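/- (Wright's extension theorem.) Let H be a complex Hilbert space which is either infinite dimensional or of finite dimension greater than two, and let d be a decoherence functional on H. Then there exists a bounded bilinear form D : B(H) × B(H) → ℂ (i.e. a map, ℂ-linear in each argument, with |D(x,y)| ≤ C‖x‖‖y‖ for some constant C and all bounded operators x, y) such that D(p,q) = d(p,q) for all projections p, q, if and only if d is bounded. Moreover, when d is bounded such an extension D is unique. -/

import Mathlib

variable {H : Type*} [NormedAddCommGroup H] [InnerProductSpace ℂ H] [CompleteSpace H]

/-- A bounded bilinear form on `B(H)` extending the functional `d` on pairs of
projections. -/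
def IsBoundedBilinearExtension (d D : (H →L[ℂ] H) → (H →L[ℂ] H) → ℂ) : Prop :=
  (∀ x x' y : H →L[ℂ] H, D (x + x') y = D x y + D x' y) ∧
  (∀ (c : ℂ) (x y : H →L[ℂ] H), D (c • x) y = c * D x y) ∧
  (∀ x y y' : H →L[ℂ] H, D x (y + y') = D x y + D x y') ∧
  (∀ (c : ℂ) (x y : H →L[ℂ] H), D x (c • y) = c * D x y) ∧
  (∃ C : ℝ, ∀ x y : H →L[ℂ] H, ‖D x y‖ ≤ C * ‖x‖ * ‖y‖) ∧
  (∀ p q : H →L[ℂ] H, IsSelfAdjoint p → p * p = p → IsSelfAdjoint q → q * q = q →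
    D p q = d p q)

open Filter Topology

/-- A degree-zero homogeneous frame function of three real variables: its values at two
orthogonal nonzero vectors have a sum depending only on the plane they span. -/
structure IsFrameFn3 (F : ℝ → ℝ → ℝ → ℝ) : Prop where
  smul : ∀ c x y z : ℝ, c ≠ 0 → F (c * x) (c * y) (c * z) = F x y z
  rot : ∀ x₁ x₂ x₃ y₁ y₂ y₃ a b : ℝ, 0 < x₁ ^ 2 + x₂ ^ 2 + x₃ ^ 2 →
    0 < y₁ ^ 2 + y₂ ^ 2 + y₃ ^ 2 → x₁ * y₁ + x₂ * y₂ + x₃ * y₃ = 0 → 0 < a ^ 2 + b ^ 2 →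
    F (a * x₁ + b * y₁) (a * x₂ + b * y₂) (a * x₃ + b * y₃) +
      F (-(b * (y₁ ^ 2 + y₂ ^ 2 + y₃ ^ 2)) * x₁ + a * (x₁ ^ 2 + x₂ ^ 2 + x₃ ^ 2) * y₁)
        (-(b * (y₁ ^ 2 + y₂ ^ 2 + y₃ ^ 2)) * x₂ + a * (x₁ ^ 2 + x₂ ^ 2 + x₃ ^ 2) * y₂)
        (-(b * (y₁ ^ 2 + y₂ ^ 2 + y₃ ^ 2)) * x₃ + a * (x₁ ^ 2 + x₂ ^ 2 + x₃ ^ 2) * y₃) =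
      F x₁ x₂ x₃ + F y₁ y₂ y₃

namespace IsFrameFn3

variable {F F' : ℝ → ℝ → ℝ → ℝ}

lemma pair (h : IsFrameFn3 F) {x₁ x₂ x₃ y₁ y₂ y₃ u₁ u₂ u₃ w₁ w₂ w₃ : ℝ} (a b k : ℝ)
    (hx : 0 < x₁ ^ 2 + x₂ ^ 2 + x₃ ^ 2) (hy : 0 < y₁ ^ 2 + y₂ ^ 2 + y₃ ^ 2)
    (hxy : x₁ * y₁ + x₂ * y₂ + x₃ * y₃ = 0) (hab : 0 < a ^ 2 + b ^ 2) (hk : k ≠ 0)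
    (hu₁ : u₁ = a * x₁ + b * y₁) (hu₂ : u₂ = a * x₂ + b * y₂) (hu₃ : u₃ = a * x₃ + b * y₃)
    (hw₁ : k * w₁ =
      -(b * (y₁ ^ 2 + y₂ ^ 2 + y₃ ^ 2)) * x₁ + a * (x₁ ^ 2 + x₂ ^ 2 + x₃ ^ 2) * y₁)
    (hw₂ : k * w₂ =
      -(b * (y₁ ^ 2 + y₂ ^ 2 + y₃ ^ 2)) * x₂ + a * (x₁ ^ 2 + x₂ ^ 2 + x₃ ^ 2) * y₂)
    (hw₃ : k * w₃ =
      -(b * (y₁ ^ 2 + y₂ ^ 2 + y₃ ^ 2)) * x₃ + a * (x₁ ^ 2 + x₂ ^ 2 + x₃ ^ 2) * y₃) :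
    F u₁ u₂ u₃ + F w₁ w₂ w₃ = F x₁ x₂ x₃ + F y₁ y₂ y₃ := by
  have := h.rot _ _ _ _ _ _ a b hx hy hxy hab
  rwa [← hw₁, ← hw₂, ← hw₃, h.smul _ _ _ _ hk, ← hu₁, ← hu₂, ← hu₃] at this

lemma add (h : IsFrameFn3 F) (h' : IsFrameFn3 F') :
    IsFrameFn3 (fun x y z => F x y z + F' x y z) where
  smul c x y z hc := by rw [h.smul c x y z hc, h'.smul c x y z hc]
  rot x₁ x₂ x₃ y₁ y₂ y₃ a b hx hy hxy hab := by
    linarith [h.rot _ _ _ _ _ _ a b hx hy hxy hab, h'.rot _ _ _ _ _ _ a b hx hy hxy hab]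

lemma neg (h : IsFrameFn3 F) : IsFrameFn3 (fun x y z => -F x y z) where
  smul c x y z hc := by rw [h.smul c x y z hc]
  rot x₁ x₂ x₃ y₁ y₂ y₃ a b hx hy hxy hab := by
    linarith [h.rot _ _ _ _ _ _ a b hx hy hxy hab]

lemma quarterTurn (h : IsFrameFn3 F) : IsFrameFn3 (fun x y z => F (-y) x z) where
  smul c x y z hc := by
    have := h.smul c (-y) x z hc
    rwa [mul_neg] at this
  rot x₁ x₂ x₃ y₁ y₂ y₃ a b hx hy hxy hab := by
    refine h.pair (x₁ := -x₂) (y₁ := -y₂) a b 1 (by linarith) (by linarith) (by linarith) hab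
      one_ne_zero ?_ ?_ ?_ ?_ ?_ ?_ <;> ring

/-- The sum of a frame function and its quarter turn about the third axis, on the affine
plane at height one. -/
noncomputable def avg (F : ℝ → ℝ → ℝ → ℝ) (ζ : ℂ) : ℝ :=
  F ζ.re ζ.im 1 + F (-ζ.im) ζ.re 1

lemma add_quarterTurn_equator (h : IsFrameFn3 F) {x y : ℝ} (hxy : 0 < x ^ 2 + y ^ 2) :
    F x y 0 + F (-y) x 0 = F 1 0 0 + F 0 1 0 :=
  h.pair x y 1 (by norm_num) (by norm_num) (by norm_num) hxy one_ne_zero (by ring) (by ring)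
    (by ring) (by ring) (by ring) (by ring)

lemma add_meridian (h : IsFrameFn3 F) {x y : ℝ} (z : ℝ) (hxy : 0 < x ^ 2 + y ^ 2) :
    F x y z + F (-(z * x)) (-(z * y)) (x ^ 2 + y ^ 2) = F x y 0 + F 0 0 1 :=
  h.pair 1 z 1 (by linarith) (by norm_num) (by norm_num) (by positivity) one_ne_zero (by ring)
    (by ring) (by ring) (by ring) (by ring) (by ring)

lemma sum_meridian (h : IsFrameFn3 F) {x y : ℝ} (z : ℝ) (hxy : 0 < x ^ 2 + y ^ 2) :
    (F x y z + F (-y) x z) +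
      (F (-(z * x)) (-(z * y)) (x ^ 2 + y ^ 2) + F (z * y) (-(z * x)) (x ^ 2 + y ^ 2)) =
      F 1 0 0 + F 0 1 0 + 2 * F 0 0 1 := by
  have h1 := h.add_meridian z hxy
  have h2 := h.add_meridian (x := -y) (y := x) z (by linarith)
  have h3 := h.add_quarterTurn_equator hxy
  rw [show -(z * -y) = z * y by ring, show (-y) ^ 2 + x ^ 2 = x ^ 2 + y ^ 2 by ring] at h2
  linarith

lemma sum_quarterTurn_ge (h : IsFrameFn3 F) {M η : ℝ}
    (hM : ∀ x y z : ℝ, 0 < x ^ 2 + y ^ 2 + z ^ 2 → F x y z ≤ M) (hη : M - η ≤ F 0 0 1)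
    {x y : ℝ} (z : ℝ) (hxy : 0 < x ^ 2 + y ^ 2) :
    F 1 0 0 + F 0 1 0 - 2 * η ≤ F x y z + F (-y) x z := by
  have h1 := h.sum_meridian z hxy
  have h2 := hM (-(z * x)) (-(z * y)) (x ^ 2 + y ^ 2) (by positivity)
  have h3 := hM (z * y) (-(z * x)) (x ^ 2 + y ^ 2) (by positivity)
  linarith

lemma normSq_pos_of_ne {ζ : ℂ} (hζ : ζ ≠ 0) : 0 < ζ.re ^ 2 + ζ.im ^ 2 := by
  have := Complex.normSq_pos.2 hζ
  rw [Complex.normSq_apply] at this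
  nlinarith

lemma avg_mul_le (h : IsFrameFn3 F) {M η : ℝ}
    (hM : ∀ x y z : ℝ, 0 < x ^ 2 + y ^ 2 + z ^ 2 → F x y z ≤ M) (hη : M - η ≤ F 0 0 1)
    {ζ : ℂ} (hζ : ζ ≠ 0) (τ : ℝ) :
    avg F (ζ * (1 + τ * Complex.I)) ≤ avg F ζ + 2 * η := by
  have hp := normSq_pos_of_ne hζ
  set x := ζ.re
  set y := ζ.im
  have hre : (ζ * (1 + τ * Complex.I)).re = x - τ * y := by simp [x, y]; ring
  have him : (ζ * (1 + τ * Complex.I)).im = y + τ * x := by simp [x, y]; ring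
  have hg := h.add h.quarterTurn
  have h1 := hg.rot x y 1 (-y) x 0 1 τ (by positivity) (by linarith) (by ring) (by positivity)
  have h2 := h.add_quarterTurn_equator (x := -y) (y := x) (by linarith)
  set X := -(τ * ((-y) ^ 2 + x ^ 2 + 0 ^ 2)) * x + 1 * (x ^ 2 + y ^ 2 + 1 ^ 2) * -y
  set Y := -(τ * ((-y) ^ 2 + x ^ 2 + 0 ^ 2)) * y + 1 * (x ^ 2 + y ^ 2 + 1 ^ 2) * x
  have h3 := h.sum_quarterTurn_ge hM hη (x := X) (y := Y)
    (-(τ * ((-y) ^ 2 + x ^ 2 + 0 ^ 2)) * 1 + 1 * (x ^ 2 + y ^ 2 + 1 ^ 2) * 0) (by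
      have : X ^ 2 + Y ^ 2 = (x ^ 2 + y ^ 2) *
        ((τ * (y ^ 2 + x ^ 2)) ^ 2 + (x ^ 2 + y ^ 2 + 1) ^ 2) := by ring
      rw [this]; positivity)
  unfold avg
  rw [hre, him]
  have e1 : (1:ℝ) * x + τ * -y = x - τ * y := by ring
  have e2 : (1:ℝ) * y + τ * x = y + τ * x := by ring
  have e3 : (1:ℝ) * 1 + τ * 0 = 1 := by ring
  simp only [e1, e2, e3] at h1
  linarith

lemma exists_factor {l : ℂ} (hl : 4 ≤ ‖l‖) : ∃ τ σ : ℝ,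
    l = (1 + τ * Complex.I) ^ 4 * ((1 + σ * Complex.I) * (1 + (-σ : ℝ) * Complex.I)) := by
  set φ := l.arg / 4 with hφ
  have h1 : |φ| ≤ Real.pi / 4 := by
    have := Complex.abs_arg_le_pi l
    rw [hφ, abs_div, abs_of_pos (by norm_num : (0:ℝ) < 4)]
    linarith
  have hc : √2 / 2 ≤ Real.cos φ := by
    rw [← Real.cos_pi_div_four, ← Real.cos_abs φ]
    exact Real.cos_le_cos_of_nonneg_of_le_pi (abs_nonneg _) (by linarith [Real.pi_pos]) h1
  have hs2 : √2 * √2 = 2 := Real.mul_self_sqrt (by norm_num)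
  have hpos : 0 < Real.cos φ := lt_of_lt_of_le (by positivity) hc
  have hc2 : 1 / 2 ≤ Real.cos φ ^ 2 := by nlinarith [Real.sqrt_nonneg 2]
  have hc4 : 1 ≤ ‖l‖ * Real.cos φ ^ 4 := by
    have : 1 / 4 ≤ Real.cos φ ^ 4 := by nlinarith
    nlinarith
  refine ⟨Real.tan φ, √(‖l‖ * Real.cos φ ^ 4 - 1), ?_⟩
  set σ := √(‖l‖ * Real.cos φ ^ 4 - 1)
  have hσ : σ ^ 2 = ‖l‖ * Real.cos φ ^ 4 - 1 := Real.sq_sqrt (by linarith)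
  have hσ' : (1 + σ * Complex.I) * (1 + (-σ : ℝ) * Complex.I) =
      (‖l‖ : ℂ) * (Real.cos φ : ℂ) ^ 4 := by
    have : ((σ ^ 2 : ℝ) : ℂ) = ((‖l‖ * Real.cos φ ^ 4 - 1 : ℝ) : ℂ) := by rw [hσ]
    push_cast at this ⊢
    linear_combination this - σ ^ 2 * Complex.I_sq
  have hcne : (Real.cos φ : ℂ) ≠ 0 := by exact_mod_cast hpos.ne'
  have ht : (1 + Real.tan φ * Complex.I : ℂ) * Real.cos φ = Complex.exp (φ * Complex.I) := by
    rw [Complex.exp_mul_I, ← Complex.ofReal_cos, ← Complex.ofReal_sin, Real.tan_eq_sin_div_cos]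
    push_cast at hcne ⊢
    field_simp
  have he : Complex.exp (φ * Complex.I) ^ 4 = Complex.exp (l.arg * Complex.I) := by
    rw [← Complex.exp_nat_mul]
    congr 1
    rw [hφ]
    push_cast
    ring
  rw [hσ']
  calc l = ‖l‖ * Complex.exp (l.arg * Complex.I) := (Complex.norm_mul_exp_arg_mul_I l).symm
    _ = _ := by rw [← he, ← ht]; ring

lemma avg_mul_le_of_four_le (h : IsFrameFn3 F) {M η : ℝ}
    (hM : ∀ x y z : ℝ, 0 < x ^ 2 + y ^ 2 + z ^ 2 → F x y z ≤ M) (hη : M - η ≤ F 0 0 1)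
    {ζ : ℂ} (hζ : ζ ≠ 0) {l : ℂ} (hl : 4 ≤ ‖l‖) :
    avg F (ζ * l) ≤ avg F ζ + 12 * η := by
  obtain ⟨τ, σ, rfl⟩ := exists_factor hl
  have hne : ∀ t : ℝ, (1 + t * Complex.I : ℂ) ≠ 0 := fun t ht => by
    have := congrArg Complex.re ht
    simp at this
  have s1 := h.avg_mul_le hM hη hζ τ
  have z1 := mul_ne_zero hζ (hne τ)
  have s2 := h.avg_mul_le hM hη z1 τ
  have z2 := mul_ne_zero z1 (hne τ)
  have s3 := h.avg_mul_le hM hη z2 τ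
  have z3 := mul_ne_zero z2 (hne τ)
  have s4 := h.avg_mul_le hM hη z3 τ
  have z4 := mul_ne_zero z3 (hne τ)
  have s5 := h.avg_mul_le hM hη z4 σ
  have z5 := mul_ne_zero z4 (hne σ)
  have s6 := h.avg_mul_le hM hη z5 (-σ)
  have e : ζ * ((1 + τ * Complex.I) ^ 4 * ((1 + σ * Complex.I) * (1 + (-σ : ℝ) * Complex.I))) =
    ζ * (1 + τ * Complex.I) * (1 + τ * Complex.I) * (1 + τ * Complex.I) * (1 + τ * Complex.I) *
     (1 + σ * Complex.I) * (1 + (-σ : ℝ) * Complex.I) := by ring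
  rw [e]
  linarith

/-- The orthogonal vectors `(u(x ± iy), 1)` with `y² = 1 + x²`. -/
lemma avg_add_avg (h : IsFrameFn3 F) {u : ℂ} (hu : ‖u‖ = 1) {x y : ℝ} (hy : y ^ 2 = 1 + x ^ 2) :
    avg F (u * (x + y * Complex.I)) + avg F (u * (x - y * Complex.I)) =
      avg F (u * x) + (F 1 0 0 + F 0 1 0) := by
  have hu2 : u.re ^ 2 + u.im ^ 2 = 1 := by
    have := Complex.sq_norm u
    rw [hu, Complex.normSq_apply] at this
    linarith
  have hg := h.add h.quarterTurn
  set c := u.re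
  set s := u.im
  have hq : ∀ t : ℝ, (c * x - s * t) ^ 2 + (c * t + s * x) ^ 2 = x ^ 2 + t ^ 2 := fun t => by
    linear_combination (x ^ 2 + t ^ 2) * hu2
  have hy0 : y ≠ 0 := by
    rintro rfl
    nlinarith
  have h1 := hg.pair (u₁ := c * x) (u₂ := s * x) (u₃ := 1) (w₁ := -s) (w₂ := c) (w₃ := 0)
    (x₁ := c * x - s * y) (x₂ := c * y + s * x) (x₃ := 1) (y₁ := c * x + s * y)
    (y₂ := - c * y + s * x) (y₃ := 1) (1/2) (1/2) (-y * (1 + x ^ 2 + y ^ 2))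
    (by positivity) (by positivity)
    (by linear_combination (x ^ 2 - y ^ 2) * hu2 - hy) (by norm_num)
    (mul_ne_zero (neg_ne_zero.2 hy0) (by positivity))
    (by ring) (by ring) (by ring)
    (by linear_combination (-(x ^ 2 + y ^ 2) * s * y) * hu2)
    (by linear_combination ((x ^ 2 + y ^ 2) * c * y) * hu2)
    (by ring)
  have h2 := h.add_quarterTurn_equator (x := -s) (y := c) (by nlinarith)
  have e1 : (u * (x + y * Complex.I)).re = c * x - s * y := by simp [c, s]
  have e2 : (u * (x + y * Complex.I)).im = c * y + s * x := by simp [c, s]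
  have e3 : (u * (x - y * Complex.I)).re = c * x + s * y := by simp [c, s]
  have e4 : (u * (x - y * Complex.I)).im = -c * y + s * x := by simp [c, s]
  have e5 : (u * x).re = c * x := by simp [c]
  have e6 : (u * x).im = s * x := by simp [s]
  unfold avg
  rw [e1, e2, e3, e4, e5, e6]
  linarith

lemma avg_zero (F : ℝ → ℝ → ℝ → ℝ) : avg F 0 = 2 * F 0 0 1 := by
  simp [avg, two_mul]

lemma avg_add_avg_neg_inv (h : IsFrameFn3 F) {ζ : ℂ} (hζ : ζ ≠ 0) :
    avg F ζ + avg F (-(ζ / ((‖ζ‖ ^ 2 : ℝ) : ℂ))) = F 1 0 0 + F 0 1 0 + 2 * F 0 0 1 := by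
  have hp := normSq_pos_of_ne hζ
  have hn : ‖ζ‖ ^ 2 = ζ.re ^ 2 + ζ.im ^ 2 := by
    rw [Complex.sq_norm, Complex.normSq_apply]; ring
  have h1 := h.sum_meridian 1 hp
  have hre : (-(ζ / ((‖ζ‖ ^ 2 : ℝ) : ℂ))).re = -(ζ.re / ‖ζ‖ ^ 2) := by
    rw [Complex.neg_re, Complex.div_ofReal_re]
  have him : (-(ζ / ((‖ζ‖ ^ 2 : ℝ) : ℂ))).im = -(ζ.im / ‖ζ‖ ^ 2) := by
    rw [Complex.neg_im, Complex.div_ofReal_im]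
  unfold avg
  rw [hre, him, hn]
  set N := ζ.re ^ 2 + ζ.im ^ 2
  have h2 := h.smul N⁻¹ (-(1 * ζ.re)) (-(1 * ζ.im)) N (inv_ne_zero hp.ne')
  have h3 := h.smul N⁻¹ (1 * ζ.im) (-(1 * ζ.re)) N (inv_ne_zero hp.ne')
  rw [inv_mul_cancel₀ hp.ne'] at h2 h3
  have e1 : N⁻¹ * -(1 * ζ.re) = -(ζ.re / N) := by ring
  have e2 : N⁻¹ * -(1 * ζ.im) = -(ζ.im / N) := by ring
  have e3 : N⁻¹ * (1 * ζ.im) = -(-(ζ.im / N)) := by ring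
  rw [e1, e2] at h2
  rw [e1, e3] at h3
  rw [h2, h3]
  exact h1

lemma avg_le_two_mul {M : ℝ} (hM : ∀ x y z : ℝ, 0 < x ^ 2 + y ^ 2 + z ^ 2 → F x y z ≤ M)
    (ζ : ℂ) : avg F ζ ≤ 2 * M := by
  have h1 := hM ζ.re ζ.im 1 (by positivity)
  have h2 := hM (-ζ.im) ζ.re 1 (by positivity)
  unfold avg
  linarith

lemma avg_le_of_pow_le (h : IsFrameFn3 F) {M η : ℝ}
    (hM : ∀ x y z : ℝ, 0 < x ^ 2 + y ^ 2 + z ^ 2 → F x y z ≤ M) (hη : M - η ≤ F 0 0 1)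
    (hη0 : 0 ≤ η) (k : ℕ) : ∀ ζ : ℂ, (8 : ℝ) ^ k ≤ ‖ζ‖ →
      avg F ζ - (F 1 0 0 + F 0 1 0) ≤ (2 * M - (F 1 0 0 + F 0 1 0)) / 2 ^ k + 24 * η := by
  induction k with
  | zero =>
    intro ζ _
    have := avg_le_two_mul hM ζ
    norm_num
    linarith
  | succ k ih =>
    intro ζ hζ
    have h8 : (1 : ℝ) ≤ 8 ^ k := one_le_pow₀ (by norm_num)
    rw [pow_succ] at hζ
    have hpos : 0 < ‖ζ‖ := by linarith
    set x := ‖ζ‖ / 8 with hx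
    have hx1 : (8 : ℝ) ^ k ≤ x := by rw [hx]; linarith
    have hζ0 : ζ ≠ 0 := norm_pos_iff.1 hpos
    set u : ℂ := ζ / ‖ζ‖ with hu
    have hu1 : ‖u‖ = 1 := by
      rw [hu, norm_div, Complex.norm_real, norm_norm, div_self hpos.ne']
    set y := √(1 + x ^ 2)
    have hy : y ^ 2 = 1 + x ^ 2 := Real.sq_sqrt (by positivity)
    have h1 := h.avg_add_avg hu1 hy
    have hux : ‖u * (x : ℂ)‖ = x := by
      rw [norm_mul, hu1, one_mul, Complex.norm_real, Real.norm_of_nonneg (by linarith)]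
    have h2 := ih (u * x) (by rw [hux]; exact hx1)
    have key : ∀ w : ℂ, ‖w‖ ^ 2 = x ^ 2 + y ^ 2 → avg F ζ ≤ avg F w + 12 * η := by
      intro w hw
      have hw0 : 0 < ‖w‖ := by
        by_contra hcon
        have : ‖w‖ = 0 := le_antisymm (not_lt.1 hcon) (norm_nonneg _)
        rw [this] at hw
        nlinarith
      have hwne : w ≠ 0 := norm_pos_iff.1 hw0
      have h4 : 4 ≤ ‖ζ / w‖ := by
        rw [norm_div, le_div_iff₀ hw0]
        apply le_of_sq_le_sq _ hpos.le
        nlinarith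
      have := h.avg_mul_le_of_four_le hM hη hwne h4
      rwa [mul_div_cancel₀ _ hwne] at this
    have n1 : ‖u * (x + y * Complex.I)‖ ^ 2 = x ^ 2 + y ^ 2 := by
      rw [norm_mul, hu1, one_mul, Complex.sq_norm, Complex.normSq_add_mul_I]
    have n2 : ‖u * (x - y * Complex.I)‖ ^ 2 = x ^ 2 + y ^ 2 := by
      rw [norm_mul, hu1, one_mul, Complex.sq_norm]
      have := Complex.normSq_add_mul_I x (-y)
      rw [neg_sq] at this
      rw [← this]
      push_cast
      ring_nf
    have k1 := key _ n1
    have k2 := key _ n2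
    have e : (2 * M - (F 1 0 0 + F 0 1 0)) / 2 ^ (k + 1) =
      (2 * M - (F 1 0 0 + F 0 1 0)) / 2 ^ k / 2 := by rw [pow_succ]; field_simp
    rw [e]
    linarith

/-- A frame function is nearly maximal in a whole neighbourhood of a near maximizer. -/
lemma near_max (h : IsFrameFn3 F) {M η : ℝ}
    (hM : ∀ x y z : ℝ, 0 < x ^ 2 + y ^ 2 + z ^ 2 → F x y z ≤ M) (hη : M - η ≤ F 0 0 1)
    (hη0 : 0 ≤ η) (k : ℕ) {x y z : ℝ} (hz : 0 < z) (hxy : 8 ^ k * √(x ^ 2 + y ^ 2) ≤ z) :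
    M - 26 * η - (2 * M - (F 1 0 0 + F 0 1 0)) / 2 ^ k ≤ F x y z := by
  have hm1 := hM 1 0 0 (by norm_num)
  have hm2 := hM 0 1 0 (by norm_num)
  have hT : 0 ≤ (2 * M - (F 1 0 0 + F 0 1 0)) / 2 ^ k := div_nonneg (by linarith) (by positivity)
  have hs := h.smul z⁻¹ x y z (inv_ne_zero hz.ne')
  rw [inv_mul_cancel₀ hz.ne'] at hs
  rw [← hs]
  set ζ : ℂ := ⟨z⁻¹ * x, z⁻¹ * y⟩ with hζ
  by_cases h0 : ζ = 0
  · have e1 : z⁻¹ * x = 0 := congrArg Complex.re h0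
    have e2 : z⁻¹ * y = 0 := congrArg Complex.im h0
    rw [e1, e2]
    linarith
  have hpos : 0 < ‖ζ‖ := norm_pos_iff.2 h0
  have hn : ‖ζ‖ = z⁻¹ * √(x ^ 2 + y ^ 2) := by
    rw [Complex.norm_def, Complex.normSq_mk,
      show z⁻¹ * x * (z⁻¹ * x) + z⁻¹ * y * (z⁻¹ * y) = z⁻¹ ^ 2 * (x ^ 2 + y ^ 2) by ring,
      Real.sqrt_mul (by positivity), Real.sqrt_sq (by positivity)]
  have hle : 8 ^ k * ‖ζ‖ ≤ 1 := by
    rw [hn]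
    calc 8 ^ k * (z⁻¹ * √(x ^ 2 + y ^ 2)) = z⁻¹ * (8 ^ k * √(x ^ 2 + y ^ 2)) := by ring
      _ ≤ z⁻¹ * z := by gcongr
      _ = 1 := inv_mul_cancel₀ hz.ne'
  have h1 := h.avg_add_avg_neg_inv h0
  have hn' : ‖-(ζ / ((‖ζ‖ ^ 2 : ℝ) : ℂ))‖ = ‖ζ‖⁻¹ := by
    rw [norm_neg, norm_div, Complex.norm_real, Real.norm_of_nonneg (by positivity)]
    field_simp
  have h2 := h.avg_le_of_pow_le hM hη hη0 k (-(ζ / ((‖ζ‖ ^ 2 : ℝ) : ℂ))) (by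
    rw [hn', ← one_div, le_div_iff₀ hpos]
    exact hle)
  have h3 := hM (-(z⁻¹ * y)) (z⁻¹ * x) 1 (by positivity)
  have h4 : avg F ζ = F (z⁻¹ * x) (z⁻¹ * y) 1 + F (-(z⁻¹ * y)) (z⁻¹ * x) 1 := rfl
  linarith

lemma avg_rotate_le (h : IsFrameFn3 F) (hc : Continuous (avg F)) {M : ℝ}
    (hM : ∀ x y z : ℝ, 0 < x ^ 2 + y ^ 2 + z ^ 2 → F x y z ≤ M) (hp : F 0 0 1 = M)
    {ζ : ℂ} (hζ : ζ ≠ 0) (θ : ℝ) :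
    avg F (ζ * Complex.exp (θ * Complex.I)) ≤ avg F ζ := by
  have hne : ∀ t : ℝ, (1 + t * Complex.I : ℂ) ≠ 0 := fun t ht => by
    have := congrArg Complex.re ht
    simp at this
  have h1 : ∀ (τ : ℝ) (n : ℕ), avg F (ζ * (1 + τ * Complex.I) ^ n) ≤ avg F ζ := by
    intro τ n
    induction n with
    | zero => simp
    | succ n ih =>
      have := h.avg_mul_le hM (η := 0) (by linarith)
        (mul_ne_zero hζ (pow_ne_zero n (hne τ))) τ
      rw [pow_succ, ← mul_assoc]
      linarith
  have h2 := Complex.tendsto_one_add_div_pow_exp (θ * Complex.I)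
  have h3 := (hc.tendsto _).comp (h2.const_mul ζ)
  refine le_of_tendsto h3 (Eventually.of_forall fun n => ?_)
  have := h1 (θ / n) n
  have e : (θ * Complex.I / n : ℂ) = ((θ / n : ℝ) : ℂ) * Complex.I := by
    push_cast
    ring
  simp only [Function.comp, e]
  exact this

lemma avg_radial (h : IsFrameFn3 F) (hc : Continuous (avg F)) {M : ℝ}
    (hM : ∀ x y z : ℝ, 0 < x ^ 2 + y ^ 2 + z ^ 2 → F x y z ≤ M) (hp : F 0 0 1 = M)
    (ζ : ℂ) : avg F ζ = avg F (‖ζ‖ : ℂ) := by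
  by_cases hζ : ζ = 0
  · simp [hζ]
  have h1 := h.avg_rotate_le hc hM hp hζ (-ζ.arg)
  have h2 := h.avg_rotate_le hc hM hp (ζ := (‖ζ‖ : ℂ)) (by simpa using hζ) ζ.arg
  rw [Complex.norm_mul_exp_arg_mul_I] at h2
  have h3 : ζ * Complex.exp ((-ζ.arg : ℝ) * Complex.I) = (‖ζ‖ : ℂ) := by
    conv_lhs => rw [← Complex.norm_mul_exp_arg_mul_I ζ]
    rw [mul_assoc, Complex.norm_mul_exp_arg_mul_I, ← Complex.exp_add]
    push_cast
    rw [← add_mul, add_neg_cancel, zero_mul, Complex.exp_zero, mul_one]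
  rw [h3] at h1
  exact le_antisymm h2 h1

lemma avg_eq (h : IsFrameFn3 F) (hc : Continuous (avg F)) {M B : ℝ}
    (hM : ∀ x y z : ℝ, 0 < x ^ 2 + y ^ 2 + z ^ 2 → F x y z ≤ M) (hp : F 0 0 1 = M)
    (hB : ∀ ζ, |avg F ζ| ≤ B) (ζ : ℂ) :
    avg F ζ = (F 1 0 0 + F 0 1 0) + (2 * M - (F 1 0 0 + F 0 1 0)) / (1 + ‖ζ‖ ^ 2) := by
  set m := F 1 0 0 + F 0 1 0 with hm
  set T := 2 * M - m with hT
  set D : ℝ → ℝ := fun r => avg F (r : ℂ) - m - T / (1 + r ^ 2) with hD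
  have hrad := h.avg_radial hc hM hp
  have d1 : ∀ r, 1 ≤ r → 2 * D r = D (√((r ^ 2 - 1) / 2)) := by
    intro r hr
    set x := √((r ^ 2 - 1) / 2) with hx
    have hx2 : x ^ 2 = (r ^ 2 - 1) / 2 := Real.sq_sqrt (by nlinarith)
    set y := √(1 + x ^ 2)
    have hy : y ^ 2 = 1 + x ^ 2 := Real.sq_sqrt (by positivity)
    have h1 := h.avg_add_avg (u := 1) (by simp) hy
    have hxy : x ^ 2 + y ^ 2 = r ^ 2 := by rw [hy, hx2]; ring
    have n1 : ‖(1 : ℂ) * (x + y * Complex.I)‖ = r := by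
      rw [one_mul, Complex.norm_add_mul_I, hxy, Real.sqrt_sq (by linarith)]
    have n2 : ‖(1 : ℂ) * (x - y * Complex.I)‖ = r := by
      have := Complex.norm_add_mul_I x (-y)
      rw [neg_sq, hxy, Real.sqrt_sq (by linarith)] at this
      rw [one_mul, ← this]
      push_cast
      ring_nf
    rw [hrad, n1, hrad (1 * (_ - _)), n2, one_mul] at h1
    have e : (r ^ 2 - 1) / 2 + 1 = (1 + r ^ 2) / 2 := by ring
    simp only [hD]
    rw [hx2, show 1 + (r ^ 2 - 1) / 2 = (1 + r ^ 2) / 2 by ring]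
    have e2 : T / ((1 + r ^ 2) / 2) = 2 * (T / (1 + r ^ 2)) := by
      field_simp
    rw [e2]
    linarith
  have d0 : D 0 = 0 := by
    simp only [hD, Complex.ofReal_zero, avg_zero, hp, hT]
    ring
  have d2 : ∀ r, 0 < r → D r = -D r⁻¹ := by
    intro r hr
    have h1 := h.avg_add_avg_neg_inv (ζ := (r : ℂ)) (by exact_mod_cast hr.ne')
    have n1 : ‖-((r : ℂ) / ((‖(r : ℂ)‖ ^ 2 : ℝ) : ℂ))‖ = r⁻¹ := by
      rw [norm_neg, norm_div, Complex.norm_real, Complex.norm_real, norm_pow, norm_norm,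
        Real.norm_of_nonneg hr.le]
      field_simp
    rw [hrad (-_), n1, hp] at h1
    simp only [hD]
    have e : T / (1 + r ^ 2) + T / (1 + r⁻¹ ^ 2) = T := by
      field_simp
      ring
    linarith
  have bound : ∀ k : ℕ, ∀ r, 0 ≤ r → |D r| ≤ (B + |m| + |T|) / 2 ^ k := by
    intro k
    induction k with
    | zero =>
      intro r _
      have h1 := hB (r : ℂ)
      have h2 : |T / (1 + r ^ 2)| ≤ |T| := by
        rw [abs_div, abs_of_pos (by positivity : 0 < 1 + r ^ 2)]
        exact div_le_self (abs_nonneg _) (by nlinarith)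
      simp only [hD]
      have h3 := abs_sub (avg F (r : ℂ) - m) (T / (1 + r ^ 2))
      have h4 := abs_sub (avg F (r : ℂ)) m
      rw [pow_zero, div_one]
      linarith
    | succ k ih =>
      have big : ∀ r, 1 ≤ r → |D r| ≤ (B + |m| + |T|) / 2 ^ (k + 1) := by
        intro r hr
        have h1 := ih (√((r ^ 2 - 1) / 2)) (Real.sqrt_nonneg _)
        rw [← d1 r hr, abs_mul, abs_two] at h1
        rw [pow_succ, ← div_div]
        linarith
      intro r hr
      rcases le_or_gt 1 r with h1 | h1
      · exact big r h1
      rcases hr.eq_or_lt with h2 | h2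
      · rw [← h2, d0, abs_zero]
        exact (abs_nonneg _).trans (big 1 le_rfl)
      · rw [d2 r h2, abs_neg]
        exact big _ (by rw [le_inv_comm₀ one_pos h2, inv_one]; exact h1.le)
  have hz : D ‖ζ‖ = 0 := by
    rw [← abs_nonpos_iff]
    have ht : Tendsto (fun k : ℕ => (B + |m| + |T|) / 2 ^ k) atTop (𝓝 0) :=
      tendsto_const_nhds.div_atTop (tendsto_pow_atTop_atTop_of_one_lt (by norm_num))
    exact ge_of_tendsto' ht fun k => bound k _ (norm_nonneg _)
  rw [hrad]
  simp only [hD] at hz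
  linarith

/-- At a maximizer, the average over a quarter turn is a Rayleigh quotient. -/
lemma add_quarterTurn_eq (h : IsFrameFn3 F) (hc : Continuous (avg F)) {M B : ℝ}
    (hM : ∀ x y z : ℝ, 0 < x ^ 2 + y ^ 2 + z ^ 2 → F x y z ≤ M) (hp : F 0 0 1 = M)
    (hB : ∀ ζ, |avg F ζ| ≤ B) {x y z : ℝ} (hs : 0 < x ^ 2 + y ^ 2 + z ^ 2) :
    F x y z + F (-y) x z =
      ((F 1 0 0 + F 0 1 0) * (x ^ 2 + y ^ 2) + 2 * M * z ^ 2) / (x ^ 2 + y ^ 2 + z ^ 2) := by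
  rcases eq_or_ne z 0 with rfl | hz
  · rw [h.add_quarterTurn_equator (by linarith)]
    field_simp
    ring
  have h1 := h.avg_eq hc hM hp hB ⟨z⁻¹ * x, z⁻¹ * y⟩
  have hs1 := h.smul z⁻¹ x y z (inv_ne_zero hz)
  have hs2 := h.smul z⁻¹ (-y) x z (inv_ne_zero hz)
  rw [inv_mul_cancel₀ hz] at hs1 hs2
  rw [Complex.sq_norm, Complex.normSq_mk] at h1
  simp only [avg] at h1
  rw [← hs1, ← hs2, mul_neg, h1]
  field_simp
  ring

end IsFrameFn3

/-- A degree-zero homogeneous frame function on a real inner product space: its values at two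
orthogonal nonzero vectors have a sum depending only on the plane they span. -/
structure IsFrameFn {E : Type*} [NormedAddCommGroup E] [InnerProductSpace ℝ E]
    (f : E → ℝ) : Prop where
  smul : ∀ (c : ℝ) (x : E), c ≠ 0 → f (c • x) = f x
  rot : ∀ x y : E, x ≠ 0 → y ≠ 0 → inner ℝ x y = 0 → ∀ a b : ℝ, (a ≠ 0 ∨ b ≠ 0) →
    f (a • x + b • y) + f ((-(b * ‖y‖ ^ 2)) • x + (a * ‖x‖ ^ 2) • y) = f x + f y

namespace IsFrameFn

variable {E : Type*} [NormedAddCommGroup E] [InnerProductSpace ℝ E] {f g : E → ℝ}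

lemma add (hf : IsFrameFn f) (hg : IsFrameFn g) : IsFrameFn (fun x => f x + g x) where
  smul c x hc := by rw [hf.smul c x hc, hg.smul c x hc]
  rot x y hx hy hxy a b hab := by
    linarith [hf.rot x y hx hy hxy a b hab, hg.rot x y hx hy hxy a b hab]

lemma const_mul (hf : IsFrameFn f) (k : ℝ) : IsFrameFn (fun x => k * f x) where
  smul c x hc := by rw [hf.smul c x hc]
  rot x y hx hy hxy a b hab := by
    rw [← mul_add, ← mul_add, hf.rot x y hx hy hxy a b hab]

lemma sq_div (φ : E →ₗ[ℝ] ℝ) : IsFrameFn (fun x => φ x ^ 2 / ‖x‖ ^ 2) where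
  smul c x hc := by
    rw [map_smul, norm_smul, smul_eq_mul, mul_pow, mul_pow, Real.norm_eq_abs, sq_abs,
      mul_div_mul_left _ _ (pow_ne_zero 2 hc)]
  rot x y hx hy hxy a b hab := by
    have n : ∀ s t : ℝ, ‖s • x + t • y‖ ^ 2 = s ^ 2 * ‖x‖ ^ 2 + t ^ 2 * ‖y‖ ^ 2 := by
      intro s t
      rw [norm_add_sq_real, inner_smul_left, inner_smul_right, hxy, norm_smul, norm_smul,
        mul_pow, mul_pow, Real.norm_eq_abs, Real.norm_eq_abs, sq_abs, sq_abs]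
      ring
    have hX : 0 < ‖x‖ ^ 2 := by positivity
    have hY : 0 < ‖y‖ ^ 2 := by positivity
    simp only [n, map_add, map_smul, smul_eq_mul]
    set X := ‖x‖ ^ 2
    set Y := ‖y‖ ^ 2
    have hN : 0 < a ^ 2 * X + b ^ 2 * Y := by
      rcases hab with h | h <;> positivity
    have e : (-(b * Y)) ^ 2 * X + (a * X) ^ 2 * Y = X * Y * (a ^ 2 * X + b ^ 2 * Y) := by ring
    rw [e]
    field_simp
    ring

section Coordinates

variable (b : OrthonormalBasis (Fin 3) ℝ E)

/-- A function of a vector, as a function of the coordinates in an orthonormal basis. -/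
noncomputable def coord (f : E → ℝ) (b : OrthonormalBasis (Fin 3) ℝ E) (x y z : ℝ) : ℝ :=
  f (x • b 0 + y • b 1 + z • b 2)

lemma inner_coord (x y z x' y' z' : ℝ) :
    inner ℝ (x • b 0 + y • b 1 + z • b 2) (x' • b 0 + y' • b 1 + z' • b 2) =
      x * x' + y * y' + z * z' := by
  have h : ∀ i j, inner ℝ (b i) (b j) = if i = j then (1:ℝ) else 0 :=
    fun i j => orthonormal_iff_ite.1 b.orthonormal i j
  simp only [inner_add_left, inner_add_right, inner_smul_left, inner_smul_right, h]
  simp [mul_comm]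

lemma norm_sq_coord (x y z : ℝ) :
    ‖x • b 0 + y • b 1 + z • b 2‖ ^ 2 = x ^ 2 + y ^ 2 + z ^ 2 := by
  rw [← real_inner_self_eq_norm_sq, inner_coord]
  ring

lemma coord_ne_zero {x y z : ℝ} (h : 0 < x ^ 2 + y ^ 2 + z ^ 2) :
    x • b 0 + y • b 1 + z • b 2 ≠ 0 := by
  intro h0
  have := norm_sq_coord b x y z
  rw [h0, norm_zero] at this
  linarith

lemma eq_coord (s : E) :
    s = inner ℝ (b 0) s • b 0 + inner ℝ (b 1) s • b 1 + inner ℝ (b 2) s • b 2 := by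
  conv_lhs => rw [← b.sum_repr' s, Fin.sum_univ_three]

lemma coord_inner (f : E → ℝ) (s : E) :
    coord f b (inner ℝ (b 0) s) (inner ℝ (b 1) s) (inner ℝ (b 2) s) = f s := by
  rw [coord, ← eq_coord]

lemma coord_frame (f : E → ℝ) : coord f b 1 0 0 = f (b 0) ∧ coord f b 0 1 0 = f (b 1) ∧
    coord f b 0 0 1 = f (b 2) := by
  simp [coord]

lemma isFrameFn3_coord (hf : IsFrameFn f) : IsFrameFn3 (coord f b) where
  smul c x y z hc := by
    simp only [coord, mul_smul, ← smul_add]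
    exact hf.smul c _ hc
  rot x₁ x₂ x₃ y₁ y₂ y₃ s t hx hy hxy hst := by
    have h1 := hf.rot _ _ (coord_ne_zero b hx) (coord_ne_zero b hy)
      (by rw [inner_coord]; exact hxy) s t (by
        by_contra hcon
        push Not at hcon
        rw [hcon.1, hcon.2] at hst
        simp at hst)
    rw [norm_sq_coord, norm_sq_coord] at h1
    simp only [coord]
    rw [← h1]
    congr 2 <;> module

lemma eq_coord' (s : E) : ∃ x y z : ℝ, s = x • b 0 + y • b 1 + z • b 2 :=
  ⟨_, _, _, eq_coord b s⟩

lemma plane (hf : IsFrameFn f) {u w : E} (hu : u ≠ 0) (hw : w ≠ 0) (huw : inner ℝ u w = 0)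
    (hu2 : inner ℝ (b 2) u = 0) (hw2 : inner ℝ (b 2) w = 0) :
    f u + f w = f (b 0) + f (b 1) := by
  have h := hf.isFrameFn3_coord b
  rw [← coord_inner b f u, ← coord_inner b f w, hu2, hw2]
  have eu := eq_coord b u
  have ew := eq_coord b w
  rw [hu2] at eu
  rw [hw2] at ew
  set p := inner ℝ (b 0) u
  set q := inner ℝ (b 1) u
  set r := inner ℝ (b 0) w
  set s := inner ℝ (b 1) w
  rw [eu, ew, inner_coord] at huw
  have pu : 0 < p ^ 2 + q ^ 2 := by
    have := norm_sq_coord b p q 0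
    rw [← eu] at this
    have : 0 < ‖u‖ ^ 2 := by positivity
    linarith
  have pw : 0 < r ^ 2 + s ^ 2 := by
    have := norm_sq_coord b r s 0
    rw [← ew] at this
    have : 0 < ‖w‖ ^ 2 := by positivity
    linarith
  have hd : p * s - q * r ≠ 0 := by
    intro h0
    have : (p ^ 2 + q ^ 2) * (r ^ 2 + s ^ 2) = (p * r + q * s + 0 * 0) ^ 2 + (p * s - q * r) ^ 2 := by
      ring
    rw [huw, h0] at this
    nlinarith [mul_pos pu pw]
  have h1 := h.pair (x₁ := 1) (x₂ := 0) (x₃ := 0) (y₁ := 0) (y₂ := 1) (y₃ := 0)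
    (u₁ := p) (u₂ := q) (u₃ := 0) (w₁ := r) (w₂ := s) (w₃ := 0) p q
    ((p ^ 2 + q ^ 2) / (p * s - q * r)) (by norm_num) (by norm_num) (by norm_num) pu
    (div_ne_zero pu.ne' hd) (by ring) (by ring) (by ring)
    (by field_simp; linear_combination p * huw) (by field_simp; linear_combination q * huw)
    (by ring)
  rw [h1, (coord_frame b f).1, (coord_frame b f).2.1]

end Coordinates

lemma exists_basis_pair (hE : Module.finrank ℝ E = 3) {q p : E} (hq : ‖q‖ = 1)
    (hp : ‖p‖ = 1) (hqp : inner ℝ q p = 0) :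
    ∃ b : OrthonormalBasis (Fin 3) ℝ E, b 0 = q ∧ b 2 = p := by
  have : FiniteDimensional ℝ E := FiniteDimensional.of_finrank_pos (by omega)
  have ho : Orthonormal ℝ (({0, 2} : Set (Fin 3)).domRestrict (![q, 0, p] : Fin 3 → E)) := by
    have hpq : inner ℝ p q = 0 := by rw [real_inner_comm]; exact hqp
    refine ⟨?_, ?_⟩
    · rintro ⟨i, hi⟩
      rcases hi with rfl | rfl
      · exact hq
      · exact hp
    · rintro ⟨i, hi⟩ ⟨j, hj⟩ hij
      rcases hi with rfl | rfl <;> rcases hj with rfl | rfl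
      · exact absurd rfl hij
      · exact hqp
      · exact hpq
      · exact absurd rfl hij
  obtain ⟨b, hb⟩ := ho.exists_orthonormalBasis_extension_of_card_eq (by simpa using hE)
  exact ⟨b, by simpa using hb 0 (by simp), by simpa using hb 2 (by simp)⟩

lemma exists_orthogonal (hE : Module.finrank ℝ E = 3) (x y : E) :
    ∃ z : E, ‖z‖ = 1 ∧ inner ℝ x z = 0 ∧ inner ℝ y z = 0 := by
  have : FiniteDimensional ℝ E := FiniteDimensional.of_finrank_pos (by omega)
  set W := Submodule.span ℝ ({x, y} : Set E)
  have h1 : Module.finrank ℝ W ≤ 2 := by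
    classical
    have := (finrank_span_finset_le_card (R := ℝ) ({x, y} : Finset E)).trans Finset.card_le_two
    rwa [Finset.coe_pair] at this
  have h2 := W.finrank_add_finrank_orthogonal
  have h3 : Wᗮ ≠ ⊥ := by
    intro h
    rw [h, finrank_bot] at h2
    omega
  obtain ⟨z, hz, hz0⟩ := Submodule.exists_mem_ne_zero_of_ne_bot h3
  have hx := hz x (Submodule.subset_span (by simp))
  have hy := hz y (Submodule.subset_span (by simp))
  refine ⟨‖z‖⁻¹ • z, ?_, ?_, ?_⟩
  · rw [norm_smul, norm_inv, norm_norm, inv_mul_cancel₀ (norm_ne_zero_iff.2 hz0)]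
  · rw [inner_smul_right, hx, mul_zero]
  · rw [inner_smul_right, hy, mul_zero]

lemma exists_basis (hE : Module.finrank ℝ E = 3) {p : E} (hp : ‖p‖ = 1) :
    ∃ b : OrthonormalBasis (Fin 3) ℝ E, b 2 = p := by
  obtain ⟨z, hz, hpz, -⟩ := exists_orthogonal hE p p
  obtain ⟨b, -, hb⟩ := exists_basis_pair hE hz hp (by rw [real_inner_comm]; exact hpz)
  exact ⟨b, hb⟩

/-- The sum of a frame function over an orthonormal basis does not depend on the basis. -/
lemma sum_basis_eq (hE : Module.finrank ℝ E = 3) (hf : IsFrameFn f)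
    (b b' : OrthonormalBasis (Fin 3) ℝ E) :
    f (b 0) + f (b 1) + f (b 2) = f (b' 0) + f (b' 1) + f (b' 2) := by
  obtain ⟨e, he, h1, h2⟩ := exists_orthogonal hE (b 2) (b' 2)
  obtain ⟨c, hc, hc2⟩ := exists_basis_pair hE he (b.orthonormal.1 2)
    (by rw [real_inner_comm]; exact h1)
  obtain ⟨c', hc', hc2'⟩ := exists_basis_pair hE he (b'.orthonormal.1 2)
    (by rw [real_inner_comm]; exact h2)
  have ho : ∀ (a : OrthonormalBasis (Fin 3) ℝ E) {i j}, i ≠ j → inner ℝ (a i) (a j) = 0 :=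
    fun a i j hij => a.orthonormal.2 hij
  have hn : ∀ (a : OrthonormalBasis (Fin 3) ℝ E) i, a i ≠ 0 := fun a i => a.orthonormal.ne_zero i
  have k1 := hf.plane b (hn c 0) (hn c 1) (ho c (by decide)) (hc2 ▸ ho c (by decide))
    (hc2 ▸ ho c (by decide))
  have k2 := hf.plane b' (hn c' 0) (hn c' 1) (ho c' (by decide)) (hc2' ▸ ho c' (by decide))
    (hc2' ▸ ho c' (by decide))
  obtain ⟨d, hd⟩ := exists_basis hE he
  have k3 := hf.plane d (hn c 1) (hn c 2) (ho c (by decide))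
    (by rw [hd, ← hc]; exact ho c (by decide)) (by rw [hd, ← hc]; exact ho c (by decide))
  have k4 := hf.plane d (hn c' 1) (hn c' 2) (ho c' (by decide))
    (by rw [hd, ← hc']; exact ho c' (by decide)) (by rw [hd, ← hc']; exact ho c' (by decide))
  rw [hc] at k1
  rw [hc'] at k2
  rw [hc2] at k3
  rw [hc2'] at k4
  linarith

end IsFrameFn

namespace IsFrameFn

variable {E : Type*} [NormedAddCommGroup E] [InnerProductSpace ℝ E] {f : E → ℝ}

/-- The oscillation of `f` at `p` is at most `2 * ε`. -/
def OscAt (f : E → ℝ) (p : E) (ε : ℝ) : Prop := ∃ c, ∀ᶠ s in 𝓝 p, |f s - c| ≤ ε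

lemma exists_oscAt (hE : Module.finrank ℝ E = 3) (hf : IsFrameFn f) {C : ℝ}
    (hC : ∀ x ≠ 0, |f x| ≤ C) {ε : ℝ} (hε : 0 < ε) : ∃ p ≠ 0, OscAt f p ε := by
  have : FiniteDimensional ℝ E := FiniteDimensional.of_finrank_pos (by omega)
  have : Nontrivial E := Module.nontrivial_of_finrank_pos (R := ℝ) (by omega)
  set S : Set ℝ := f '' {x | x ≠ 0} with hS
  have hbd : BddAbove S := ⟨C, by
    rintro _ ⟨x, hx, rfl⟩
    exact (le_abs_self _).trans (hC x hx)⟩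
  obtain ⟨v, hv⟩ := exists_ne (0 : E)
  have hne : S.Nonempty := ⟨f v, v, hv, rfl⟩
  set M := sSup S with hM
  have hMle : ∀ x ≠ 0, f x ≤ M := fun x hx => le_csSup hbd ⟨x, hx, rfl⟩
  obtain ⟨_, ⟨p₀, hp₀, rfl⟩, hp₁⟩ := exists_lt_of_lt_csSup hne (b := M - ε / 52)
    (by rw [← hM]; linarith)
  set p := ‖p₀‖⁻¹ • p₀ with hp
  have hpn : ‖p‖ = 1 := by rw [hp, norm_smul, norm_inv, norm_norm, inv_mul_cancel₀ (norm_ne_zero_iff.2 hp₀)]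
  have hfp : f p = f p₀ := hf.smul _ _ (inv_ne_zero (norm_ne_zero_iff.2 hp₀))
  obtain ⟨b, hb⟩ := exists_basis hE hpn
  have hF := hf.isFrameFn3_coord b
  have hFM : ∀ x y z : ℝ, 0 < x ^ 2 + y ^ 2 + z ^ 2 → coord f b x y z ≤ M :=
    fun x y z h => hMle _ (coord_ne_zero b h)
  obtain ⟨k, hk⟩ : ∃ k : ℕ, (2 * M - (f (b 0) + f (b 1))) / 2 ^ k < ε / 2 := by
    have ht : Tendsto (fun k : ℕ => (2 * M - (f (b 0) + f (b 1))) / 2 ^ k) atTop (𝓝 0) :=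
      tendsto_const_nhds.div_atTop (tendsto_pow_atTop_atTop_of_one_lt (by norm_num))
    exact (ht.eventually (gt_mem_nhds (half_pos hε))).exists
  refine ⟨p, by rw [← norm_ne_zero_iff, hpn]; norm_num, M, ?_⟩
  have c0 : Continuous fun s : E => inner ℝ (b 0) s := continuous_const.inner continuous_id
  have c1 : Continuous fun s : E => inner ℝ (b 1) s := continuous_const.inner continuous_id
  have c2 : Continuous fun s : E => inner ℝ (b 2) s := continuous_const.inner continuous_id
  have hb2 : inner ℝ (b 2) (b 2) = (1:ℝ) := by rw [real_inner_self_eq_norm_sq, hb, hpn]; norm_num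
  have hb0 : inner ℝ (b 0) (b 2) = (0:ℝ) := b.orthonormal.2 (by decide)
  have hb1 : inner ℝ (b 1) (b 2) = (0:ℝ) := b.orthonormal.2 (by decide)
  have e1 : ∀ᶠ s in 𝓝 p, 0 < inner ℝ (b 2) s := by
    apply (c2.tendsto p).eventually (lt_mem_nhds _)
    rw [← hb, hb2]; norm_num
  have e2 : ∀ᶠ s in 𝓝 p, 8 ^ k * √(inner ℝ (b 0) s ^ 2 + inner ℝ (b 1) s ^ 2) < inner ℝ (b 2) s := by
    have hc : Continuous fun s : E => inner ℝ (b 2) s -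
      8 ^ k * √(inner ℝ (b 0) s ^ 2 + inner ℝ (b 1) s ^ 2) := by fun_prop
    have := (hc.tendsto p).eventually (lt_mem_nhds (a := 0) (by
      rw [← hb, hb2, hb0, hb1]; norm_num))
    filter_upwards [this] with s hs
    linarith
  filter_upwards [e1, e2] with s h1 h2
  have h3 := hF.near_max hFM (η := ε / 52) (by
    rw [(coord_frame b f).2.2, hb, hfp]; linarith) (by positivity) k h1 h2.le
  rw [coord_inner, (coord_frame b f).1, (coord_frame b f).2.1] at h3
  have h4 : f s ≤ M := hMle s (by
    rintro rfl
    simp at h1)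
  rw [abs_le]
  constructor <;> linarith

lemma OscAt.of_orthogonal (hf : IsFrameFn f) {p q : E} (hp : p ≠ 0) (hq : q ≠ 0)
    (hqp : inner ℝ q p = 0) {ε : ℝ} (h : OscAt f p ε) : OscAt f q (2 * ε) := by
  obtain ⟨c, hc⟩ := h
  obtain ⟨U, hU, hUo, hpU⟩ := eventually_nhds_iff.1 hc
  have hP : 0 < ‖p‖ ^ 2 := by positivity
  have hQ : 0 < ‖q‖ ^ 2 := by positivity
  obtain ⟨α, hα, hαU⟩ : ∃ α : ℝ, α ≠ 0 ∧ p - (α * ‖p‖ ^ 2 / ‖q‖ ^ 2) • q ∈ U := by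
    have hcont : Continuous fun α : ℝ => p - (α * ‖p‖ ^ 2 / ‖q‖ ^ 2) • q := by fun_prop
    have h0 : ∀ᶠ α : ℝ in 𝓝 0, p - (α * ‖p‖ ^ 2 / ‖q‖ ^ 2) • q ∈ U :=
      (hcont.tendsto 0).eventually (by
        simpa using hUo.mem_nhds hpU)
    have h1 : ∀ᶠ α : ℝ in 𝓝[≠] 0, p - (α * ‖p‖ ^ 2 / ‖q‖ ^ 2) • q ∈ U :=
      h0.filter_mono nhdsWithin_le_nhds
    obtain ⟨α, h2, h3⟩ := (h1.and self_mem_nhdsWithin).exists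
    exact ⟨α, h3, h2⟩
  set z := q + α • p with hz
  have hz2 : ‖z‖ ^ 2 = ‖q‖ ^ 2 + α ^ 2 * ‖p‖ ^ 2 := by
    rw [hz, norm_add_sq_real, inner_smul_right, hqp, norm_smul, mul_pow, Real.norm_eq_abs, sq_abs]
    ring
  have hqz : inner ℝ q z = ‖q‖ ^ 2 := by
    rw [hz, inner_add_right, inner_smul_right, hqp, real_inner_self_eq_norm_sq]
    ring
  have hzn : z ≠ 0 := by
    intro h0
    rw [h0, norm_zero] at hz2
    have : 0 ≤ α ^ 2 * ‖p‖ ^ 2 := by positivity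
    linarith
  refine ⟨f z, ?_⟩
  let n : E → E := fun x => z - (inner ℝ x z / ‖x‖ ^ 2) • x
  let n' : E → E := fun x => x - (inner ℝ x z / ‖z‖ ^ 2) • z
  let κ : ℝ := - ‖z‖ ^ 2 / (α * ‖q‖ ^ 2)
  have hκ : κ ≠ 0 := by
    apply div_ne_zero
    · apply neg_ne_zero.2; positivity
    · positivity
  have nq : α⁻¹ • n q = p := by
    simp only [n, hqz]
    rw [div_self hQ.ne', one_smul, hz, add_sub_cancel_left, smul_smul, inv_mul_cancel₀ hα, one_smul]
  have nq' : κ • n' q = p - (α * ‖p‖ ^ 2 / ‖q‖ ^ 2) • q := by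
    simp only [n', hqz, κ]
    have hz2' : 0 < ‖z‖ ^ 2 := by positivity
    have a1 : -‖z‖ ^ 2 / (α * ‖q‖ ^ 2) * (‖q‖ ^ 2 / ‖z‖ ^ 2 * α) = -1 := by field_simp
    have a2 : -‖z‖ ^ 2 / (α * ‖q‖ ^ 2) * (1 - ‖q‖ ^ 2 / ‖z‖ ^ 2) = -(α * ‖p‖ ^ 2 / ‖q‖ ^ 2) := by
      have : 1 - ‖q‖ ^ 2 / ‖z‖ ^ 2 = α ^ 2 * ‖p‖ ^ 2 / ‖z‖ ^ 2 := by
        rw [eq_div_iff hz2'.ne', sub_mul, div_mul_cancel₀ _ hz2'.ne', hz2]; ring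
      rw [this]
      field_simp
    rw [show q - (‖q‖ ^ 2 / ‖z‖ ^ 2) • z = (1 - ‖q‖ ^ 2 / ‖z‖ ^ 2) • q -
      (‖q‖ ^ 2 / ‖z‖ ^ 2 * α) • p by rw [hz]; module, smul_sub, smul_smul, smul_smul, a1, a2]
    module
  have cn : ContinuousAt (fun x => α⁻¹ • n x) q := by
    simp only [n]
    fun_prop (disch := positivity)
  have cn' : ContinuousAt (fun x => κ • n' x) q := by
    simp only [n']
    fun_prop
  have e0 : ∀ᶠ x in 𝓝 q, x ≠ 0 := isOpen_ne.mem_nhds hq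
  have e1 : ∀ᶠ x in 𝓝 q, α⁻¹ • n x ∈ U := cn.eventually (hUo.mem_nhds (by simpa only [nq] using hpU))
  have e2 : ∀ᶠ x in 𝓝 q, κ • n' x ∈ U := cn'.eventually (hUo.mem_nhds (by simpa only [nq'] using hαU))
  have e3 : ∀ᶠ x in 𝓝 q, α⁻¹ • n x ≠ 0 :=
    cn.eventually (isOpen_ne.mem_nhds (by simpa only [nq, Set.mem_ofPred_eq] using hp))
  filter_upwards [e0, e1, e2, e3] with x hx h1 h2 h3
  have hx2 : 0 < ‖x‖ ^ 2 := by positivity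
  have hn0 : n x ≠ 0 := fun h0 => h3 (by rw [h0, smul_zero])
  have k1 := hU _ h1
  have k2 := hU _ h2
  rw [hf.smul _ _ (inv_ne_zero hα)] at k1
  rw [hf.smul _ _ hκ] at k2
  have hxn : inner ℝ x (n x) = 0 := by
    simp only [n]
    rw [inner_sub_right, inner_smul_right, real_inner_self_eq_norm_sq, div_mul_cancel₀ _ hx2.ne',
      sub_self]
  have hr := hf.rot x (n x) hx hn0 hxn (inner ℝ x z / ‖x‖ ^ 2) 1 (Or.inr one_ne_zero)
  have hzdec : (inner ℝ x z / ‖x‖ ^ 2) • x + (1:ℝ) • n x = z := by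
    simp only [n]; module
  have hnn : ‖n x‖ ^ 2 = ‖z‖ ^ 2 - inner ℝ x z ^ 2 / ‖x‖ ^ 2 := by
    simp only [n]
    rw [norm_sub_sq_real, inner_smul_right, norm_smul, mul_pow, Real.norm_eq_abs, sq_abs,
      real_inner_comm x z]
    field_simp
    ring
  have hw : (-(1 * ‖n x‖ ^ 2)) • x + (inner ℝ x z / ‖x‖ ^ 2 * ‖x‖ ^ 2) • n x =
      (-‖z‖ ^ 2) • n' x := by
    rw [hnn, div_mul_cancel₀ _ hx2.ne']
    simp only [n, n', smul_sub, smul_smul]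
    have hz2' : ‖z‖ ^ 2 ≠ 0 := by positivity
    rw [show -‖z‖ ^ 2 * (inner ℝ x z / ‖z‖ ^ 2) = - inner ℝ x z by field_simp]
    rw [show inner ℝ x z * (inner ℝ x z / ‖x‖ ^ 2) = inner ℝ x z ^ 2 / ‖x‖ ^ 2 by ring]
    module
  rw [hzdec, hw, hf.smul _ _ (by apply neg_ne_zero.2; positivity)] at hr
  rw [abs_le] at *
  constructor <;> linarith [k1.1, k1.2, k2.1, k2.2]

lemma continuousAt (hE : Module.finrank ℝ E = 3) (hf : IsFrameFn f) {C : ℝ}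
    (hC : ∀ x ≠ 0, |f x| ≤ C) {x : E} (hx : x ≠ 0) : ContinuousAt f x := by
  rw [Metric.continuousAt_iff']
  intro ε hε
  obtain ⟨p, hp, h⟩ := exists_oscAt hE hf hC (ε := ε / 16) (by positivity)
  obtain ⟨q, hq, hpq, hxq⟩ := exists_orthogonal hE p x
  have hq0 : q ≠ 0 := by rw [← norm_ne_zero_iff, hq]; norm_num
  have h1 := h.of_orthogonal hf hp hq0 (by rw [real_inner_comm]; exact hpq)
  obtain ⟨c, h2⟩ := h1.of_orthogonal hf hq0 hx hxq
  have h3 := h2.self_of_nhds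
  filter_upwards [h2] with s hs
  rw [Real.dist_eq, abs_lt]
  rw [abs_le] at hs h3
  constructor <;> linarith [hs.1, hs.2, h3.1, h3.2]

end IsFrameFn

namespace IsFrameFn

variable {E : Type*} [NormedAddCommGroup E] [InnerProductSpace ℝ E] {f : E → ℝ}

lemma coord_add_quarterTurn (hE : Module.finrank ℝ E = 3) (hf : IsFrameFn f) {C : ℝ}
    (hC : ∀ x ≠ 0, |f x| ≤ C) (b : OrthonormalBasis (Fin 3) ℝ E)
    (hmax : ∀ x ≠ 0, f x ≤ f (b 2)) {x y z : ℝ} (hs : 0 < x ^ 2 + y ^ 2 + z ^ 2) :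
    coord f b x y z + coord f b (-y) x z =
      ((f (b 0) + f (b 1)) * (x ^ 2 + y ^ 2) + 2 * f (b 2) * z ^ 2) /
        (x ^ 2 + y ^ 2 + z ^ 2) := by
  have hF := hf.isFrameFn3_coord b
  obtain ⟨e0, e1, e2⟩ := coord_frame b f
  have hc : Continuous (IsFrameFn3.avg (coord f b)) := by
    have h1 : ∀ u v : ℂ → ℝ, Continuous u → Continuous v →
        Continuous fun ζ => coord f b (u ζ) (v ζ) 1 := by
      intro u v hu hv
      rw [continuous_iff_continuousAt]
      intro ζ
      have hg : ContinuousAt (fun ζ => u ζ • b 0 + v ζ • b 1 + (1:ℝ) • b 2) ζ := by fun_prop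
      exact ContinuousAt.comp (f := fun ζ => u ζ • b 0 + v ζ • b 1 + (1:ℝ) • b 2)
        (hf.continuousAt hE hC (coord_ne_zero b (by positivity))) hg
    exact (h1 _ _ Complex.continuous_re Complex.continuous_im).add
      (h1 _ _ Complex.continuous_im.neg Complex.continuous_re)
  have hB : ∀ ζ, |IsFrameFn3.avg (coord f b) ζ| ≤ 2 * C := by
    intro ζ
    have h1 := hC _ (coord_ne_zero b (x := ζ.re) (y := ζ.im) (z := 1) (by positivity))
    have h2 := hC _ (coord_ne_zero b (x := -ζ.im) (y := ζ.re) (z := 1) (by positivity))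
    unfold IsFrameFn3.avg
    refine (abs_add_le _ _).trans ?_
    unfold coord
    linarith
  have := hF.add_quarterTurn_eq hc (M := f (b 2)) (fun x y z h => hmax _ (coord_ne_zero b h))
    e2 hB hs
  rw [this, e0, e1]

lemma exists_max (hE : Module.finrank ℝ E = 3) (hf : IsFrameFn f) {C : ℝ}
    (hC : ∀ x ≠ 0, |f x| ≤ C) : ∃ p : E, ‖p‖ = 1 ∧ ∀ x ≠ 0, f x ≤ f p := by
  have : FiniteDimensional ℝ E := FiniteDimensional.of_finrank_pos (by omega)
  have : Nontrivial E := Module.nontrivial_of_finrank_pos (R := ℝ) (by omega)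
  have hcont : ContinuousOn f (Metric.sphere (0 : E) 1) := fun x hx =>
    (hf.continuousAt hE hC (ne_zero_of_mem_unit_sphere ⟨x, hx⟩)).continuousWithinAt
  obtain ⟨p, hp, hmax⟩ := (isCompact_sphere (0 : E) 1).exists_isMaxOn
    (NormedSpace.sphere_nonempty.2 zero_le_one) hcont
  refine ⟨p, by simpa using hp, fun x hx => ?_⟩
  have h1 := hmax (a := ‖x‖⁻¹ • x) (by
    rw [mem_sphere_zero_iff_norm, norm_smul, norm_inv, norm_norm,
      inv_mul_cancel₀ (norm_ne_zero_iff.2 hx)])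
  rwa [Set.mem_ofPred_eq, hf.smul _ _ (inv_ne_zero (norm_ne_zero_iff.2 hx))] at h1

lemma sq_eq_third {A B D : ℝ} (hn : A + B + D = 1) (h : 1 / 3 ≤ A * B + B * D + D * A) :
    D = 1 / 3 := by
  have h1 : (A - B) ^ 2 + (B - D) ^ 2 + (D - A) ^ 2 ≤ 0 := by
    have h2 : (A + B + D) ^ 2 = 1 := by rw [hn]; norm_num
    linarith [h2, h]
  have h3 : (B - D) ^ 2 = 0 := by linarith [sq_nonneg (A - B), sq_nonneg (B - D), sq_nonneg (D - A)]
  have h4 : (D - A) ^ 2 = 0 := by linarith [sq_nonneg (A - B), sq_nonneg (B - D), sq_nonneg (D - A)]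
  have h5 := pow_eq_zero_iff (two_ne_zero) |>.1 h3
  have h6 := pow_eq_zero_iff (two_ne_zero) |>.1 h4
  linarith

lemma sign_changes_contradiction {u v w : ℝ} (n : u ^ 2 + v ^ 2 + w ^ 2 = 1)
    (a1 : 1 ≤ 3 * (u * w + v * u + w * v) ^ 2) (a2 : 1 ≤ 3 * (u * -w + v * -u + w * v) ^ 2)
    (a3 : 1 ≤ 3 * (u * w + v * -u + w * -v) ^ 2) (a4 : 1 ≤ 3 * (u * -w + v * u + w * -v) ^ 2)
    (a5 : 1 ≤ 3 * (u * -u + v * -v + w * w) ^ 2) : False := by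
  have hsum : (u * w + v * u + w * v) ^ 2 + (u * -w + v * -u + w * v) ^ 2 +
      (u * w + v * -u + w * -v) ^ 2 + (u * -w + v * u + w * -v) ^ 2 =
      4 * (u ^ 2 * v ^ 2 + v ^ 2 * w ^ 2 + w ^ 2 * u ^ 2) := by ring
  have hw := sq_eq_third n (by linarith)
  have h5 : u * -u + v * -v + w * w = -(1 / 3) := by linarith
  rw [h5] at a5
  norm_num at a5

/-- There is no weight zero bounded frame function which changes sign under quarter turns about
two axes, except zero. -/
lemma nonpos_of_antisymm (hE : Module.finrank ℝ E = 3) (hf : IsFrameFn f) {C : ℝ}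
    (hC : ∀ x ≠ 0, |f x| ≤ C) (b : OrthonormalBasis (Fin 3) ℝ E)
    (h1 : ∀ x y z : ℝ, 0 < x ^ 2 + y ^ 2 + z ^ 2 → coord f b x y z + coord f b (-y) x z = 0)
    (h2 : ∀ x y z : ℝ, 0 < x ^ 2 + y ^ 2 + z ^ 2 → coord f b x y z + coord f b x (-z) y = 0)
    {x : E} (hx : x ≠ 0) : f x ≤ 0 := by
  obtain ⟨p, hp, hmax⟩ := hf.exists_max hE hC
  refine (hmax x hx).trans ?_
  by_contra! hM
  obtain ⟨c, hc⟩ := exists_basis hE hp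
  have hp0 : p ≠ 0 := by rw [← norm_ne_zero_iff, hp]; norm_num
  obtain ⟨e0, e1, e2⟩ := coord_frame b f
  have w0 : f (c 0) + f (c 1) + f (c 2) = 0 := by
    rw [hf.sum_basis_eq hE c b, ← e0, ← e1, ← e2]
    have k1 := h1 1 0 0 (by norm_num)
    have k2 := h1 0 0 1 (by norm_num)
    rw [neg_zero] at k1 k2
    linarith
  have hmin : ∀ s ≠ 0, - f p ≤ f s := by
    intro s hs
    rw [← coord_inner b f s]
    set x := inner ℝ (b 0) s
    set y := inner ℝ (b 1) s
    set z := inner ℝ (b 2) s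
    have hs' : 0 < x ^ 2 + y ^ 2 + z ^ 2 := by
      rw [← norm_sq_coord b, ← eq_coord b s]
      positivity
    have k1 := h1 x y z hs'
    have k2 := hmax _ (coord_ne_zero b (x := -y) (y := x) (z := z) (by linarith))
    unfold coord at *
    linarith
  have key : ∀ s : E, ‖s‖ = 1 → f s = f p → 1 ≤ 3 * inner ℝ p s ^ 2 := by
    intro s hs hfs
    have n1 := norm_sq_coord c (inner ℝ (c 0) s) (inner ℝ (c 1) s) (inner ℝ (c 2) s)
    rw [← eq_coord c s, hs] at n1
    have k1 := hf.coord_add_quarterTurn hE hC c (x := inner ℝ (c 0) s) (y := inner ℝ (c 1) s)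
      (z := inner ℝ (c 2) s) (by rw [hc]; exact hmax) (by rw [← n1]; norm_num)
    have k2 := hmin _ (coord_ne_zero c (x := -inner ℝ (c 1) s) (y := inner ℝ (c 0) s)
      (z := inner ℝ (c 2) s) (by rw [neg_sq, add_comm (_ ^ 2) (_ ^ 2), ← n1]; norm_num))
    rw [coord_inner, ← n1, hfs, show f (c 0) + f (c 1) = - f p by rw [← hc]; linarith] at k1
    rw [show inner ℝ (c 0) s ^ 2 + inner ℝ (c 1) s ^ 2 = 1 - inner ℝ (c 2) s ^ 2 by linarith,
      hc] at k1
    rw [hc] at k2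
    unfold coord at k1
    rw [hc] at k1
    by_contra! hlt
    nlinarith
  have H1 : ∀ x y z : ℝ, x ^ 2 + y ^ 2 + z ^ 2 = 1 → coord f b x y z = - coord f b (-y) x z :=
    fun x y z h => by linarith [h1 x y z (by linarith)]
  have H2 : ∀ x y z : ℝ, x ^ 2 + y ^ 2 + z ^ 2 = 1 → coord f b x y z = - coord f b x (-z) y :=
    fun x y z h => by linarith [h2 x y z (by linarith)]
  obtain ⟨u, v, w, huvw⟩ := eq_coord' b p
  have n : u ^ 2 + v ^ 2 + w ^ 2 = 1 := by rw [← norm_sq_coord b, ← huvw, hp]; norm_num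
  have v0 : coord f b u v w = f p := by rw [huvw]; rfl
  have S1 : ∀ x y z : ℝ, x ^ 2 + y ^ 2 + z ^ 2 = 1 → coord f b (-x) (-y) z = coord f b x y z :=
    fun x y z h => by rw [H1 x y z h, H1 (-y) x z (by linarith), neg_neg]
  have S2 : ∀ x y z : ℝ, x ^ 2 + y ^ 2 + z ^ 2 = 1 → coord f b x (-y) (-z) = coord f b x y z :=
    fun x y z h => by rw [H2 x y z h, H2 x (-z) y (by linarith), neg_neg]
  have S3 : ∀ x y z : ℝ, x ^ 2 + y ^ 2 + z ^ 2 = 1 → coord f b z x y = coord f b x y z :=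
    fun x y z h => by
      rw [H2 x y z h, H1 x (-z) y (by linarith), neg_neg, neg_neg]
  have key' : ∀ x y z : ℝ, x ^ 2 + y ^ 2 + z ^ 2 = 1 → coord f b x y z = f p →
      1 ≤ 3 * (u * x + v * y + w * z) ^ 2 := by
    intro x y z h hv
    have := key (x • b 0 + y • b 1 + z • b 2)
      (by
        have := norm_sq_coord b x y z
        rw [h] at this
        nlinarith [norm_nonneg (x • b 0 + y • b 1 + z • b 2)]) hv
    rwa [huvw, inner_coord] at this
  have a1 := key' w u v (by linarith) (by rw [S3 u v w n, v0])
  have a2 := key' (-w) (-u) v (by linarith) (by rw [S1 w u v (by linarith), S3 u v w n, v0])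
  have a3 := key' w (-u) (-v) (by linarith) (by rw [S2 w u v (by linarith), S3 u v w n, v0])
  have a4 := key' (-w) u (-v) (by linarith) (by
    rw [← S1 _ _ _ (by linarith), neg_neg, S2 w u v (by linarith), S3 u v w n, v0])
  have a5 := key' (-u) (-v) w (by linarith) (by rw [S1 u v w n, v0])
  exact sign_changes_contradiction n a1 a2 a3 a4 a5

/-- Gleason's theorem for bounded frame functions on a three-dimensional real space: they are
Rayleigh quotients. -/
theorem exists_eq_rayleigh (hE : Module.finrank ℝ E = 3) (hf : IsFrameFn f) {C : ℝ}
    (hC : ∀ x ≠ 0, |f x| ≤ C) : ∃ (b : OrthonormalBasis (Fin 3) ℝ E) (l n m : ℝ), ∀ s ≠ 0,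
      f s * ‖s‖ ^ 2 = l * inner ℝ (b 0) s ^ 2 + n * inner ℝ (b 1) s ^ 2 +
        m * inner ℝ (b 2) s ^ 2 := by
  obtain ⟨p, hp, hmax⟩ := hf.exists_max hE hC
  have hf' := hf.const_mul (-1)
  have hC' : ∀ x ≠ 0, |(-1) * f x| ≤ C := fun x hx => by
    rw [neg_one_mul, abs_neg]; exact hC x hx
  obtain ⟨e, he, hmin⟩ := hf'.exists_max hE hC'
  obtain ⟨z, hz, hpz, hez⟩ := exists_orthogonal hE p e
  obtain ⟨q, hq, hpq, hzq⟩ := exists_orthogonal hE p z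
  obtain ⟨e', he', hee', hze'⟩ := exists_orthogonal hE e z
  have ne : ∀ v : E, ‖v‖ = 1 → v ≠ 0 := fun v hv => by rw [← norm_ne_zero_iff, hv]; norm_num
  obtain ⟨d, hd⟩ := exists_basis hE hz
  have k1 := hf.plane d (ne p hp) (ne q hq) hpq (by rw [hd, real_inner_comm]; exact hpz)
    (by rw [hd]; exact hzq)
  have k2 := hf.plane d (ne e he) (ne e' he') hee' (by rw [hd, real_inner_comm]; exact hez)
    (by rw [hd]; exact hze')
  have hminq : ∀ x ≠ 0, f q ≤ f x := by
    intro x hx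
    have := hmin x hx
    have := hmax e' (ne e' he')
    linarith
  obtain ⟨b, hb0, hb2⟩ := exists_basis_pair hE hq hp (by rw [real_inner_comm]; exact hpq)
  refine ⟨b, f (b 0), f (b 1), f (b 2), ?_⟩
  let Q : E → ℝ := fun s => f (b 0) * (inner ℝ (b 0) s ^ 2 / ‖s‖ ^ 2) +
    f (b 1) * (inner ℝ (b 1) s ^ 2 / ‖s‖ ^ 2) + f (b 2) * (inner ℝ (b 2) s ^ 2 / ‖s‖ ^ 2)
  have hQ : IsFrameFn Q := (((sq_div (innerₗ E (b 0))).const_mul (f (b 0))).add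
    ((sq_div (innerₗ E (b 1))).const_mul (f (b 1)))).add
    ((sq_div (innerₗ E (b 2))).const_mul (f (b 2)))
  have hQb : ∀ x ≠ 0, |Q x| ≤ |f (b 0)| + |f (b 1)| + |f (b 2)| := by
    intro x hx
    have hi : ∀ i, |f (b i) * (inner ℝ (b i) x ^ 2 / ‖x‖ ^ 2)| ≤ |f (b i)| := by
      intro i
      rw [abs_mul]
      apply mul_le_of_le_one_right (abs_nonneg _)
      rw [abs_of_nonneg (by positivity), div_le_one (by positivity)]
      have := abs_real_inner_le_norm (b i) x
      rw [b.orthonormal.1 i, one_mul] at this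
      rw [← sq_abs]
      exact pow_le_pow_left₀ (abs_nonneg _) this 2
    exact (abs_add_three _ _ _).trans (add_le_add (add_le_add (hi 0) (hi 1)) (hi 2))
  have hh := hf.add (hQ.const_mul (-1))
  have hhn := hh.const_mul (-1)
  have hB : ∀ x ≠ 0, |f x + -1 * Q x| ≤ C + (|f (b 0)| + |f (b 1)| + |f (b 2)|) := by
    intro x hx
    refine (abs_add_le _ _).trans (add_le_add (hC x hx) ?_)
    rw [neg_one_mul, abs_neg]
    exact hQb x hx
  have hBn : ∀ x ≠ 0, |-1 * (f x + -1 * Q x)| ≤ C + (|f (b 0)| + |f (b 1)| + |f (b 2)|) := by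
    intro x hx
    rw [neg_one_mul, abs_neg]
    exact hB x hx
  have hin : ∀ x y z : ℝ, inner ℝ (b 0) (x • b 0 + y • b 1 + z • b 2) = x ∧
      inner ℝ (b 1) (x • b 0 + y • b 1 + z • b 2) = y ∧
      inner ℝ (b 2) (x • b 0 + y • b 1 + z • b 2) = z := by
    intro x y z
    have i0 := inner_coord b 1 0 0 x y z
    have i1 := inner_coord b 0 1 0 x y z
    have i2 := inner_coord b 0 0 1 x y z
    simp only [one_smul, zero_smul, add_zero, zero_add] at i0 i1 i2
    exact ⟨by rw [i0]; ring, by rw [i1]; ring, by rw [i2]; ring⟩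
  have hQc : ∀ x y z : ℝ, coord Q b x y z =
      (f (b 0) * x ^ 2 + f (b 1) * y ^ 2 + f (b 2) * z ^ 2) / (x ^ 2 + y ^ 2 + z ^ 2) := by
    intro x y z
    simp only [coord, Q]
    rw [(hin x y z).1, (hin x y z).2.1, (hin x y z).2.2, norm_sq_coord]
    ring
  have h1 : ∀ x y z : ℝ, 0 < x ^ 2 + y ^ 2 + z ^ 2 →
      coord (fun x => f x + -1 * Q x) b x y z + coord (fun x => f x + -1 * Q x) b (-y) x z = 0 := by
    intro x y z hs
    have k := hf.coord_add_quarterTurn hE hC b (by rw [hb2]; exact hmax) hs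
    have q1 := hQc x y z
    have q2 := hQc (-y) x z
    rw [show (-y) ^ 2 + x ^ 2 + z ^ 2 = x ^ 2 + y ^ 2 + z ^ 2 by ring] at q2
    have : ((f (b 0) + f (b 1)) * (x ^ 2 + y ^ 2) + 2 * f (b 2) * z ^ 2) /
        (x ^ 2 + y ^ 2 + z ^ 2) = coord Q b x y z + coord Q b (-y) x z := by
      rw [q1, q2]; ring
    unfold coord at *
    linarith
  let b' : OrthonormalBasis (Fin 3) ℝ E := b.reindex (finRotate 3).symm
  have b'0 : b' 0 = b 1 := by simp [b']
  have b'1 : b' 1 = b 2 := by simp [b']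
  have b'2 : b' 2 = b 0 := by simp [b']
  have h2 : ∀ x y z : ℝ, 0 < x ^ 2 + y ^ 2 + z ^ 2 →
      coord (fun x => f x + -1 * Q x) b x y z + coord (fun x => f x + -1 * Q x) b x (-z) y = 0 := by
    intro x y z hs
    have k := hf'.coord_add_quarterTurn hE hC' b' (x := y) (y := z) (z := x) (by
      intro s hs0
      rw [b'2, hb0]
      have := hminq s hs0
      linarith) (by linarith)
    have q1 := hQc x y z
    have q2 := hQc x (-z) y
    rw [show x ^ 2 + (-z) ^ 2 + y ^ 2 = x ^ 2 + y ^ 2 + z ^ 2 by ring] at q2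
    rw [b'0, b'1, b'2, show y ^ 2 + z ^ 2 + x ^ 2 = x ^ 2 + y ^ 2 + z ^ 2 by ring] at k
    have : ((-1 * f (b 1) + -1 * f (b 2)) * (y ^ 2 + z ^ 2) + 2 * (-1 * f (b 0)) * x ^ 2) /
        (x ^ 2 + y ^ 2 + z ^ 2) = -(coord Q b x y z + coord Q b x (-z) y) := by
      rw [q1, q2]; ring
    unfold coord at *
    rw [b'0, b'1, b'2, show y • b 1 + z • b 2 + x • b 0 = x • b 0 + y • b 1 + z • b 2 by abel,
      show -z • b 1 + y • b 2 + x • b 0 = x • b 0 + -z • b 1 + y • b 2 by abel] at k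
    linarith
  intro s hs
  have le1 := hh.nonpos_of_antisymm hE hB b h1 h2 hs
  have le2 := hhn.nonpos_of_antisymm hE hBn b
    (fun x y z h => by
      have := h1 x y z h
      unfold coord at *
      linarith)
    (fun x y z h => by
      have := h2 x y z h
      unfold coord at *
      linarith) hs
  have hfs : f s = Q s := by linarith
  have hs2 : ‖s‖ ^ 2 ≠ 0 := by positivity
  rw [hfs]
  simp only [Q]
  field_simp

end IsFrameFn

/-- A degree-zero homogeneous function on a complex inner product space satisfying the frame
identity for real rotations in the plane of two orthogonal vectors. -/
structure IsComplexFrameFn {V : Type*} [NormedAddCommGroup V] [InnerProductSpace ℂ V]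
    (f : V → ℝ) : Prop where
  smul : ∀ (c : ℂ) (x : V), c ≠ 0 → f (c • x) = f x
  rot : ∀ x y : V, x ≠ 0 → y ≠ 0 → inner ℂ x y = 0 → ∀ a b : ℝ, (a ≠ 0 ∨ b ≠ 0) →
    f ((a : ℂ) • x + (b : ℂ) • y) +
      f (((-(b * ‖y‖ ^ 2) : ℝ) : ℂ) • x + ((a * ‖x‖ ^ 2 : ℝ) : ℂ) • y) = f x + f y

namespace IsComplexFrameFn

variable {V : Type*} [NormedAddCommGroup V] [InnerProductSpace ℂ V] {f : V → ℝ}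

/-- The degree-two homogeneous function attached to `f`. -/
def quad (f : V → ℝ) (x : V) : ℝ := ‖x‖ ^ 2 * f x

/-- The real-linear span of three vectors. -/
def realSpan (x y z : V) (s : EuclideanSpace ℝ (Fin 3)) : V :=
  (s 0 : ℂ) • x + (s 1 : ℂ) • y + (s 2 : ℂ) • z

lemma inner_realSpan {x y z : V} (hx : ‖x‖ = 1) (hy : ‖y‖ = 1) (hz : ‖z‖ = 1)
    (hxy : inner ℂ x y = 0) (hxz : inner ℂ x z = 0) (hyz : inner ℂ y z = 0)
    (s t : EuclideanSpace ℝ (Fin 3)) :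
    inner ℂ (realSpan x y z s) (realSpan x y z t) = ((inner ℝ s t : ℝ) : ℂ) := by
  have hyx : inner ℂ y x = 0 := by rw [← inner_conj_symm, hxy, map_zero]
  have hzx : inner ℂ z x = 0 := by rw [← inner_conj_symm, hxz, map_zero]
  have hzy : inner ℂ z y = 0 := by rw [← inner_conj_symm, hyz, map_zero]
  have hxx : inner ℂ x x = 1 := by rw [inner_self_eq_norm_sq_to_K, hx]; norm_num
  have hyy : inner ℂ y y = 1 := by rw [inner_self_eq_norm_sq_to_K, hy]; norm_num
  have hzz : inner ℂ z z = 1 := by rw [inner_self_eq_norm_sq_to_K, hz]; norm_num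
  simp only [realSpan, inner_add_left, inner_add_right, inner_smul_left, inner_smul_right, hxy,
    hxz, hyz, hyx, hzx, hzy, hxx, hyy, hzz, PiLp.inner_apply, Fin.sum_univ_three,
    Complex.conj_ofReal]
  simp

lemma norm_realSpan {x y z : V} (hx : ‖x‖ = 1) (hy : ‖y‖ = 1) (hz : ‖z‖ = 1)
    (hxy : inner ℂ x y = 0) (hxz : inner ℂ x z = 0) (hyz : inner ℂ y z = 0)
    (s : EuclideanSpace ℝ (Fin 3)) : ‖realSpan x y z s‖ = ‖s‖ := by
  have h := inner_realSpan hx hy hz hxy hxz hyz s s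
  have h2 : ‖realSpan x y z s‖ ^ 2 = ‖s‖ ^ 2 := by
    rw [← inner_self_eq_norm_sq (𝕜 := ℂ), h, real_inner_self_eq_norm_sq]
    exact Complex.ofReal_re _
  exact (pow_left_inj₀ (norm_nonneg _) (norm_nonneg _) two_ne_zero).1 h2

lemma isFrameFn_realSpan (hf : IsComplexFrameFn f) {x y z : V} (hx : ‖x‖ = 1) (hy : ‖y‖ = 1)
    (hz : ‖z‖ = 1) (hxy : inner ℂ x y = 0) (hxz : inner ℂ x z = 0) (hyz : inner ℂ y z = 0) :
    IsFrameFn (fun s => f (realSpan x y z s)) where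
  smul c s hc := by
    rw [← hf.smul c (realSpan x y z s) (by exact_mod_cast hc)]
    congr 1
    simp only [realSpan, PiLp.smul_apply, smul_eq_mul, Complex.ofReal_mul]
    module
  rot s t hs ht hst a b hab := by
    have n := norm_realSpan hx hy hz hxy hxz hyz
    have ne : ∀ v : EuclideanSpace ℝ (Fin 3), v ≠ 0 → realSpan x y z v ≠ 0 := fun v hv => by
      rw [← norm_ne_zero_iff, n]; exact norm_ne_zero_iff.2 hv
    have h := hf.rot _ _ (ne s hs) (ne t ht)
      (by rw [inner_realSpan hx hy hz hxy hxz hyz, hst, Complex.ofReal_zero]) a b hab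
    rw [n, n] at h
    rw [← h]
    have key : ∀ p q : ℝ, realSpan x y z (p • s + q • t) =
        (p : ℂ) • realSpan x y z s + (q : ℂ) • realSpan x y z t := by
      intro p q
      simp only [realSpan, PiLp.smul_apply, PiLp.add_apply, smul_eq_mul, Complex.ofReal_mul,
        Complex.ofReal_add]
      module
    rw [key, key]

lemma exists_real_form (hf : IsComplexFrameFn f) {C : ℝ} (hC : ∀ x ≠ 0, |f x| ≤ C)
    (hV : ∀ x y : V, ∃ z : V, ‖z‖ = 1 ∧ inner ℂ x z = 0 ∧ inner ℂ y z = 0) {x y : V}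
    (hx : ‖x‖ = 1) (hy : ‖y‖ = 1) (hxy : inner ℂ x y = 0) :
    ∃ γ : ℝ, ∀ a b : ℝ, quad f ((a : ℂ) • x + (b : ℂ) • y) = a ^ 2 * f x + b ^ 2 * f y + a * b * γ := by
  obtain ⟨z, hz, hxz, hyz⟩ := hV x y
  have h1 := hf.isFrameFn_realSpan hx hy hz hxy hxz hyz
  have n := norm_realSpan hx hy hz hxy hxz hyz
  obtain ⟨e, l, p, m, he⟩ := h1.exists_eq_rayleigh (by simp) (C := C) (fun s hs =>
    hC _ (by rw [← norm_ne_zero_iff, n]; exact norm_ne_zero_iff.2 hs))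
  have he' : ∀ s, quad f (realSpan x y z s) = l * inner ℝ (e 0) s ^ 2 + p * inner ℝ (e 1) s ^ 2 +
        m * inner ℝ (e 2) s ^ 2 := by
    intro s
    rcases eq_or_ne s 0 with rfl | hs
    · simp [quad, n]
    · rw [← he s hs, quad, n, mul_comm]
  let e0 : EuclideanSpace ℝ (Fin 3) := EuclideanSpace.single 0 1
  let e1 : EuclideanSpace ℝ (Fin 3) := EuclideanSpace.single 1 1
  have hab : ∀ a b : ℝ, (a : ℂ) • x + (b : ℂ) • y = realSpan x y z (a • e0 + b • e1) := by
    intro a b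
    simp [realSpan, e0, e1]
  have hx1 := he' ((1:ℝ) • e0 + (0:ℝ) • e1)
  have hy1 := he' ((0:ℝ) • e0 + (1:ℝ) • e1)
  rw [← hab] at hx1 hy1
  simp only [Complex.ofReal_one, Complex.ofReal_zero, one_smul, zero_smul, add_zero, zero_add,
    quad, hx, hy] at hx1 hy1
  refine ⟨2 * (l * inner ℝ (e 0) e0 * inner ℝ (e 0) e1 + p * inner ℝ (e 1) e0 * inner ℝ (e 1) e1 +
    m * inner ℝ (e 2) e0 * inner ℝ (e 2) e1), fun a b => ?_⟩
  rw [hab, he']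
  simp only [inner_add_right, inner_smul_right]
  linear_combination (-a ^ 2) * hx1 - b ^ 2 * hy1

lemma abs_le_of_quadratic_nonneg {A B γ : ℝ} (h : ∀ a b : ℝ, 0 ≤ A * a ^ 2 + B * b ^ 2 - a * b * γ) :
    γ ^ 2 ≤ 4 * (A * B) := by
  have hA : 0 ≤ A := by simpa using h 1 0
  have hB : 0 ≤ B := by simpa using h 0 1
  have h3 : ∀ x : ℝ, 0 ≤ A * (x * x) + (-γ) * x + B := fun x => by
    have := h x 1
    linarith
  have := discrim_le_zero h3
  unfold discrim at this
  linarith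

lemma exists_near_diagonal (hf : IsComplexFrameFn f) {C : ℝ} (hC : ∀ x ≠ 0, |f x| ≤ C)
    (hV : ∀ x y : V, ∃ z : V, ‖z‖ = 1 ∧ inner ℂ x z = 0 ∧ inner ℂ y z = 0) {x₀ y₀ : V}
    (hx₀ : ‖x₀‖ = 1) (hy₀ : ‖y₀‖ = 1) (hxy₀ : inner ℂ x₀ y₀ = 0) {κ : ℝ} (hκ : 0 < κ) :
    ∃ (x y : V) (α β : ℝ), (∃ a b c d : ℂ, x₀ = a • x + b • y ∧ y₀ = c • x + d • y) ∧
      ‖x‖ = 1 ∧ ‖y‖ = 1 ∧ inner ℂ x y = 0 ∧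
      ∀ a b : ℂ, |quad f (a • x + b • y) - (α * ‖a‖ ^ 2 + β * ‖b‖ ^ 2)| ≤ κ * (‖a‖ * ‖b‖) := by
  have hx₀0 : x₀ ≠ 0 := by rw [← norm_ne_zero_iff, hx₀]; norm_num
  have hC0 : 0 ≤ C := (abs_nonneg _).trans (hC x₀ hx₀0)
  set S : Set ℝ := {r | ∃ a b : ℂ, a • x₀ + b • y₀ ≠ 0 ∧ f (a • x₀ + b • y₀) = r} with hS
  have hbd : BddAbove S := ⟨C, by
    rintro _ ⟨a, b, hab, rfl⟩
    exact (le_abs_self _).trans (hC _ hab)⟩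
  have hne : S.Nonempty := ⟨f x₀, 1, 0, by simpa using hx₀0, by simp⟩
  set M := sSup S with hM
  have hMC : M ≤ C := csSup_le hne (by
    rintro _ ⟨a, b, hab, rfl⟩
    exact (le_abs_self _).trans (hC _ hab))
  set δ := κ ^ 2 / (8 * (C + 1)) with hδ
  have hδ0 : 0 < δ := by positivity
  obtain ⟨_, ⟨a₀, b₀, hab, rfl⟩, hlt⟩ := exists_lt_of_lt_csSup hne (b := M - δ)
    (by rw [← hM]; linarith)
  have hxx : inner ℂ x₀ x₀ = 1 := by rw [inner_self_eq_norm_sq_to_K, hx₀]; norm_num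
  have hyy : inner ℂ y₀ y₀ = 1 := by rw [inner_self_eq_norm_sq_to_K, hy₀]; norm_num
  have hyx₀ : inner ℂ y₀ x₀ = 0 := by rw [← inner_conj_symm, hxy₀, map_zero]
  have hip : ∀ a b c d : ℂ, inner ℂ (a • x₀ + b • y₀) (c • x₀ + d • y₀) =
      (starRingEnd ℂ) a * c + (starRingEnd ℂ) b * d := by
    intro a b c d
    simp only [inner_add_left, inner_add_right, inner_smul_left, inner_smul_right, hxx, hyy,
      hxy₀, hyx₀]
    ring
  set N := ‖a₀ • x₀ + b₀ • y₀‖ with hN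
  have hN0 : 0 < N := norm_pos_iff.2 hab
  set a : ℂ := (N⁻¹ : ℝ) * a₀ with ha
  set b : ℂ := (N⁻¹ : ℝ) * b₀ with hb
  set x := a • x₀ + b • y₀ with hx
  set y := (-(starRingEnd ℂ) b) • x₀ + (starRingEnd ℂ) a • y₀ with hy
  have hxe : x = ((N⁻¹ : ℝ) : ℂ) • (a₀ • x₀ + b₀ • y₀) := by
    rw [hx, ha, hb]; module
  have hxn : ‖x‖ = 1 := by
    rw [hxe, norm_smul, Complex.norm_real, Real.norm_of_nonneg (by positivity), ← hN,
      inv_mul_cancel₀ hN0.ne']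
  have hsum : (starRingEnd ℂ) a * a + (starRingEnd ℂ) b * b = 1 := by
    rw [← hip, ← hx, inner_self_eq_norm_sq_to_K, hxn]; norm_num
  have hyn : ‖y‖ = 1 := by
    have h1 : inner ℂ y y = 1 := by
      rw [hy, hip, map_neg, Complex.conj_conj, Complex.conj_conj, ← hsum]; ring
    have : ‖y‖ ^ 2 = 1 := by
      rw [← inner_self_eq_norm_sq (𝕜 := ℂ), h1]
      simp
    exact (pow_eq_one_iff_of_nonneg (norm_nonneg _) two_ne_zero).1 this
  have hxy : inner ℂ x y = 0 := by
    rw [hx, hy, hip]; ring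
  have hfx : M - δ < f x := by
    rwa [hxe, hf.smul _ _ (by exact_mod_cast (inv_ne_zero hN0.ne'))]
  have hle : ∀ s t : ℂ, s • x + t • y ≠ 0 → f (s • x + t • y) ≤ M := by
    intro s t hst
    have e : s • x + t • y = (s * a - t * (starRingEnd ℂ) b) • x₀ +
      (s * b + t * (starRingEnd ℂ) a) • y₀ := by rw [hx, hy]; module
    rw [e] at hst ⊢
    exact le_csSup hbd ⟨_, _, hst, rfl⟩
  have nq : ∀ s t : ℂ, ‖s • x + t • y‖ ^ 2 = ‖s‖ ^ 2 + ‖t‖ ^ 2 := by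
    intro s t
    rw [norm_add_sq (𝕜 := ℂ), inner_smul_left, inner_smul_right, hxy, norm_smul, norm_smul, hxn, hyn]
    simp
  have hle2 : ∀ s t : ℂ, quad f (s • x + t • y) ≤ M * (‖s‖ ^ 2 + ‖t‖ ^ 2) := by
    intro s t
    rw [quad, nq, mul_comm]
    by_cases h0 : s • x + t • y = 0
    · have := nq s t
      rw [h0, norm_zero] at this
      rw [← this]; simp
    · exact mul_le_mul_of_nonneg_right (hle s t h0) (by positivity)
  refine ⟨x, y, f x, f y, ⟨(starRingEnd ℂ) a, -b, (starRingEnd ℂ) b, a, ?_, ?_⟩, hxn, hyn, hxy, ?_⟩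
  · have : (starRingEnd ℂ) a • x + (-b) • y =
        ((starRingEnd ℂ) a * a + (starRingEnd ℂ) b * b) • x₀ := by
      rw [hx, hy]; module
    rw [this, hsum, one_smul]
  · have : (starRingEnd ℂ) b • x + a • y =
        ((starRingEnd ℂ) a * a + (starRingEnd ℂ) b * b) • y₀ := by
      rw [hx, hy]; module
    rw [this, hsum, one_smul]
  intro s t
  obtain ⟨us, hus, hs⟩ : ∃ u : ℂ, ‖u‖ = 1 ∧ s = ‖s‖ * u :=
    ⟨Complex.exp (s.arg * Complex.I), Complex.norm_exp_ofReal_mul_I _,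
      (Complex.norm_mul_exp_arg_mul_I s).symm⟩
  obtain ⟨ut, hut, ht⟩ : ∃ u : ℂ, ‖u‖ = 1 ∧ t = ‖t‖ * u :=
    ⟨Complex.exp (t.arg * Complex.I), Complex.norm_exp_ofReal_mul_I _,
      (Complex.norm_mul_exp_arg_mul_I t).symm⟩
  have us0 : us ≠ 0 := by rw [← norm_ne_zero_iff, hus]; norm_num
  have ut0 : ut ≠ 0 := by rw [← norm_ne_zero_iff, hut]; norm_num
  obtain ⟨γ, hγ⟩ := hf.exists_real_form hC hV (x := us • x) (y := ut • y)
    (by rw [norm_smul, hus, hxn, one_mul]) (by rw [norm_smul, hut, hyn, one_mul])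
    (by rw [inner_smul_left, inner_smul_right, hxy]; simp)
  rw [hf.smul _ _ us0, hf.smul _ _ ut0] at hγ
  have hγ2 : γ ^ 2 ≤ 4 * ((M - f x) * (M - f y)) := by
    apply abs_le_of_quadratic_nonneg
    intro p q
    have h1 := hle2 (p * us) (q * ut)
    rw [mul_smul, mul_smul, hγ, norm_mul, norm_mul, hus, hut, Complex.norm_real, Complex.norm_real,
      mul_one, mul_one, Real.norm_eq_abs, Real.norm_eq_abs, sq_abs, sq_abs] at h1
    linarith
  have hx0 : x ≠ 0 := by rw [← norm_ne_zero_iff, hxn]; norm_num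
  have hy0 : y ≠ 0 := by rw [← norm_ne_zero_iff, hyn]; norm_num
  have hfy : M - f y ≤ 2 * (C + 1) := by
    have := (abs_le.1 (hC y hy0)).1
    linarith
  have hMx : 0 ≤ M - f x := by
    have := hle 1 0 (by simpa using hx0)
    simp at this
    linarith
  have hγκ : |γ| ≤ κ := by
    apply abs_le_of_sq_le_sq _ hκ.le
    calc γ ^ 2 ≤ 4 * ((M - f x) * (M - f y)) := hγ2
      _ ≤ 4 * ((M - f x) * (2 * (C + 1))) := by gcongr
      _ ≤ 4 * (δ * (2 * (C + 1))) := by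
        have : M - f x ≤ δ := by linarith
        gcongr
      _ = κ ^ 2 := by rw [hδ]; field_simp; norm_num
  have h1 := hγ ‖s‖ ‖t‖
  rw [← mul_smul, ← mul_smul, ← hs, ← ht] at h1
  rw [h1, show ‖s‖ ^ 2 * f x + ‖t‖ ^ 2 * f y + ‖s‖ * ‖t‖ * γ - (f x * ‖s‖ ^ 2 + f y * ‖t‖ ^ 2) =
    (‖s‖ * ‖t‖) * γ by ring, abs_mul, abs_of_nonneg (by positivity), mul_comm κ]
  gcongr

end IsComplexFrameFn

namespace IsComplexFrameFn

variable {V : Type*} [NormedAddCommGroup V] [InnerProductSpace ℂ V] {f : V → ℝ} {C : ℝ}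

theorem exists_unit_smul_eq (hV : ∀ x y : V, ∃ z, ‖z‖ = 1 ∧ inner ℂ x z = 0 ∧ inner ℂ y z = 0)
    (x w : V) (h : inner ℂ x w = 0) :
    ∃ y : V, ‖y‖ = 1 ∧ inner ℂ x y = 0 ∧ ∃ b : ℂ, w = b • y := by
  by_cases hw : w = 0
  · obtain ⟨z, hz, hxz, -⟩ := hV x x
    exact ⟨z, hz, hxz, 0, by simp [hw]⟩
  · have hw' : ‖w‖ ≠ 0 := norm_ne_zero_iff.2 hw
    refine ⟨((‖w‖⁻¹ : ℝ) : ℂ) • w, ?_, ?_, ((‖w‖ : ℝ) : ℂ), ?_⟩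
    · rw [norm_smul, Complex.norm_real, norm_inv, norm_norm, inv_mul_cancel₀ hw']
    · rw [inner_smul_right, h, mul_zero]
    · rw [smul_smul, ← Complex.ofReal_mul, mul_inv_cancel₀ hw', Complex.ofReal_one, one_smul]

theorem exists_orthonormal_pair
    (hV : ∀ x y : V, ∃ z, ‖z‖ = 1 ∧ inner ℂ x z = 0 ∧ inner ℂ y z = 0) (u v : V) :
    ∃ x y : V, ‖x‖ = 1 ∧ ‖y‖ = 1 ∧ inner ℂ x y = 0 ∧
      (∃ a : ℂ, u = a • x) ∧ ∃ a b : ℂ, v = a • x + b • y := by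
  obtain ⟨x, hx, -, a, ha⟩ := exists_unit_smul_eq hV 0 u (inner_zero_left _)
  obtain ⟨y, hy, hxy, b, hb⟩ := exists_unit_smul_eq hV x (v - inner ℂ x v • x) (by
    rw [inner_sub_right, inner_smul_right, inner_self_eq_norm_sq_to_K, hx]; simp)
  exact ⟨x, y, hx, hy, hxy, ⟨a, ha⟩, inner ℂ x v, b, by rw [← hb]; abel⟩

theorem exists_near_form (hf : IsComplexFrameFn f) (hC : ∀ x ≠ 0, |f x| ≤ C)
    (hV : ∀ x y : V, ∃ z, ‖z‖ = 1 ∧ inner ℂ x z = 0 ∧ inner ℂ y z = 0) (u v : V)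
    {κ : ℝ} (hκ : 0 < κ) :
    ∃ (p r : ℝ) (g : ℂ), ∀ s t : ℂ, |quad f (s • u + t • v) -
      (p * ‖s‖ ^ 2 + r * ‖t‖ ^ 2 + 2 * (g * s * (starRingEnd ℂ) t).re)| ≤
        κ * ‖s • u + t • v‖ ^ 2 := by
  obtain ⟨x₀, y₀, hx₀, hy₀, hxy₀, ⟨k, hu⟩, l, m, hv⟩ := exists_orthonormal_pair hV u v
  obtain ⟨x, y, α, β, ⟨a, b, c, d, hxa, hya⟩, hx, hy, hxy, h⟩ :=
    hf.exists_near_diagonal hC hV hx₀ hy₀ hxy₀ hκ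
  obtain ⟨a₁, b₁, hu'⟩ : ∃ a₁ b₁ : ℂ, u = a₁ • x + b₁ • y :=
    ⟨k * a, k * b, by rw [hu, hxa]; module⟩
  obtain ⟨a₂, b₂, hv'⟩ : ∃ a₂ b₂ : ℂ, v = a₂ • x + b₂ • y :=
    ⟨l * a + m * c, l * b + m * d, by rw [hv, hxa, hya]; module⟩
  refine ⟨α * ‖a₁‖ ^ 2 + β * ‖b₁‖ ^ 2, α * ‖a₂‖ ^ 2 + β * ‖b₂‖ ^ 2,
    α * (a₁ * (starRingEnd ℂ) a₂) + β * (b₁ * (starRingEnd ℂ) b₂), fun s t => ?_⟩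
  have e : s • u + t • v = (s * a₁ + t * a₂) • x + (s * b₁ + t * b₂) • y := by
    rw [hu', hv']; module
  have hn : ∀ a b : ℂ, ‖a • x + b • y‖ ^ 2 = ‖a‖ ^ 2 + ‖b‖ ^ 2 := by
    intro a b
    rw [norm_add_sq (𝕜 := ℂ), inner_smul_left, inner_smul_right, hxy, norm_smul, norm_smul, hx, hy]
    simp
  have key : ∀ a b : ℂ, ‖s * a + t * b‖ ^ 2 = ‖a‖ ^ 2 * ‖s‖ ^ 2 + ‖b‖ ^ 2 * ‖t‖ ^ 2 +
      2 * (a * (starRingEnd ℂ) b * s * (starRingEnd ℂ) t).re := by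
    intro a b
    simp only [← Complex.normSq_eq_norm_sq, Complex.normSq_apply, Complex.add_re, Complex.mul_re,
      Complex.mul_im, Complex.add_im, Complex.conj_re, Complex.conj_im]
    ring
  have h1 := h (s * a₁ + t * a₂) (s * b₁ + t * b₂)
  rw [e, hn]
  refine le_trans (le_of_eq ?_) (h1.trans ?_)
  · congr 2
    rw [key, key]
    simp only [add_mul, Complex.add_re, mul_assoc, Complex.re_ofReal_mul]
    ring
  · gcongr
    nlinarith [sq_nonneg (‖s * a₁ + t * a₂‖ - ‖s * b₁ + t * b₂‖),
      sq_nonneg (‖s * a₁ + t * a₂‖ + ‖s * b₁ + t * b₂‖)]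

theorem exists_form (hf : IsComplexFrameFn f) (hC : ∀ x ≠ 0, |f x| ≤ C)
    (hV : ∀ x y : V, ∃ z, ‖z‖ = 1 ∧ inner ℂ x z = 0 ∧ inner ℂ y z = 0) (u v : V) :
    ∃ g : ℂ, ∀ s t : ℂ, quad f (s • u + t • v) =
      quad f u * ‖s‖ ^ 2 + quad f v * ‖t‖ ^ 2 + 2 * (g * s * (starRingEnd ℂ) t).re := by
  have hpos : ∀ n : ℕ, (0 : ℝ) < 1 / ((n : ℝ) + 1) := fun n => by positivity
  choose p r g h using fun n : ℕ => hf.exists_near_form hC hV u v (hpos n)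
  have lim : ∀ s t : ℂ, Tendsto (fun n => p n * ‖s‖ ^ 2 + r n * ‖t‖ ^ 2 +
      2 * (g n * s * (starRingEnd ℂ) t).re) atTop (𝓝 (quad f (s • u + t • v))) := by
    intro s t
    rw [tendsto_iff_norm_sub_tendsto_zero]
    refine squeeze_zero (fun _ => norm_nonneg _)
      (fun n => ?_) (g := fun n : ℕ => 1 / ((n : ℝ) + 1) * ‖s • u + t • v‖ ^ 2) ?_
    · rw [Real.norm_eq_abs, abs_sub_comm]; exact h n s t
    · simpa using tendsto_one_div_add_atTop_nhds_zero_nat.mul_const (‖s • u + t • v‖ ^ 2)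
  have hp : Tendsto p atTop (𝓝 (quad f u)) := by simpa using lim 1 0
  have hr : Tendsto r atTop (𝓝 (quad f v)) := by simpa using lim 0 1
  have hre : Tendsto (fun n => (g n).re) atTop
      (𝓝 ((quad f (u + v) - quad f u - quad f v) / 2)) := by
    have h1 := (((lim 1 1).sub hp).sub hr).div_const 2
    simp only [one_smul] at h1
    refine h1.congr fun n => ?_
    simp
    ring
  have him : Tendsto (fun n => (g n).im) atTop
      (𝓝 ((quad f u + quad f v - quad f (Complex.I • u + v)) / 2)) := by
    have h1 := ((hp.add hr).sub (lim Complex.I 1)).div_const 2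
    simp only [one_smul] at h1
    refine h1.congr fun n => ?_
    simp
  refine ⟨⟨(quad f (u + v) - quad f u - quad f v) / 2,
    (quad f u + quad f v - quad f (Complex.I • u + v)) / 2⟩, fun s t => ?_⟩
  refine tendsto_nhds_unique (lim s t) ?_
  have e : ∀ g : ℂ, (g * s * (starRingEnd ℂ) t).re =
      g.re * (s * (starRingEnd ℂ) t).re - g.im * (s * (starRingEnd ℂ) t).im := by
    intro g; rw [mul_assoc, Complex.mul_re]
  simp only [e]
  exact ((hp.mul_const _).add (hr.mul_const _)).add
    (((hre.mul_const _).sub (him.mul_const _)).const_mul 2)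

end IsComplexFrameFn

namespace IsComplexFrameFn

variable {V : Type*} [NormedAddCommGroup V] [InnerProductSpace ℂ V]

theorem eq_of_re_mul_eq {g h : ℂ}
    (H : ∀ s : ℂ, (g * s).re = (h * s).re) : g = h := by
  have h1 := H 1
  have h2 := H Complex.I
  apply Complex.ext
  · simpa using h1
  · simpa using h2

theorem exists_sesq_real {f : V → ℝ} {C : ℝ} (hf : IsComplexFrameFn f) (hC : ∀ x ≠ 0, |f x| ≤ C)
    (hV : ∀ x y : V, ∃ z, ‖z‖ = 1 ∧ inner ℂ x z = 0 ∧ inner ℂ y z = 0) :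
    ∃ S : V →ₗ⋆[ℂ] V →ₗ[ℂ] ℂ, ∀ x, S x x = quad f x := by
  choose T hT using hf.exists_form hC hV
  have smulT : ∀ (c : ℂ) u v, T (c • u) v = c * T u v := by
    intro c u v
    apply eq_of_re_mul_eq
    intro s
    have h1 := hT (c • u) v s 1
    have h2 := hT u v (s * c) 1
    have h3 := hT (c • u) v s 0
    have h4 := hT u v (s * c) 0
    rw [smul_smul] at h1 h3
    simp only [map_zero, map_one, mul_zero, mul_one, Complex.zero_re] at h1 h2 h3 h4
    have : T u v * (s * c) = c * T u v * s := by ring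
    rw [this] at h2
    rw [h1] at h2
    rw [h3] at h4
    simp only [norm_zero] at h4
    linarith
  have conjT : ∀ u v, T v u = (starRingEnd ℂ) (T u v) := by
    intro u v
    apply eq_of_re_mul_eq
    intro s
    have h1 := hT u v 1 s
    have h2 := hT v u s 1
    rw [add_comm (s • v)] at h2
    rw [h1] at h2
    have e : ((starRingEnd ℂ) (T u v) * s).re = (T u v * (starRingEnd ℂ) s).re := by
      simp
    rw [e]
    simp only [map_one, mul_one] at h2
    linarith
  have reT : ∀ u v, (T u v).re = (quad f (u + v) - quad f (u - v)) / 4 := by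
    intro u v
    have h1 := hT u v 1 1
    have h2 := hT u v 1 (-1)
    simp only [one_smul, neg_smul, ← sub_eq_add_neg, map_one, map_neg, mul_one, norm_neg, mul_neg,
      Complex.neg_re] at h1 h2
    rw [h1, h2]; ring
  have par : ∀ u v, quad f (u + v) + quad f (u - v) = 2 * quad f u + 2 * quad f v := by
    intro u v
    have h1 := hT u v 1 1
    have h2 := hT u v 1 (-1)
    simp only [one_smul, neg_smul, ← sub_eq_add_neg, map_one, map_neg, mul_one, norm_neg, mul_neg,
      Complex.neg_re, norm_one] at h1 h2
    rw [h1, h2]; ring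
  have readd : ∀ a b v, (T (a + b) v).re = (T a v).re + (T b v).re := by
    intro a b v
    have key : ∀ u u', (T (u + u') v).re + (T (u - u') v).re = 2 * (T u v).re := by
      intro u u'
      rw [reT, reT, reT]
      have h1 := par (u + v) u'
      have h2 := par (u - v) u'
      rw [show u + v + u' = u + u' + v by abel, show u + v - u' = u - u' + v by abel] at h1
      rw [show u - v + u' = u + u' - v by abel, show u - v - u' = u - u' - v by abel] at h2
      linarith
    have h1 := key ((1 / 2 : ℂ) • (a + b)) ((1 / 2 : ℂ) • (a - b))
    rw [show (1 / 2 : ℂ) • (a + b) + (1 / 2 : ℂ) • (a - b) = a by module,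
      show (1 / 2 : ℂ) • (a + b) - (1 / 2 : ℂ) • (a - b) = b by module, smulT] at h1
    rw [h1]
    simp
  have addT : ∀ a b v, T (a + b) v = T a v + T b v := by
    intro a b v
    apply Complex.ext
    · rw [readd, Complex.add_re]
    · have h1 := readd (Complex.I • a) (Complex.I • b) v
      rw [← smul_add, smulT, smulT, smulT] at h1
      simp at h1
      rw [Complex.add_im]; linarith
  refine ⟨LinearMap.mk₂'ₛₗ (starRingEnd ℂ) (RingHom.id ℂ) (fun v u => T u v) ?_ ?_ ?_ ?_, ?_⟩
  · intro v v' u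
    rw [conjT (v + v'), addT, map_add, ← conjT, ← conjT]
  · intro c v u
    rw [conjT (c • v), smulT, map_mul, ← conjT, smul_eq_mul]
  · intro v u u'
    exact addT u u' v
  · intro c v u
    exact smulT c u v
  · intro x
    simp only [LinearMap.mk₂'ₛₗ_apply]
    have h1 := hT x x 1 0
    have h0 := hT x x 1 1
    have h2 := hT x x Complex.I 1
    have h3 := hT x x (1 + 1) 0
    have h4 := hT x x (Complex.I + 1) 0
    rw [← add_smul] at h0 h2
    rw [zero_smul, add_zero] at h3 h4
    rw [h3] at h0
    rw [h4] at h2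
    have n2 : ‖(1 + 1 : ℂ)‖ = 2 := by norm_num
    have nI : ‖(Complex.I + 1 : ℂ)‖ ^ 2 = 2 := by
      rw [← Complex.normSq_eq_norm_sq, Complex.normSq_apply]; simp; norm_num
    rw [n2] at h0
    rw [nI] at h2
    simp at h0 h2
    apply Complex.ext
    · rw [Complex.ofReal_re]; linarith
    · rw [Complex.ofReal_im]; linarith

/-- **Gleason's theorem** for bounded homogeneous complex-valued functions. -/
theorem exists_sesq {f : V → ℂ} {C : ℝ} (hre : IsComplexFrameFn fun x => (f x).re)
    (him : IsComplexFrameFn fun x => (f x).im) (hC : ∀ x ≠ 0, ‖f x‖ ≤ C)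
    (hV : ∀ x y : V, ∃ z, ‖z‖ = 1 ∧ inner ℂ x z = 0 ∧ inner ℂ y z = 0) :
    ∃ S : V →ₗ⋆[ℂ] V →ₗ[ℂ] ℂ, ∀ x, S x x = (‖x‖ ^ 2 : ℝ) * f x := by
  obtain ⟨S, hS⟩ := hre.exists_sesq_real
    (fun x hx => (Complex.abs_re_le_norm _).trans (hC x hx)) hV
  obtain ⟨S', hS'⟩ := him.exists_sesq_real
    (fun x hx => (Complex.abs_im_le_norm _).trans (hC x hx)) hV
  refine ⟨S + Complex.I • S', fun x => ?_⟩
  rw [LinearMap.add_apply, LinearMap.add_apply, LinearMap.smul_apply, LinearMap.smul_apply, hS,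
    hS', quad, quad]
  conv_rhs => rw [← Complex.re_add_im (f x)]
  push_cast
  rw [smul_eq_mul]
  ring

end IsComplexFrameFn

/-- A bounded, finitely additive complex-valued function on the projections of a star algebra. -/
structure IsProjCharge {A : Type*} [Ring A] [StarRing A] (μ : A → ℂ) (K : ℝ) : Prop where
  add : ∀ p q : A, IsStarProjection p → IsStarProjection q → p * q = 0 → μ (p + q) = μ p + μ q
  bound : ∀ p : A, IsStarProjection p → ‖μ p‖ ≤ K

/-- A sesquilinear family of matrix units in `A` indexed by an inner product space. -/
structure IsMatrixUnits {V A : Type*} [NormedAddCommGroup V] [InnerProductSpace ℂ V]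
    [Ring A] [StarRing A] [Algebra ℂ A] (E : V → V → A) : Prop where
  add_left : ∀ x y z, E (x + y) z = E x z + E y z
  smul_left : ∀ (c : ℂ) x y, E (c • x) y = c • E x y
  star : ∀ x y, star (E x y) = E y x
  mul : ∀ x y z t, E x y * E z t = inner ℂ y z • E x t

namespace IsMatrixUnits

variable {V A : Type*} [NormedAddCommGroup V] [InnerProductSpace ℂ V]
    [Ring A] [StarRing A] [Algebra ℂ A] {E : V → V → A}

theorem inner_self_eq_ofReal (x : V) : inner ℂ x x = ((‖x‖ ^ 2 : ℝ) : ℂ) := by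
  rw [inner_self_eq_norm_sq_to_K]
  push_cast
  rfl

theorem add_right (hE : IsMatrixUnits E) (x y z : V) : E x (y + z) = E x y + E x z := by
  rw [← hE.star, hE.add_left, star_add, hE.star, hE.star]

theorem mul_eq_zero (hE : IsMatrixUnits E) {x y : V} (h : inner ℂ x y = 0) (a b : ℂ) :
    (a • E x x) * (b • E y y) = 0 := by
  rw [smul_mul_smul_comm, hE.mul, h, zero_smul, smul_zero]

variable [StarModule ℂ A]

theorem smul_right (hE : IsMatrixUnits E) (c : ℂ) (x y : V) :
    E x (c • y) = (starRingEnd ℂ) c • E x y := by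
  rw [← hE.star, hE.smul_left, star_smul, hE.star]; rfl

theorem isStarProjection (hE : IsMatrixUnits E) {x : V} (hx : x ≠ 0) :
    IsStarProjection ((((‖x‖ ^ 2)⁻¹ : ℝ) : ℂ) • E x x) := by
  have hx' : (‖x‖ : ℝ) ^ 2 ≠ 0 := pow_ne_zero _ (norm_ne_zero_iff.2 hx)
  constructor
  · rw [IsIdempotentElem, smul_mul_smul_comm, hE.mul, smul_smul]
    congr 1
    rw [inner_self_eq_ofReal]
    have : ((‖x‖ ^ 2 : ℝ) : ℂ) ≠ 0 := by exact_mod_cast hx'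
    push_cast at this ⊢
    field_simp
  · rw [IsSelfAdjoint, star_smul, hE.star]
    congr 1
    exact Complex.conj_ofReal _

theorem rot_eq (hE : IsMatrixUnits E) {x y : V} (hx : x ≠ 0) (hy : y ≠ 0)
    (hxy : inner ℂ x y = 0) (a b : ℝ) (hab : a ≠ 0 ∨ b ≠ 0) {x' y' : V}
    (hx' : x' = (a : ℂ) • x + (b : ℂ) • y)
    (hy' : y' = ((-(b * ‖y‖ ^ 2) : ℝ) : ℂ) • x + ((a * ‖x‖ ^ 2 : ℝ) : ℂ) • y) :
    x' ≠ 0 ∧ y' ≠ 0 ∧ inner ℂ x' y' = 0 ∧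
    (((‖x'‖ ^ 2)⁻¹ : ℝ) : ℂ) • E x' x' + (((‖y'‖ ^ 2)⁻¹ : ℝ) : ℂ) • E y' y' =
      (((‖x‖ ^ 2)⁻¹ : ℝ) : ℂ) • E x x + (((‖y‖ ^ 2)⁻¹ : ℝ) : ℂ) • E y y := by
  have hX : 0 < ‖x‖ ^ 2 := by have := norm_pos_iff.2 hx; positivity
  have hY : 0 < ‖y‖ ^ 2 := by have := norm_pos_iff.2 hy; positivity
  have hyx : inner ℂ y x = 0 := by rw [← inner_conj_symm, hxy, map_zero]
  have nsq : ∀ s t : ℝ, ‖(s : ℂ) • x + (t : ℂ) • y‖ ^ 2 = s ^ 2 * ‖x‖ ^ 2 + t ^ 2 * ‖y‖ ^ 2 := by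
    intro s t
    rw [norm_add_sq (𝕜 := ℂ), inner_smul_left, inner_smul_right, hxy, norm_smul, norm_smul]
    simp [mul_pow]
  have hN : 0 < a ^ 2 * ‖x‖ ^ 2 + b ^ 2 * ‖y‖ ^ 2 := by
    rcases hab with h | h <;> positivity
  have nx' : ‖x'‖ ^ 2 = a ^ 2 * ‖x‖ ^ 2 + b ^ 2 * ‖y‖ ^ 2 := by rw [hx', nsq]
  have ny' : ‖y'‖ ^ 2 = ‖x‖ ^ 2 * ‖y‖ ^ 2 * (a ^ 2 * ‖x‖ ^ 2 + b ^ 2 * ‖y‖ ^ 2) := by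
    rw [hy', nsq]; ring
  refine ⟨?_, ?_, ?_, ?_⟩
  · rintro h; rw [h, norm_zero, zero_pow two_ne_zero] at nx'; linarith
  · rintro h; rw [h] at ny'
    have : 0 < ‖x‖ ^ 2 * ‖y‖ ^ 2 * (a ^ 2 * ‖x‖ ^ 2 + b ^ 2 * ‖y‖ ^ 2) := by positivity
    rw [← ny'] at this
    simp at this
  · rw [hx', hy']
    simp only [inner_add_left, inner_add_right, inner_smul_left, inner_smul_right, hxy, hyx,
      inner_self_eq_ofReal, Complex.conj_ofReal]
    push_cast
    ring
  · rw [nx', ny', hx', hy']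
    simp only [hE.add_left, hE.add_right, hE.smul_left, hE.smul_right, Complex.conj_ofReal]
    set X := ‖x‖ ^ 2
    set Y := ‖y‖ ^ 2
    have hX' : (X : ℂ) ≠ 0 := by exact_mod_cast hX.ne'
    have hY' : (Y : ℂ) ≠ 0 := by exact_mod_cast hY.ne'
    have hN' : ((a : ℂ) ^ 2 * X + (b : ℂ) ^ 2 * Y) ≠ 0 := by exact_mod_cast hN.ne'
    push_cast
    match_scalars <;> field_simp <;> ring

theorem isComplexFrameFn (hE : IsMatrixUnits E) {μ : A → ℂ} {K : ℝ} (hμ : IsProjCharge μ K)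
    (L : ℂ →ₗ[ℝ] ℝ) :
    IsComplexFrameFn fun x : V => L (μ ((((‖x‖ ^ 2)⁻¹ : ℝ) : ℂ) • E x x)) := by
  constructor
  · intro c x hc
    have hc' : ((‖c‖ : ℝ) : ℂ) ≠ 0 := by exact_mod_cast norm_ne_zero_iff.2 hc
    congr 2
    rw [hE.smul_left, hE.smul_right, smul_smul, smul_smul, norm_smul, mul_assoc, Complex.mul_conj,
      Complex.normSq_eq_norm_sq]
    congr 1
    rw [mul_pow, mul_inv]
    push_cast
    field_simp
  · intro x y hx hy hxy a b hab
    obtain ⟨hx', hy', hxy', h⟩ := hE.rot_eq hx hy hxy a b hab rfl rfl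
    rw [← map_add, ← hμ.add _ _ (hE.isStarProjection hx') (hE.isStarProjection hy')
      (hE.mul_eq_zero hxy' _ _), h, hμ.add _ _ (hE.isStarProjection hx) (hE.isStarProjection hy)
      (hE.mul_eq_zero hxy _ _), map_add]

/-- Gleason's theorem for charges along a system of matrix units. -/
theorem exists_sesq (hE : IsMatrixUnits E) {μ : A → ℂ} {K : ℝ} (hμ : IsProjCharge μ K)
    (hV : ∀ x y : V, ∃ z, ‖z‖ = 1 ∧ inner ℂ x z = 0 ∧ inner ℂ y z = 0) :
    ∃ S : V →ₗ⋆[ℂ] V →ₗ[ℂ] ℂ, ∀ x, ‖x‖ = 1 → S x x = μ (E x x) := by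
  obtain ⟨S, hS⟩ := IsComplexFrameFn.exists_sesq (C := K)
    (f := fun x : V => μ ((((‖x‖ ^ 2)⁻¹ : ℝ) : ℂ) • E x x))
    (hE.isComplexFrameFn hμ Complex.reLm) (hE.isComplexFrameFn hμ Complex.imLm)
    (fun x hx => hμ.bound _ (hE.isStarProjection hx)) hV
  refine ⟨S, fun x hx => ?_⟩
  rw [hS, hx]
  simp

end IsMatrixUnits

/-- A linear functional on `A` is controlled by its values on projections. -/
def HasProjBound (A : Type*) [NormedRing A] [StarRing A] [NormedAlgebra ℂ A] : Prop :=
  ∃ C : ℝ, 0 ≤ C ∧ ∀ (Φ : A →ₗ[ℂ] ℂ) (K : ℝ), (∀ p, IsStarProjection p → ‖Φ p‖ ≤ K) →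
    ∀ x, ‖Φ x‖ ≤ C * K * ‖x‖

/-- Every bounded charge on the projections of `A` extends to a linear functional. -/
def HasLinearExtension (A : Type*) [Ring A] [StarRing A] [Algebra ℂ A] : Prop :=
  ∀ (μ : A → ℂ) (K : ℝ), IsProjCharge μ K →
    ∃ Φ : A →ₗ[ℂ] ℂ, ∀ p, IsStarProjection p → Φ p = μ p

theorem IsProjCharge.map_zero {A : Type*} [Ring A] [StarRing A] {μ : A → ℂ} {K : ℝ}
    (hμ : IsProjCharge μ K) : μ 0 = 0 := by
  have := hμ.add 0 0 (.zero A) (.zero A) (by simp)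
  rw [add_zero] at this
  simpa using this

theorem IsProjCharge.map_sum {A : Type*} [Ring A] [StarRing A] {μ : A → ℂ} {K : ℝ}
    (hμ : IsProjCharge μ K) {ι : Type*} (s : Finset ι) (p : ι → A)
    (hp : ∀ i, IsStarProjection (p i)) (hpq : ∀ i j, i ≠ j → p i * p j = 0) :
    IsStarProjection (∑ i ∈ s, p i) ∧ μ (∑ i ∈ s, p i) = ∑ i ∈ s, μ (p i) := by
  classical
  induction s using Finset.induction_on with
  | empty => exact ⟨.zero A, hμ.map_zero⟩
  | insert i s hi ih =>
    have h0 : p i * ∑ j ∈ s, p j = 0 := by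
      rw [Finset.mul_sum]
      exact Finset.sum_eq_zero fun j hj => hpq i j (by rintro rfl; exact hi hj)
    rw [Finset.sum_insert hi, Finset.sum_insert hi]
    exact ⟨(hp i).add ih.1 h0, by rw [hμ.add _ _ (hp i) ih.1 h0, ih.2]⟩

theorem exists_orthogonal_unit {V : Type*} [NormedAddCommGroup V] [InnerProductSpace ℂ V]
    [FiniteDimensional ℂ V] (h : 2 < Module.finrank ℂ V) (x y : V) :
    ∃ z, ‖z‖ = 1 ∧ inner ℂ x z = 0 ∧ inner ℂ y z = 0 := by
  classical
  have h1 : Module.finrank ℂ (Submodule.span ℂ ({x, y} : Set V)) ≤ 2 := by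
    have := finrank_span_finset_le_card (R := ℂ) ({x, y} : Finset V)
    rw [Finset.coe_insert, Finset.coe_singleton] at this
    exact this.trans Finset.card_le_two
  have h2 := Submodule.finrank_add_finrank_orthogonal (Submodule.span ℂ ({x, y} : Set V))
  have h3 : 0 < Module.finrank ℂ (Submodule.span ℂ ({x, y} : Set V))ᗮ := by omega
  rw [Module.finrank_pos_iff] at h3
  obtain ⟨z, hz⟩ := exists_ne (0 : (Submodule.span ℂ ({x, y} : Set V))ᗮ)
  have hz0 : ‖(z : V)‖ ≠ 0 := by simpa using hz
  have hz' := z.2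
  rw [Submodule.mem_orthogonal] at hz'
  refine ⟨((‖(z : V)‖⁻¹ : ℝ) : ℂ) • (z : V), ?_, ?_, ?_⟩
  · rw [norm_smul, Complex.norm_real, norm_inv, norm_norm, inv_mul_cancel₀ hz0]
  · rw [inner_smul_right, hz' x (Submodule.subset_span (by simp)), mul_zero]
  · rw [inner_smul_right, hz' y (Submodule.subset_span (by simp)), mul_zero]

section

variable {H : Type*} [NormedAddCommGroup H] [InnerProductSpace ℂ H] [CompleteSpace H]

open InnerProductSpace

theorem isMatrixUnits_rankOne : IsMatrixUnits fun x y : H => rankOne ℂ x y where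
  add_left x y z := by simp
  smul_left c x y := by simp
  star x y := by rw [ContinuousLinearMap.star_eq_adjoint]; simp
  mul x y z t := by
    ext u
    simp [smul_smul, mul_comm]

theorem exists_eq_sum_rankOne [FiniteDimensional ℂ H] {p : H →L[ℂ] H} (hp : IsStarProjection p) :
    ∃ (n : ℕ) (v : Fin n → H), Orthonormal ℂ v ∧ p = ∑ i, rankOne ℂ (v i) (v i) := by
  obtain ⟨U, hU, rfl⟩ := isStarProjection_iff_eq_starProjection.1 hp
  let b := stdOrthonormalBasis ℂ U
  refine ⟨_, fun i => (b i : H), ?_, b.starProjection_eq_sum_rankOne⟩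
  exact b.orthonormal.comp_linearIsometry U.subtypeₗᵢ

theorem hasLinearExtension_of_finrank [FiniteDimensional ℂ H] (h : 2 < Module.finrank ℂ H) :
    HasLinearExtension (H →L[ℂ] H) := by
  intro μ K hμ
  obtain ⟨S, hS⟩ := isMatrixUnits_rankOne.exists_sesq hμ (exists_orthogonal_unit h)
  let b := stdOrthonormalBasis ℂ H
  let Φ : (H →L[ℂ] H) →ₗ[ℂ] ℂ :=
    ∑ i, (S (b i)).comp ((LinearMap.applyₗ (b i)).comp (ContinuousLinearMap.coeLM ℂ))
  have hΦ : ∀ v : H, ‖v‖ = 1 → Φ (rankOne ℂ v v) = μ (rankOne ℂ v v) := by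
    intro v hv
    have h1 : Φ (rankOne ℂ v v) = ∑ i, inner ℂ v (b i) • S (b i) v := by
      simp [Φ]
    rw [h1, ← hS v hv]
    have h2 : S v = ∑ i, inner ℂ v (b i) • S (b i) := by
      conv_lhs => rw [← b.sum_repr v]
      rw [map_sum]
      refine Finset.sum_congr rfl fun i _ => ?_
      rw [LinearMap.map_smulₛₗ, b.repr_apply_apply, inner_conj_symm]
    rw [h2, LinearMap.sum_apply]
    rfl
  refine ⟨Φ, fun p hp => ?_⟩
  obtain ⟨n, v, hv, rfl⟩ := exists_eq_sum_rankOne hp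
  have h2 := hμ.map_sum Finset.univ (fun i => rankOne ℂ (v i) (v i))
    (fun i => isStarProjection_rankOne_self (hv.1 i)) (fun i j hij => by
      rw [isMatrixUnits_rankOne.mul, hv.2 hij, zero_smul])
  rw [h2.2, map_sum]
  exact Finset.sum_congr rfl fun i _ => hΦ _ (hv.1 i)

theorem hasProjBound_of_finiteDimensional [FiniteDimensional ℂ H] : HasProjBound (H →L[ℂ] H) := by
  let b := stdOrthonormalBasis ℂ H
  refine ⟨(Module.finrank ℂ H) * 4, by positivity, fun Φ K hΦ x => ?_⟩
  have hK : 0 ≤ K := (norm_nonneg _).trans (hΦ 0 (.zero _))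
  have h1 : ∀ v : H, ‖Φ (rankOne ℂ v v)‖ ≤ K * ‖v‖ ^ 2 := by
    intro v
    by_cases hv : v = 0
    · simp [hv]
    · have h2 := hΦ _ (isMatrixUnits_rankOne.isStarProjection hv)
      rw [map_smul, norm_smul, Complex.norm_real, Real.norm_of_nonneg (by positivity)] at h2
      have : 0 < ‖v‖ ^ 2 := by have := norm_pos_iff.2 hv; positivity
      rwa [inv_mul_le_iff₀ this, mul_comm] at h2
  have h2 : ∀ u v : H, ‖u‖ = 1 → ‖v‖ = 1 → ‖Φ (rankOne ℂ u v)‖ ≤ 4 * K := by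
    intro u v hu hv
    have e : (4 : ℂ) • rankOne ℂ u v = rankOne ℂ (u + v) (u + v) +
        (-1 : ℂ) • rankOne ℂ (u + (-1 : ℂ) • v) (u + (-1 : ℂ) • v) +
        Complex.I • rankOne ℂ (u + Complex.I • v) (u + Complex.I • v) +
        (-Complex.I) • rankOne ℂ (u + (-Complex.I) • v) (u + (-Complex.I) • v) := by
      simp only [map_add, map_smul, add_apply, smul_apply,
        ContinuousLinearMap.map_smulₛₗ]
      simp only [map_neg, map_one, Complex.conj_I]
      match_scalars <;> ring_nf <;> simp <;> norm_num
    have h3 : ∀ c : ℂ, ‖c‖ = 1 → ‖Φ (rankOne ℂ (u + c • v) (u + c • v))‖ ≤ 4 * K := by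
      intro c hc
      refine (h1 _).trans ?_
      have : ‖u + c • v‖ ≤ 2 := by
        refine (norm_add_le _ _).trans ?_
        rw [norm_smul, hu, hv, hc]; norm_num
      have : ‖u + c • v‖ ^ 2 ≤ 2 ^ 2 := by gcongr
      nlinarith
    have h4 : ‖(4 : ℂ) * Φ (rankOne ℂ u v)‖ ≤ 4 * K + 4 * K + 4 * K + 4 * K := by
      rw [← smul_eq_mul, ← map_smul, e, map_add, map_add, map_add, map_smul, map_smul, map_smul]
      refine (norm_add_le _ _).trans (add_le_add ((norm_add_le _ _).trans
        (add_le_add ((norm_add_le _ _).trans (add_le_add ?_ ?_)) ?_)) ?_)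
      · simpa using h3 1 (by simp)
      · rw [norm_smul, norm_neg, norm_one, one_mul]; exact h3 _ (by simp)
      · rw [norm_smul, Complex.norm_I, one_mul]; exact h3 _ (by simp)
      · rw [norm_smul, norm_neg, Complex.norm_I, one_mul]; exact h3 _ (by simp)
    rw [norm_mul] at h4
    norm_num at h4
    linarith
  have h3 : ∀ u v : H, ‖v‖ = 1 → ‖Φ (rankOne ℂ u v)‖ ≤ 4 * K * ‖u‖ := by
    intro u v hv
    by_cases hu : u = 0
    · simp [hu]
    have hu' : ‖u‖ ≠ 0 := norm_ne_zero_iff.2 hu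
    have h4 := h2 (((‖u‖⁻¹ : ℝ) : ℂ) • u) v (by
      rw [norm_smul, Complex.norm_real, norm_inv, norm_norm, inv_mul_cancel₀ hu']) hv
    rw [map_smul, smul_apply, map_smul, norm_smul, Complex.norm_real, norm_inv,
      norm_norm, inv_mul_le_iff₀ (norm_pos_iff.2 hu)] at h4
    linarith
  have h4 : x = ∑ i, rankOne ℂ (x (b i)) (b i) := by
    conv_lhs => rw [← mul_one x, ContinuousLinearMap.one_def, ← b.sum_rankOne_eq_id, Finset.mul_sum]
    refine Finset.sum_congr rfl fun i _ => ?_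
    ext u
    simp
  conv_lhs => rw [h4, map_sum]
  refine (norm_sum_le _ _).trans ?_
  have h5 : ∀ i ∈ Finset.univ, ‖Φ (rankOne ℂ (x (b i)) (b i))‖ ≤ 4 * K * ‖x‖ := by
    intro i _
    refine (h3 _ _ (b.orthonormal.1 i)).trans ?_
    have := x.le_opNorm (b i)
    rw [b.orthonormal.1 i, mul_one] at this
    gcongr
  refine (Finset.sum_le_card_nsmul _ _ _ h5).trans (le_of_eq ?_)
  rw [Finset.card_univ, Fintype.card_fin, nsmul_eq_mul]
  ring

end

/-- Data expressing that `A` absorbs countable direct sums: orthogonal isometries and an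
amplification `σ` with `σ a = a ⊕ σ a`. -/
structure Amplification (A : Type*) [CStarAlgebra A] where
  S : ℕ → A
  shift : A
  σ : A →⋆ₐ[ℂ] A
  star_mul_self : ∀ n, star (S n) * S n = 1
  star_mul_of_ne : ∀ n m, n ≠ m → star (S n) * S m = 0
  shift_star_mul_self : star shift * shift = 1
  σ_eq : ∀ a, σ a = S 0 * a * star (S 0) + shift * σ a * star shift

section

variable {A : Type*} [CStarAlgebra A]

theorem star_mul_eq_zero_comm {v w : A} (h : star v * w = 0) : star w * v = 0 := by
  have := congrArg star h
  simpa using this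

theorem mul_mul_of_isometry {w : A} (hw : star w * w = 1) (x y : A) :
    w * x * star w * (w * y * star w) = w * (x * y) * star w := by
  calc _ = w * x * (star w * w) * y * star w := by noncomm_ring
    _ = _ := by rw [hw]; noncomm_ring

theorem IsStarProjection.conj_isometry {w p : A} (hw : star w * w = 1)
    (hp : IsStarProjection p) : IsStarProjection (w * p * star w) := by
  constructor
  · rw [IsIdempotentElem, mul_mul_of_isometry hw, hp.isIdempotentElem]
  · rw [IsSelfAdjoint]
    simp [hp.isSelfAdjoint.star_eq, mul_assoc]

theorem isStarProjection_isometry {w : A} (hw : star w * w = 1) :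
    IsStarProjection (w * star w) := by
  simpa using IsStarProjection.conj_isometry hw (.one A)

/-- `1/√2` as a complex number. -/
noncomputable def invSqrtTwo : ℂ := ((√2)⁻¹ : ℝ)

theorem star_invSqrtTwo : star invSqrtTwo = invSqrtTwo := Complex.conj_ofReal _

theorem invSqrtTwo_mul_self : invSqrtTwo * invSqrtTwo = 1 / 2 := by
  rw [invSqrtTwo, ← Complex.ofReal_mul, ← mul_inv, Real.mul_self_sqrt zero_le_two]
  norm_num

theorem half_add_half (a : A) : (1 / 2 : ℂ) • (a + a) = a := by
  rw [← two_smul ℂ a, smul_smul]; norm_num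

theorem star_mul_combo {a b c d : A} :
    star (invSqrtTwo • (a + b)) * (invSqrtTwo • (c + d)) =
      (1 / 2 : ℂ) • (star a * c + star a * d + star b * c + star b * d) := by
  rw [star_smul, star_invSqrtTwo, smul_mul_smul_comm, invSqrtTwo_mul_self, star_add]
  congr 1
  noncomm_ring

theorem combo_mul_star {a b c d : A} :
    (invSqrtTwo • (a + b)) * star (invSqrtTwo • (c + d)) =
      (1 / 2 : ℂ) • (a * star c + a * star d + b * star c + b * star d) := by
  rw [star_smul, star_invSqrtTwo, smul_mul_smul_comm, invSqrtTwo_mul_self, star_add]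
  congr 1
  noncomm_ring

theorem combo_isometry {a b : A} (ha : star a * a = 1) (hb : star b * b = 1)
    (hab : star a * b = 0) : star (invSqrtTwo • (a + b)) * (invSqrtTwo • (a + b)) = 1 := by
  rw [star_mul_combo, ha, hb, hab, star_mul_eq_zero_comm hab, add_zero, add_zero]
  exact half_add_half 1

variable {Φ : A →ₗ[ℂ] ℂ} {K : ℝ}

theorem norm_cross_unitary_le (hΦ : ∀ p, IsStarProjection p → ‖Φ p‖ ≤ K) {v w u : A}
    (hv : star v * v = 1) (hw : star w * w = 1) (hvw : star v * w = 0) (hu : u ∈ unitary A) :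
    ‖Φ (w * u * star v)‖ ≤ 4 * K := by
  have hK : 0 ≤ K := (norm_nonneg _).trans (hΦ 0 (.zero _))
  have iso : ∀ u ∈ unitary A, star (w * u) * (w * u) = 1 := by
    intro u hu
    calc star (w * u) * (w * u) = star u * (star w * w) * u := by rw [star_mul]; noncomm_ring
      _ = 1 := by rw [hw, mul_one, Unitary.star_mul_self_of_mem hu]
  have key : ∀ u ∈ unitary A,
      IsStarProjection ((1 / 2 : ℂ) • (v * star v + v * star (w * u) + w * u * star v +
        w * star w)) := by
    intro u hu
    have h1 := isStarProjection_isometry (combo_isometry hv (iso u hu) (by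
      rw [← mul_assoc, hvw, zero_mul]))
    rw [combo_mul_star] at h1
    have : w * u * star (w * u) = w * star w := by
      rw [star_mul]
      calc w * u * (star u * star w) = w * (u * star u) * star w := by noncomm_ring
        _ = _ := by rw [Unitary.mul_star_self_of_mem hu, mul_one]
    rwa [this] at h1
  have hI : Complex.I • u ∈ unitary A := by
    rw [Unitary.mem_iff] at hu ⊢
    simp [smul_smul, hu.1, hu.2]
  have h1 := hΦ _ (key u hu)
  have h2 := hΦ _ (key _ hI)
  have h3 := hΦ _ (isStarProjection_isometry hv)
  have h4 := hΦ _ (isStarProjection_isometry hw)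
  have e : w * u * star v = (1 / 2 : ℂ) • (v * star v + v * star (w * u) + w * u * star v +
        w * star w) - Complex.I • ((1 / 2 : ℂ) • (v * star v + v * star (w * (Complex.I • u)) +
        w * (Complex.I • u) * star v + w * star w)) -
        ((1 - Complex.I) / 2) • (v * star v) - ((1 - Complex.I) / 2) • (w * star w) := by
    simp only [star_mul, star_smul, mul_smul_comm, smul_mul_assoc, Complex.star_def, Complex.conj_I]
    match_scalars <;> ring_nf <;> (simp; try norm_num)
  have h5 : ‖(1 - Complex.I) / 2‖ ≤ 1 := by
    rw [norm_div]
    have := norm_sub_le 1 Complex.I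
    simp only [norm_one, Complex.norm_I] at this
    norm_num
    linarith
  rw [e, map_sub, map_sub, map_sub, map_smul Φ Complex.I, map_smul Φ ((1 - Complex.I) / 2),
    map_smul Φ ((1 - Complex.I) / 2)]
  have h6 : ∀ z : ℂ, ‖z‖ ≤ K → ‖((1 - Complex.I) / 2) • z‖ ≤ K := by
    intro z hz
    rw [norm_smul]
    nlinarith [norm_nonneg z]
  have h2' : ‖Complex.I • Φ ((1 / 2 : ℂ) • (v * star v + v * star (w * (Complex.I • u)) +
        w * (Complex.I • u) * star v + w * star w))‖ ≤ K := by
    rwa [norm_smul, Complex.norm_I, one_mul]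
  have h7 := norm_sub_le_of_le (norm_sub_le_of_le (norm_sub_le_of_le h1 h2') (h6 _ h3)) (h6 _ h4)
  linarith

theorem norm_cross_le (hΦ : ∀ p, IsStarProjection p → ‖Φ p‖ ≤ K) {v w : A}
    (hv : star v * v = 1) (hw : star w * w = 1) (hvw : star v * w = 0) (x : A) :
    ‖Φ (w * x * star v)‖ ≤ 8 * K * ‖x‖ := by
  obtain ⟨u, c, hx, hc⟩ := CStarAlgebra.exists_sum_four_unitary x
  have hK : 0 ≤ K := (norm_nonneg _).trans (hΦ 0 (.zero _))
  have e : Φ (w * x * star v) = ∑ i, c i • Φ (w * u i * star v) := by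
    conv_lhs => rw [hx]
    simp only [Finset.mul_sum, Finset.sum_mul, map_sum, mul_smul_comm, smul_mul_assoc, map_smul]
  rw [e]
  refine (norm_sum_le _ _).trans ((Finset.sum_le_card_nsmul _ _ (‖x‖ / 2 * (4 * K)) ?_).trans ?_)
  · intro i _
    rw [norm_smul]
    exact mul_le_mul (hc i) (norm_cross_unitary_le hΦ hv hw hvw (u i).2) (norm_nonneg _)
      (by positivity)
  · rw [Finset.card_univ, Fintype.card_fin, nsmul_eq_mul]
    norm_num
    linarith

theorem conj_sub_conj_eq (v w x : A) :
    v * x * star v - w * x * star w =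
      invSqrtTwo • (v + w) * x * star (invSqrtTwo • (v - w)) +
      invSqrtTwo • (v - w) * x * star (invSqrtTwo • (v + w)) := by
  simp only [star_smul, star_invSqrtTwo, smul_mul_assoc, mul_smul_comm, smul_smul,
    invSqrtTwo_mul_self]
  rw [← smul_add]
  have : (v + w) * x * star (v - w) + (v - w) * x * star (v + w) =
      (v * x * star v - w * x * star w) + (v * x * star v - w * x * star w) := by
    rw [star_add, star_sub]; noncomm_ring
  rw [this, half_add_half]

theorem star_neg_mul_neg_self {w : A} (hw : star w * w = 1) : star (-w) * -w = 1 := by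
  rw [star_neg, neg_mul_neg, hw]

theorem norm_conj_sub_conj_le (hΦ : ∀ p, IsStarProjection p → ‖Φ p‖ ≤ K) {v w : A}
    (hv : star v * v = 1) (hw : star w * w = 1) (hvw : star v * w = 0) (x : A) :
    ‖Φ (v * x * star v - w * x * star w)‖ ≤ 16 * K * ‖x‖ := by
  have hwv := star_mul_eq_zero_comm hvw
  have h1 := combo_isometry hv hw hvw
  have h2 : star (invSqrtTwo • (v - w)) * (invSqrtTwo • (v - w)) = 1 := by
    rw [sub_eq_add_neg]
    exact combo_isometry hv (star_neg_mul_neg_self hw) (by rw [mul_neg, hvw, neg_zero])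
  have h3 : star (invSqrtTwo • (v + w)) * (invSqrtTwo • (v - w)) = 0 := by
    rw [sub_eq_add_neg, star_mul_combo]
    simp [hv, hw, hvw, hwv]
  rw [conj_sub_conj_eq, map_add]
  have := norm_add_le_of_le (norm_cross_le hΦ h2 h1 (star_mul_eq_zero_comm h3) x)
    (norm_cross_le hΦ h1 h2 h3 x)
  linarith

end

namespace Amplification

variable {A : Type*} [CStarAlgebra A] (𝒮 : Amplification A)

/-- The telescoping identity behind the Eilenberg swindle. -/
theorem conj_S_eq (c w x : A) :
    c * 𝒮.S 0 * x * star (c * 𝒮.S 0) =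
      (c * 𝒮.σ x * star c - w * 𝒮.σ x * star w) -
        (c * 𝒮.shift * 𝒮.σ x * star (c * 𝒮.shift) - w * 𝒮.σ x * star w) := by
  have h := congrArg (fun z => c * z * star c) (𝒮.σ_eq x)
  simp only [star_mul] at h ⊢
  rw [sub_sub_sub_cancel_right, h]
  noncomm_ring

/-- A corner avoiding the range of an isometry is moved by an isometry `c` with room to spare. -/
theorem exists_mover {e t : A} (he : IsStarProjection e) (ht : star t * t = 1) (het : e * t = 0) :
    ∃ c w : A, star c * c = 1 ∧ star w * w = 1 ∧ star c * w = 0 ∧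
      c * 𝒮.S 0 * e = e ∧ star c * (t * 𝒮.S 3) = 0 ∧ star w * (t * 𝒮.S 3) = 0 ∧
      star (t * 𝒮.S 3) * (t * 𝒮.S 3) = 1 := by
  have hte : star t * e = 0 := by
    have := congrArg star het
    simpa [he.isSelfAdjoint.star_eq] using this
  have tS : ∀ n m, star (t * 𝒮.S n) * (t * 𝒮.S m) = star (𝒮.S n) * 𝒮.S m := by
    intro n m
    calc _ = star (𝒮.S n) * (star t * t) * 𝒮.S m := by rw [star_mul]; noncomm_ring
      _ = _ := by rw [ht, mul_one]
  have etS : ∀ n, e * (t * 𝒮.S n) = 0 := fun n => by rw [← mul_assoc, het, zero_mul]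
  have tSe : ∀ n, star (t * 𝒮.S n) * e = 0 := fun n => by
    rw [star_mul, mul_assoc, hte, mul_zero]
  set k := e + t * 𝒮.S 0 * (1 - e) with hk
  have hkn : ∀ n, n ≠ 0 → star k * (t * 𝒮.S n) = 0 := by
    intro n hn
    rw [hk, star_add, add_mul, he.isSelfAdjoint.star_eq, etS, star_mul (t * 𝒮.S 0), mul_assoc, tS,
      𝒮.star_mul_of_ne _ _ hn.symm, mul_zero, zero_add]
  have hkk : star k * k = 1 := by
    have h1 : star k * (t * 𝒮.S 0) = 1 - e := by
      rw [hk, star_add, add_mul, he.isSelfAdjoint.star_eq, etS, star_mul (t * 𝒮.S 0), mul_assoc, tS,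
        𝒮.star_mul_self, star_sub, star_one, he.isSelfAdjoint.star_eq, mul_one, zero_add]
    have h2 : star k * e = e := by
      rw [hk, star_add, add_mul, he.isSelfAdjoint.star_eq, he.isIdempotentElem.eq,
        star_mul (t * 𝒮.S 0), mul_assoc, tSe, mul_zero, add_zero]
    calc star k * k = star k * e + star k * (t * 𝒮.S 0) * (1 - e) := by
          conv_lhs => rw [hk, mul_add, ← hk, ← mul_assoc]
      _ = 1 := by
        rw [h1, h2, he.one_sub.isIdempotentElem.eq]; abel
  set s := 𝒮.S 0 with hs
  have hss : star s * s = 1 := 𝒮.star_mul_self 0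
  have hcn : ∀ n, 1 < n → star (k * star s + t * 𝒮.S 1 * (1 - s * star s)) * (t * 𝒮.S n) = 0 := by
    intro n hn
    rw [star_add, add_mul, star_mul k, star_mul (t * 𝒮.S 1), mul_assoc, mul_assoc,
      hkn n (by omega), tS, 𝒮.star_mul_of_ne 1 n (by omega), mul_zero, mul_zero, add_zero]
  refine ⟨k * star s + t * 𝒮.S 1 * (1 - s * star s), t * 𝒮.S 2, ?_, ?_, ?_, ?_, ?_, ?_, ?_⟩
  · have hp : IsStarProjection (1 - s * star s) := (isStarProjection_isometry hss).one_sub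
    have h1 := hkn 1 one_ne_zero
    have h2 := star_mul_eq_zero_comm h1
    have h3 : star (t * 𝒮.S 1) * (t * 𝒮.S 1) = 1 := by rw [tS, 𝒮.star_mul_self]
    generalize t * 𝒮.S 1 = r at *
    rw [star_add, star_mul k, star_mul r, star_star, hp.isSelfAdjoint.star_eq]
    calc (s * star k + (1 - s * star s) * star r) * (k * star s + r * (1 - s * star s))
        = s * (star k * k) * star s + s * (star k * r) * (1 - s * star s) +
          (1 - s * star s) * (star r * k) * star s +
          (1 - s * star s) * (star r * r) * (1 - s * star s) := by noncomm_ring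
      _ = 1 := by
        rw [hkk, h1, h2, h3, mul_one, mul_zero, mul_zero, zero_mul, zero_mul, mul_one,
          hp.isIdempotentElem.eq]
        abel
  · rw [tS, 𝒮.star_mul_self]
  · exact hcn 2 (by norm_num)
  · have : (k * star s + t * 𝒮.S 1 * (1 - s * star s)) * s * e =
        k * (star s * s) * e + t * 𝒮.S 1 * (s - s * (star s * s)) * e := by noncomm_ring
    rw [this, hss, mul_one, mul_one, sub_self, mul_zero, zero_mul, add_zero, hk, add_mul,
      he.isIdempotentElem.eq, mul_assoc, he.one_sub_mul_self, mul_zero, add_zero]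
  · exact hcn 3 (by norm_num)
  · rw [tS, 𝒮.star_mul_of_ne _ _ (by norm_num)]
  · rw [tS, 𝒮.star_mul_self]

theorem norm_corner_le (𝒮 : Amplification A) {Φ : A →ₗ[ℂ] ℂ} {K : ℝ}
    (hΦ : ∀ p, IsStarProjection p → ‖Φ p‖ ≤ K)
    {e t : A} (he : IsStarProjection e) (ht : star t * t = 1) (het : e * t = 0) (x : A)
    (hx : e * x * e = x) : ‖Φ x‖ ≤ 32 * K * ‖x‖ := by
  obtain ⟨c, w, hc, hw, hcw, hce, -, -, -⟩ := 𝒮.exists_mover he ht het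
  have hK : 0 ≤ K := (norm_nonneg _).trans (hΦ 0 (.zero _))
  have hce' : e * star (c * 𝒮.S 0) = e := by
    have := congrArg star hce
    rwa [star_mul, he.isSelfAdjoint.star_eq] at this
  have h1 : c * 𝒮.S 0 * x * star (c * 𝒮.S 0) = x := by
    calc _ = (c * 𝒮.S 0 * e) * x * (e * star (c * 𝒮.S 0)) := by
          conv_lhs => rw [← hx]
          noncomm_ring
      _ = x := by rw [hce, hce', hx]
  have hcs : star (c * 𝒮.shift) * (c * 𝒮.shift) = 1 := by
    calc _ = star 𝒮.shift * (star c * c) * 𝒮.shift := by rw [star_mul]; noncomm_ring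
      _ = 1 := by rw [hc, mul_one, 𝒮.shift_star_mul_self]
  have hcsw : star (c * 𝒮.shift) * w = 0 := by rw [star_mul, mul_assoc, hcw, mul_zero]
  have h0 : Φ x = _ := congrArg Φ (h1.symm.trans (𝒮.conj_S_eq c w x))
  rw [h0, map_sub]
  have h2 := norm_sub_le_of_le (norm_conj_sub_conj_le hΦ hc hw hcw (𝒮.σ x))
    (norm_conj_sub_conj_le hΦ hcs hw hcsw (𝒮.σ x))
  have h3 : ‖𝒮.σ x‖ ≤ ‖x‖ := NonUnitalStarAlgHom.norm_apply_le 𝒮.σ x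
  have : K * ‖𝒮.σ x‖ ≤ K * ‖x‖ := by gcongr
  linarith

end Amplification

theorem sum_blocks {A ι : Type*} [Ring A] [Fintype ι] (y : ι → A) (hy : ∑ i, y i = 1) (x : A) :
    x = ∑ i, ∑ j, y i * x * y j := by
  simp only [← Finset.mul_sum, ← Finset.sum_mul, hy, one_mul, mul_one]

namespace Amplification

variable {A : Type*} [CStarAlgebra A]

/-- The ranges of three isometries together with the remaining projection. -/
def block (𝒮 : Amplification A) : Fin 4 → A :=
  ![𝒮.S 0 * star (𝒮.S 0), 𝒮.S 1 * star (𝒮.S 1), 𝒮.S 2 * star (𝒮.S 2),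
    1 - (𝒮.S 0 * star (𝒮.S 0) + 𝒮.S 1 * star (𝒮.S 1) + 𝒮.S 2 * star (𝒮.S 2))]

theorem sum_block (𝒮 : Amplification A) : ∑ i, 𝒮.block i = 1 := by
  rw [Fin.sum_univ_four]
  simp [block]

theorem range_mul_S (𝒮 : Amplification A) {n m : ℕ} (h : n ≠ m) :
    𝒮.S n * star (𝒮.S n) * 𝒮.S m = 0 := by
  rw [mul_assoc, 𝒮.star_mul_of_ne _ _ h, mul_zero]

theorem range_mul_S_self (𝒮 : Amplification A) (n : ℕ) :
    𝒮.S n * star (𝒮.S n) * 𝒮.S n = 𝒮.S n := by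
  rw [mul_assoc, 𝒮.star_mul_self, mul_one]

theorem isStarProjection_block (𝒮 : Amplification A) (i : Fin 4) :
    IsStarProjection (𝒮.block i) := by
  have h := fun n => isStarProjection_isometry (𝒮.star_mul_self n)
  fin_cases i
  · exact h 0
  · exact h 1
  · exact h 2
  · refine (((h 0).add (h 1) ?_).add (h 2) ?_).one_sub
    · rw [← mul_assoc, 𝒮.range_mul_S (by norm_num), zero_mul]
    · rw [add_mul, ← mul_assoc, ← mul_assoc, 𝒮.range_mul_S (by norm_num),
        𝒮.range_mul_S (by norm_num), zero_mul, add_zero]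

/-- Any two blocks avoid the range of one of the isometries `S 0`, `S 1`, `S 2`. -/
theorem exists_avoid (𝒮 : Amplification A) (i j : Fin 4) :
    ∃ k : Fin 3, 𝒮.block i * 𝒮.S k = 0 ∧ 𝒮.block j * 𝒮.S k = 0 := by
  have h : ∀ (i : Fin 4) (k : Fin 3), (i : ℕ) ≠ k → 𝒮.block i * 𝒮.S k = 0 := by
    intro i k hik
    fin_cases i
    · exact 𝒮.range_mul_S hik
    · exact 𝒮.range_mul_S hik
    · exact 𝒮.range_mul_S hik
    · fin_cases k
      all_goals
        simp only [block, Matrix.cons_val, sub_mul, add_mul, one_mul, Fin.reduceFinMk]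
        simp [𝒮.range_mul_S, 𝒮.range_mul_S_self]
  obtain ⟨k, hik, hjk⟩ : ∃ k : Fin 3, (i : ℕ) ≠ k ∧ (j : ℕ) ≠ k := by
    revert i j; decide
  exact ⟨k, h i k hik, h j k hjk⟩

/-- The complement of the range of `S k`. -/
def compl (𝒮 : Amplification A) (k : ℕ) : A := 1 - 𝒮.S k * star (𝒮.S k)

theorem isStarProjection_compl (𝒮 : Amplification A) (k : ℕ) : IsStarProjection (𝒮.compl k) :=
  (isStarProjection_isometry (𝒮.star_mul_self k)).one_sub

theorem compl_mul_S (𝒮 : Amplification A) (k : ℕ) : 𝒮.compl k * 𝒮.S k = 0 := by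
  rw [compl, sub_mul, one_mul, 𝒮.range_mul_S_self, sub_self]

theorem compl_mul_mul_compl (𝒮 : Amplification A) {p q : A} {k : ℕ}
    (hpk : p * 𝒮.S k = 0) (hqk : q * 𝒮.S k = 0) (hp : IsStarProjection p) (x : A) :
    𝒮.compl k * (p * x * q) * 𝒮.compl k = p * x * q := by
  have h1 : 𝒮.compl k * p = p := by
    have := congrArg star hpk
    rw [star_mul, star_zero, hp.isSelfAdjoint.star_eq] at this
    rw [compl, sub_mul, one_mul, mul_assoc, this, mul_zero, sub_zero]
  have h2 : q * 𝒮.compl k = q := by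
    rw [compl, mul_sub, mul_one, ← mul_assoc, hqk, zero_mul, sub_zero]
  calc _ = 𝒮.compl k * p * x * (q * 𝒮.compl k) := by noncomm_ring
    _ = _ := by rw [h1, h2]

theorem norm_mul_mul_le {p q : A} (hp : IsStarProjection p) (hq : IsStarProjection q) (x : A) :
    ‖p * x * q‖ ≤ ‖x‖ := by
  refine (norm_mul_le _ _).trans ?_
  have h1 := norm_mul_le p x
  have h2 := hp.norm_le
  have h3 := hq.norm_le
  have h4 := mul_le_mul h1 h3 (norm_nonneg _) (by positivity)
  refine h4.trans ?_
  rw [mul_one]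
  exact mul_le_of_le_one_left (norm_nonneg _) h2

theorem hasProjBound (𝒮 : Amplification A) : HasProjBound A := by
  refine ⟨512, by norm_num, fun Φ K hΦ x => ?_⟩
  have hK : 0 ≤ K := (norm_nonneg _).trans (hΦ 0 (.zero _))
  conv_lhs => rw [sum_blocks 𝒮.block 𝒮.sum_block x]
  rw [map_sum]
  have h : ∀ i j, ‖Φ (𝒮.block i * x * 𝒮.block j)‖ ≤ 32 * K * ‖x‖ := by
    intro i j
    obtain ⟨k, hi, hj⟩ := 𝒮.exists_avoid i j
    refine (𝒮.norm_corner_le hΦ (𝒮.isStarProjection_compl k) (𝒮.star_mul_self k)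
      (𝒮.compl_mul_S k) _ (𝒮.compl_mul_mul_compl hi hj
      (𝒮.isStarProjection_block i) x)).trans ?_
    gcongr
    exact norm_mul_mul_le (𝒮.isStarProjection_block i) (𝒮.isStarProjection_block j) x
  have h2 : ∀ i ∈ Finset.univ, ‖Φ (∑ j, 𝒮.block i * x * 𝒮.block j)‖ ≤ 4 • (32 * K * ‖x‖) := by
    intro i _
    rw [map_sum]
    exact (norm_sum_le _ _).trans ((Finset.sum_le_card_nsmul _ _ _ fun j _ => h i j).trans
      (by simp))
  refine (norm_sum_le _ _).trans ((Finset.sum_le_card_nsmul _ _ _ h2).trans (le_of_eq ?_))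
  rw [Finset.card_univ, Fintype.card_fin, nsmul_eq_mul, nsmul_eq_mul]
  push_cast
  ring

end Amplification

section

variable {A : Type*} [CStarAlgebra A]

/-- A linear family whose values on unit vectors are isometries, orthogonal vectors having
orthogonal ranges. -/
def IsIsometricFamily {V : Type*} [NormedAddCommGroup V] [InnerProductSpace ℂ V]
    (T : V →ₗ[ℂ] A) : Prop :=
  ∀ x y, star (T x) * T y = inner ℂ x y • (1 : A)

/-- The value of a charge on the range projection of an isometry. -/
def rangeCharge (μ : A → ℂ) (w : A) : ℂ := μ (w * star w)

/-- The off-diagonal part of `rangeCharge`, recovered by polarization. -/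
noncomputable def crossCharge (μ : A → ℂ) (v w : A) : ℂ :=
  rangeCharge μ (invSqrtTwo • (v + w)) -
    Complex.I * rangeCharge μ (invSqrtTwo • (v + Complex.I • w)) -
    (1 - Complex.I) / 2 * (rangeCharge μ v + rangeCharge μ w)

theorem mem_unitary_mul_star {u : A} (hu : u ∈ unitary A) (w : A) :
    w * u * star (w * u) = w * star w := by
  rw [star_mul]
  calc w * u * (star u * star w) = w * (u * star u) * star w := by noncomm_ring
    _ = _ := by rw [Unitary.mul_star_self_of_mem hu, mul_one]

theorem rangeCharge_mul_unitary (μ : A → ℂ) {u : A} (hu : u ∈ unitary A) (w : A) :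
    rangeCharge μ (w * u) = rangeCharge μ w := by
  rw [rangeCharge, rangeCharge, mem_unitary_mul_star hu]

theorem crossCharge_mul_unitary (μ : A → ℂ) {u : A} (hu : u ∈ unitary A) (v w : A) :
    crossCharge μ (v * u) (w * u) = crossCharge μ v w := by
  simp only [crossCharge]
  rw [← add_mul, ← smul_mul_assoc, ← smul_mul_assoc, ← add_mul, ← smul_mul_assoc]
  simp only [rangeCharge_mul_unitary μ hu]

variable {V : Type*} [NormedAddCommGroup V] [InnerProductSpace ℂ V] {T : V →ₗ[ℂ] A}

theorem IsIsometricFamily.isMatrixUnits (hT : IsIsometricFamily T) :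
    IsMatrixUnits fun x y => T x * star (T y) where
  add_left x y z := by rw [map_add, add_mul]
  smul_left c x y := by rw [map_smul, smul_mul_assoc]
  star x y := by simp
  mul x y z t := by
    calc T x * star (T y) * (T z * star (T t)) = T x * (star (T y) * T z) * star (T t) := by
          noncomm_ring
      _ = _ := by rw [hT, mul_smul_comm, mul_one, smul_mul_assoc]

theorem norm_invSqrtTwo : ‖invSqrtTwo‖ ^ 2 = 1 / 2 := by
  rw [invSqrtTwo, Complex.norm_real, norm_inv, Real.norm_of_nonneg (Real.sqrt_nonneg _), inv_pow,
    Real.sq_sqrt zero_le_two, one_div]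

theorem norm_combo {x y : V} (hx : ‖x‖ = 1) (hy : ‖y‖ = 1) (hxy : inner ℂ x y = 0) :
    ‖invSqrtTwo • (x + y)‖ = 1 := by
  have : ‖invSqrtTwo • (x + y)‖ ^ 2 = 1 := by
    rw [norm_smul, mul_pow, norm_invSqrtTwo, norm_add_sq (𝕜 := ℂ), hxy, hx, hy]
    norm_num
  exact (pow_eq_one_iff_of_nonneg (norm_nonneg _) two_ne_zero).1 this

theorem IsIsometricFamily.exists_sesq (hT : IsIsometricFamily T) {μ : A → ℂ} {K : ℝ}
    (hμ : IsProjCharge μ K)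
    (hV : ∀ x y : V, ∃ z, ‖z‖ = 1 ∧ inner ℂ x z = 0 ∧ inner ℂ y z = 0) :
    ∃ S : V →ₗ⋆[ℂ] V →ₗ[ℂ] ℂ, (∀ x, ‖x‖ = 1 → rangeCharge μ (T x) = S x x) ∧
      ∀ x y, ‖x‖ = 1 → ‖y‖ = 1 → inner ℂ x y = 0 → crossCharge μ (T x) (T y) = S x y := by
  obtain ⟨S, hS⟩ := hT.isMatrixUnits.exists_sesq hμ hV
  refine ⟨S, fun x hx => (hS x hx).symm, fun x y hx hy hxy => ?_⟩
  have h1 : ∀ x, ‖x‖ = 1 → rangeCharge μ (T x) = S x x := fun x hx => (hS x hx).symm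
  rw [crossCharge, ← map_smul, ← map_add, ← map_add, ← map_smul, ← map_smul, h1 x hx, h1 y hy,
    h1 _ (norm_combo hx hy hxy), h1 _ (norm_combo hx (by rw [norm_smul, hy]; simp) (by
      rw [inner_smul_right, hxy, mul_zero]))]
  simp only [map_add, map_smul, LinearMap.map_smulₛₗ, LinearMap.add_apply, LinearMap.smul_apply,
    smul_eq_mul]
  have e1 : (starRingEnd ℂ) invSqrtTwo = invSqrtTwo := star_invSqrtTwo
  rw [e1, Complex.conj_I]
  have e2 := invSqrtTwo_mul_self
  linear_combination (S x x + S y y + S x y + S y x -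
    Complex.I * (S x x + S y y + Complex.I * S x y - Complex.I * S y x)) * e2 +
    (1 / 2 * (S y x - S x y) + invSqrtTwo ^ 2 * Complex.I * S y y) * Complex.I_sq

end

section

variable {A : Type*} [CStarAlgebra A]
variable {V : Type*} [NormedAddCommGroup V] [InnerProductSpace ℂ V] {T : V →ₗ[ℂ] A}

/-- Adjoining an isometry to an isometric family. -/
noncomputable def consFamily (v : A) (T : V →ₗ[ℂ] A) : WithLp 2 (ℂ × V) →ₗ[ℂ] A where
  toFun x := x.fst • v + T x.snd
  map_add' x y := by simp only [WithLp.add_fst, WithLp.add_snd, add_smul, map_add]; abel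
  map_smul' c x := by
    simp only [WithLp.smul_fst, WithLp.smul_snd, map_smul, smul_add, smul_smul, smul_eq_mul,
      RingHom.id_apply]

theorem consFamily_apply (v : A) (T : V →ₗ[ℂ] A) (a : ℂ) (x : V) :
    consFamily v T (WithLp.toLp 2 (a, x)) = a • v + T x := rfl

theorem IsIsometricFamily.cons (hT : IsIsometricFamily T) {v : A} (hv : star v * v = 1)
    (hvT : ∀ x, star v * T x = 0) : IsIsometricFamily (consFamily v T) := by
  intro x y
  have h : ∀ x, star (T x) * v = 0 := fun x => star_mul_eq_zero_comm (hvT x)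
  change star (x.fst • v + T x.snd) * (y.fst • v + T y.snd) = _
  rw [star_add, star_smul, add_mul, mul_add, mul_add, smul_mul_smul_comm, hv, hT,
    smul_mul_assoc, hvT, mul_smul_comm, h, smul_zero, smul_zero, add_zero, zero_add, ← add_smul,
    WithLp.prod_inner_apply]
  congr 2
  rw [RCLike.inner_apply, mul_comm]; rfl

theorem IsIsometricFamily.exists_linear [FiniteDimensional ℂ V] (hT : IsIsometricFamily T)
    {μ : A → ℂ} {K : ℝ} (hμ : IsProjCharge μ K) {v t : A} (hv : star v * v = 1)
    (ht : star t * t = 1) (hvt : star v * t = 0) (hvT : ∀ x, star v * T x = 0)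
    (htT : ∀ x, star t * T x = 0) :
    ∃ ℓ : V →ₗ[ℂ] ℂ, ∀ x, ‖x‖ = 1 → crossCharge μ v (T x) = ℓ x := by
  rcases Nat.eq_zero_or_pos (Module.finrank ℂ V) with h0 | h0
  · refine ⟨0, fun x hx => ?_⟩
    have := Module.finrank_zero_iff.1 h0
    rw [Subsingleton.elim x 0, norm_zero] at hx
    exact absurd hx zero_ne_one
  have h1 := hT.cons ht htT
  have h2 : IsIsometricFamily (consFamily v (consFamily t T)) := by
    refine h1.cons hv fun x => ?_
    change star v * (x.fst • t + T x.snd) = 0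
    rw [mul_add, mul_smul_comm, hvt, hvT, smul_zero, add_zero]
  have hd : 2 < Module.finrank ℂ (WithLp 2 (ℂ × WithLp 2 (ℂ × V))) := by
    rw [(WithLp.linearEquiv 2 ℂ _).finrank_eq, Module.finrank_prod,
      (WithLp.linearEquiv 2 ℂ _).finrank_eq, Module.finrank_prod, Module.finrank_self]
    omega
  obtain ⟨S, -, hS⟩ := h2.exists_sesq hμ (exists_orthogonal_unit hd)
  let j : V →ₗ[ℂ] WithLp 2 (ℂ × WithLp 2 (ℂ × V)) :=
    (WithLp.linearEquiv 2 ℂ (ℂ × WithLp 2 (ℂ × V))).symm.toLinearMap ∘ₗ LinearMap.inr ℂ _ _ ∘ₗ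
      (WithLp.linearEquiv 2 ℂ (ℂ × V)).symm.toLinearMap ∘ₗ LinearMap.inr ℂ _ _
  have hj : ∀ x, j x = WithLp.toLp 2 (0, WithLp.toLp 2 (0, x)) := fun x => rfl
  refine ⟨S (WithLp.toLp 2 (1, 0)) ∘ₗ j, fun x hx => ?_⟩
  rw [LinearMap.comp_apply, ← hS]
  · rw [hj, consFamily_apply, consFamily_apply]
    simp [consFamily_apply]
  · rw [WithLp.prod_norm_eq_of_L2]; simp
  · rw [hj, WithLp.prod_norm_eq_of_L2]
    simp [hx]
  · rw [hj, WithLp.prod_inner_apply]; simp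

variable {μ : A → ℂ} {K : ℝ} {v t : A}

theorem IsIsometricFamily.mul_unitary (hT : IsIsometricFamily T) {u : A} (hu : u ∈ unitary A) :
    IsIsometricFamily (LinearMap.mulRight ℂ u ∘ₗ T) := by
  intro x y
  simp only [LinearMap.comp_apply, LinearMap.mulRight_apply, star_mul]
  calc star u * star (T x) * (T y * u) = star u * (star (T x) * T y) * u := by noncomm_ring
    _ = _ := by
      rw [hT, mul_smul_comm, mul_one, smul_mul_assoc, Unitary.star_mul_self_of_mem hu]

variable {ι : Type*} [Fintype ι]

/-- The isometric family obtained by twisting each vector of an orthonormal system. -/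
noncomputable def twistFamily (T : V →ₗ[ℂ] A) (f : ι → V) (u : ι → A) :
    EuclideanSpace ℂ ι →ₗ[ℂ] A where
  toFun x := ∑ i, x i • (T (f i) * u i)
  map_add' x y := by simp [add_smul, Finset.sum_add_distrib]
  map_smul' c x := by simp [Finset.smul_sum, smul_smul]

theorem twistFamily_apply (T : V →ₗ[ℂ] A) (f : ι → V) (u : ι → A) (x : EuclideanSpace ℂ ι) :
    twistFamily T f u x = ∑ i, x i • (T (f i) * u i) := rfl

variable [DecidableEq ι]

theorem twistFamily_single (T : V →ₗ[ℂ] A) (f : ι → V) (u : ι → A) (i : ι) :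
    twistFamily T f u (EuclideanSpace.single i 1) = T (f i) * u i := by
  rw [twistFamily_apply, Finset.sum_eq_single i]
  · simp
  · intro j _ hj; simp [hj]
  · simp

theorem IsIsometricFamily.twist (hT : IsIsometricFamily T) {f : ι → V} (hf : Orthonormal ℂ f)
    {u : ι → A} (hu : ∀ i, u i ∈ unitary A) : IsIsometricFamily (twistFamily T f u) := by
  intro x y
  have h : ∀ i j, star (T (f i) * u i) * (T (f j) * u j) = if i = j then 1 else 0 := by
    intro i j
    calc star (T (f i) * u i) * (T (f j) * u j) = star (u i) * (star (T (f i)) * T (f j)) * u j := by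
          rw [star_mul]; noncomm_ring
      _ = _ := by
        rw [hT, orthonormal_iff_ite.1 hf]
        split_ifs with hij
        · subst hij; rw [one_smul, mul_one, Unitary.star_mul_self_of_mem (hu i)]
        · simp
  rw [twistFamily_apply, twistFamily_apply, star_sum, Finset.sum_mul, PiLp.inner_apply,
    Finset.sum_smul]
  refine Finset.sum_congr rfl fun i _ => ?_
  rw [Finset.mul_sum, Finset.sum_eq_single i]
  · rw [star_smul, smul_mul_smul_comm, h, if_pos rfl, RCLike.inner_apply, mul_comm]; rfl
  · intro j _ hj
    rw [star_smul, smul_mul_smul_comm, h, if_neg (Ne.symm hj), smul_zero]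
  · simp

theorem crossCharge_twist [FiniteDimensional ℂ V] (hT : IsIsometricFamily T)
    (hμ : IsProjCharge μ K) (hv : star v * v = 1)
    (ht : star t * t = 1) (hvt : star v * t = 0) (hvT : ∀ x, star v * T x = 0)
    (htT : ∀ x, star t * T x = 0) {f : ι → V} (hf : Orthonormal ℂ f) {u : ι → A}
    (hu : ∀ i, u i ∈ unitary A) {x : EuclideanSpace ℂ ι} (hx : ‖x‖ = 1) :
    crossCharge μ v (twistFamily T f u x) = ∑ i, x i * crossCharge μ v (T (f i) * u i) := by
  have h0 : ∀ {s : A}, (∀ x, star s * T x = 0) → ∀ x, star s * twistFamily T f u x = 0 := by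
    intro s hs x
    rw [twistFamily_apply, Finset.mul_sum]
    refine Finset.sum_eq_zero fun i _ => ?_
    rw [mul_smul_comm, ← mul_assoc, hs, zero_mul, smul_zero]
  obtain ⟨ℓ, hℓ⟩ := (hT.twist hf hu).exists_linear hμ hv ht hvt (h0 hvT) (h0 htT)
  have e : x = ∑ i, x i • EuclideanSpace.single i (1 : ℂ) := by
    have := (EuclideanSpace.basisFun ι ℂ).sum_repr x
    simpa using this.symm
  rw [hℓ x hx]
  conv_lhs => rw [e]
  rw [map_sum]
  refine Finset.sum_congr rfl fun i _ => ?_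
  rw [map_smul, smul_eq_mul, ← hℓ _ (by simp), twistFamily_single]

theorem sum_crossCharge_eq_zero {T : EuclideanSpace ℂ ι →ₗ[ℂ] A} (hT : IsIsometricFamily T)
    (hμ : IsProjCharge μ K) (hv : star v * v = 1)
    (ht : star t * t = 1) (hvt : star v * t = 0) (hvT : ∀ x, star v * T x = 0)
    (htT : ∀ x, star t * T x = 0) {κ : EuclideanSpace ℂ ι} (hκ : ‖κ‖ = 1) {k : ι → ℝ}
    (hk : ∀ i, κ i = k i) {u : ι → A} (hu : ∀ i, u i ∈ unitary A)
    (h : ∑ i, ((k i : ℂ) ^ 2) • u i = 0) :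
    ∑ i, (k i : ℂ) ^ 2 * crossCharge μ v (T κ * u i) = 0 := by
  have hℓ : ∀ i, ∃ ℓ : EuclideanSpace ℂ ι →ₗ[ℂ] ℂ,
      ∀ x, ‖x‖ = 1 → crossCharge μ v (T x * u i) = ℓ x := by
    intro i
    refine (hT.mul_unitary (hu i)).exists_linear hμ hv ht hvt (fun x => ?_) (fun x => ?_)
    · simp only [LinearMap.comp_apply, LinearMap.mulRight_apply]
      rw [← mul_assoc, hvT, zero_mul]
    · simp only [LinearMap.comp_apply, LinearMap.mulRight_apply]
      rw [← mul_assoc, htT, zero_mul]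
  choose ℓ hℓ using hℓ
  have hf1 : Orthonormal ℂ fun i : ι => EuclideanSpace.single i (1 : ℂ) :=
    EuclideanSpace.orthonormal_single
  have hκκ : inner ℂ κ κ = (1 : ℂ) := by
    rw [inner_self_eq_norm_sq_to_K, hκ]; simp
  have hf2 : Orthonormal ℂ fun i : ι =>
      EuclideanSpace.single i (1 : ℂ) - (2 * (k i : ℂ)) • κ := by
    rw [orthonormal_iff_ite] at hf1 ⊢
    intro i j
    have h1 := hf1 i j
    rw [inner_sub_left, inner_sub_right, inner_sub_right, h1, inner_smul_left, inner_smul_right,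
      inner_smul_right, inner_smul_left, hκκ]
    simp only [EuclideanSpace.inner_single_left, EuclideanSpace.inner_single_right, hk, map_mul,
      Complex.conj_ofReal, map_one, map_ofNat]
    ring
  have e : twistFamily T (fun i : ι => EuclideanSpace.single i (1 : ℂ) - (2 * (k i : ℂ)) • κ) u κ =
      twistFamily T (fun i : ι => EuclideanSpace.single i (1 : ℂ)) u κ := by
    rw [twistFamily_apply, twistFamily_apply]
    simp only [hk, map_sub, map_smul, sub_mul, smul_sub, Finset.sum_sub_distrib, sub_eq_self]
    have : ∀ i, (k i : ℂ) • (((2 * (k i : ℂ)) • T κ) * u i) =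
        (2 : ℂ) • (T κ * ((k i : ℂ) ^ 2 • u i)) := by
      intro i
      rw [smul_mul_assoc, mul_smul_comm, smul_smul, smul_smul]
      congr 1; ring
    simp only [this]
    rw [← Finset.smul_sum, ← Finset.mul_sum, h, mul_zero, smul_zero]
  have h1 := crossCharge_twist hT hμ hv ht hvt hvT htT hf1 hu hκ
  have h2 := crossCharge_twist hT hμ hv ht hvt hvT htT hf2 hu hκ
  rw [e, h1] at h2
  have e1 : ∀ i, κ i * crossCharge μ v (T (EuclideanSpace.single i (1 : ℂ)) * u i) =
      k i * ℓ i (EuclideanSpace.single i (1 : ℂ)) := fun i => by rw [hℓ i _ (hf1.1 i), hk]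
  have e2 : ∀ i, κ i * crossCharge μ v
        (T (EuclideanSpace.single i (1 : ℂ) - (2 * (k i : ℂ)) • κ) * u i) =
      k i * ℓ i (EuclideanSpace.single i (1 : ℂ)) - k i * (2 * (k i : ℂ)) • ℓ i κ := fun i => by
    rw [hℓ i _ (hf2.1 i), hk, map_sub, map_smul, mul_sub]
  rw [Finset.sum_congr rfl fun i _ => e1 i, Finset.sum_congr rfl fun i _ => e2 i,
    Finset.sum_sub_distrib] at h2
  have h3 : ∑ i, (k i : ℂ) * (2 * (k i : ℂ)) • ℓ i κ = 0 := by linear_combination h2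
  have h4 : ∑ i, (k i : ℂ) * (2 * (k i : ℂ)) • ℓ i κ = 2 * ∑ i, (k i : ℂ) ^ 2 * ℓ i κ := by
    rw [Finset.mul_sum]
    exact Finset.sum_congr rfl fun i _ => by rw [smul_eq_mul]; ring
  simp only [hℓ _ κ hκ]
  rw [h4] at h3
  simpa using h3

end

section

variable {A : Type*} [CStarAlgebra A] {μ : A → ℂ} {K : ℝ} {v w t : A}

theorem mul_mem_isometry {w u : A} (hw : star w * w = 1) (hu : star u * u = 1) :
    star (w * u) * (w * u) = 1 := by
  calc star (w * u) * (w * u) = star u * (star w * w) * u := by rw [star_mul]; noncomm_ring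
    _ = 1 := by rw [hw, mul_one, hu]

theorem crossCharge_smul (hμ : IsProjCharge μ K) (hv : star v * v = 1) (hw : star w * w = 1)
    (ht : star t * t = 1) (hvw : star v * w = 0) (hvt : star v * t = 0) (hwt : star w * t = 0)
    {z : ℂ} (hz : ‖z‖ = 1) : crossCharge μ v (z • w) = z * crossCharge μ v w := by
  have hT : IsIsometricFamily (LinearMap.toSpanSingleton ℂ A w) := by
    intro x y
    rw [LinearMap.toSpanSingleton_apply, LinearMap.toSpanSingleton_apply, star_smul,
      smul_mul_smul_comm, hw, RCLike.inner_apply, mul_comm]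
    rfl
  obtain ⟨ℓ, hℓ⟩ := hT.exists_linear hμ hv ht hvt
    (fun x => by rw [LinearMap.toSpanSingleton_apply, mul_smul_comm, hvw, smul_zero])
    (fun x => by
      rw [LinearMap.toSpanSingleton_apply, mul_smul_comm, star_mul_eq_zero_comm hwt, smul_zero])
  have h1 := hℓ z hz
  have h2 := hℓ 1 norm_one
  rw [LinearMap.toSpanSingleton_apply] at h1 h2
  rw [one_smul] at h2
  rw [h1, h2, ← smul_eq_mul, ← map_smul, smul_eq_mul, mul_one]

/-- The isometric family spanned by isometries with orthogonal ranges, with respect to an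
orthonormal basis. -/
theorem exists_isometricFamily {ι : Type*} [Fintype ι] [DecidableEq ι] {V : Type*}
    [NormedAddCommGroup V]
    [InnerProductSpace ℂ V] (b : OrthonormalBasis ι ℂ V) {τ : ι → A}
    (hτ : ∀ i j, star (τ i) * τ j = if i = j then 1 else 0) :
    ∃ T : V →ₗ[ℂ] A, IsIsometricFamily T ∧ (∀ i, T (b i) = τ i) ∧
      ∀ v : A, (∀ i, star v * τ i = 0) → ∀ x, star v * T x = 0 := by
  have e : ∀ x, b.toBasis.constr ℂ τ x = ∑ i, b.repr x i • τ i := fun x => by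
    rw [Module.Basis.constr_apply_fintype]; simp
  refine ⟨b.toBasis.constr ℂ τ, fun x y => ?_, fun i => ?_, fun v hv x => ?_⟩
  · rw [e, e, star_sum, Finset.sum_mul, ← b.repr.inner_map_map, PiLp.inner_apply, Finset.sum_smul]
    refine Finset.sum_congr rfl fun i _ => ?_
    rw [Finset.mul_sum, Finset.sum_eq_single i]
    · rw [star_smul, smul_mul_smul_comm, hτ, if_pos rfl, RCLike.inner_apply, mul_comm]; rfl
    · intro j _ hj
      rw [star_smul, smul_mul_smul_comm, hτ, if_neg (Ne.symm hj), smul_zero]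
    · simp
  · rw [← OrthonormalBasis.coe_toBasis, Module.Basis.constr_basis]
  · rw [e, Finset.mul_sum]
    exact Finset.sum_eq_zero fun i _ => by rw [mul_smul_comm, hv, smul_zero]

theorem sum_mul_crossCharge_eq_zero_of_nonneg (𝒮 : Amplification A) (hμ : IsProjCharge μ K)
    (hv : star v * v = 1) (hw : star w * w = 1)
    (ht : star t * t = 1) (hvw : star v * w = 0) (hvt : star v * t = 0) (hwt : star w * t = 0)
    {ι : Type*} [Fintype ι] {r : ι → ℝ} (hr : ∀ i, 0 ≤ r i) {u : ι → A}
    (hu : ∀ i, u i ∈ unitary A) (h : ∑ i, (r i : ℂ) • u i = 0) :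
    ∑ i, (r i : ℂ) * crossCharge μ v (w * u i) = 0 := by
  classical
  rcases (Finset.sum_nonneg fun i _ => hr i : 0 ≤ ∑ i, r i).eq_or_lt with hR | hR
  · have := (Finset.sum_eq_zero_iff_of_nonneg fun i _ => hr i).1 hR.symm
    refine Finset.sum_eq_zero fun i hi => ?_
    rw [this i hi, Complex.ofReal_zero, zero_mul]
  set R := ∑ i, r i with hRd
  have hne : Nonempty ι := by
    by_contra hne
    rw [not_nonempty_iff] at hne
    simp [hRd] at hR
  obtain ⟨i₀⟩ := hne
  let k : ι → ℝ := fun i => √(r i / R)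
  have hk : ∀ i, k i ^ 2 = r i / R := fun i => Real.sq_sqrt (div_nonneg (hr i) hR.le)
  let κ : EuclideanSpace ℂ ι := WithLp.toLp 2 fun i => (k i : ℂ)
  have hκi : ∀ i, κ i = k i := fun i => rfl
  have hκ : ‖κ‖ = 1 := by
    rw [EuclideanSpace.norm_eq]
    simp only [hκi, Complex.norm_real, Real.norm_eq_abs, sq_abs, hk]
    rw [← Finset.sum_div, ← hRd, div_self hR.ne', Real.sqrt_one]
  obtain ⟨b, hb⟩ := Orthonormal.exists_orthonormalBasis_extension_of_card_eq
    (𝕜 := ℂ) (E := EuclideanSpace ℂ ι) (ι := ι) (by simp) (v := fun _ => κ) (s := {i₀}) (by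
      rw [orthonormal_iff_ite]
      intro i j
      rw [if_pos (Subsingleton.elim i j)]
      simp [inner_self_eq_norm_sq_to_K, hκ])
  let n : ι → ℕ := fun i => Fintype.equivFin ι i
  have hn : Function.Injective n :=
    fun i j hij => (Fintype.equivFin ι).injective (Fin.ext hij)
  let τ : ι → A := fun i => if i = i₀ then w else t * 𝒮.S (n i + 1)
  have hτ : ∀ i j, star (τ i) * τ j = if i = j then 1 else 0 := by
    intro i j
    by_cases hi : i = i₀ <;> by_cases hj : j = i₀
    · simp [τ, hi, hj, hw]
    · have : i ≠ j := fun e => hj (e ▸ hi)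
      simp only [τ, if_pos hi, if_neg hj, if_neg this]
      rw [← mul_assoc, hwt, zero_mul]
    · have : i ≠ j := fun e => hi (e ▸ hj)
      simp only [τ, if_pos hj, if_neg hi, if_neg this]
      rw [star_mul, mul_assoc, star_mul_eq_zero_comm hwt, mul_zero]
    · simp only [τ, if_neg hj, if_neg hi]
      split_ifs with hij
      · subst hij; exact mul_mem_isometry ht (𝒮.star_mul_self _)
      · calc star (t * 𝒮.S (n i + 1)) * (t * 𝒮.S (n j + 1))
              = star (𝒮.S (n i + 1)) * (star t * t) * 𝒮.S (n j + 1) := by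
                rw [star_mul]; noncomm_ring
          _ = 0 := by
            rw [ht, mul_one, 𝒮.star_mul_of_ne]
            exact fun e => hij (hn (Nat.succ_injective e))
  obtain ⟨T, hT, hTb, hT0⟩ := exists_isometricFamily b hτ
  have hTκ : T κ = w := by
    rw [← hb i₀ rfl, hTb]; exact if_pos rfl
  have hvτ : ∀ i, star v * τ i = 0 := by
    intro i
    by_cases hi : i = i₀
    · simp only [τ, if_pos hi, hvw]
    · simp only [τ, if_neg hi]; rw [← mul_assoc, hvt, zero_mul]
  have htτ : ∀ i, star (t * 𝒮.S 0) * τ i = 0 := by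
    intro i
    by_cases hi : i = i₀
    · simp only [τ, if_pos hi]
      rw [star_mul, mul_assoc, star_mul_eq_zero_comm hwt, mul_zero]
    · simp only [τ, if_neg hi]
      calc star (t * 𝒮.S 0) * (t * 𝒮.S (n i + 1))
              = star (𝒮.S 0) * (star t * t) * 𝒮.S (n i + 1) := by
                rw [star_mul]; noncomm_ring
          _ = 0 := by
            rw [ht, mul_one, 𝒮.star_mul_of_ne]; omega
  have hfin := sum_crossCharge_eq_zero hT hμ hv (mul_mem_isometry ht (𝒮.star_mul_self 0))
    (by rw [← mul_assoc, hvt, zero_mul]) (hT0 v hvτ) (hT0 _ htτ) hκ hκi hu (by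
      have : ∀ i, (k i : ℂ) ^ 2 • u i = (R : ℂ)⁻¹ • ((r i : ℂ) • u i) := fun i => by
        rw [smul_smul, ← Complex.ofReal_pow, hk, Complex.ofReal_div, div_eq_inv_mul]
      rw [Finset.sum_congr rfl fun i _ => this i, ← Finset.smul_sum, h, smul_zero])
  rw [hTκ] at hfin
  have : ∀ i, (k i : ℂ) ^ 2 * crossCharge μ v (w * u i) =
      (R : ℂ)⁻¹ * ((r i : ℂ) * crossCharge μ v (w * u i)) := fun i => by
    rw [← Complex.ofReal_pow, hk, Complex.ofReal_div]; ring
  rw [Finset.sum_congr rfl fun i _ => this i, ← Finset.mul_sum] at hfin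
  exact (mul_eq_zero.1 hfin).resolve_left (inv_ne_zero (by exact_mod_cast hR.ne'))

theorem sum_mul_crossCharge_eq_zero (𝒮 : Amplification A) (hμ : IsProjCharge μ K)
    (hv : star v * v = 1) (hw : star w * w = 1)
    (ht : star t * t = 1) (hvw : star v * w = 0) (hvt : star v * t = 0) (hwt : star w * t = 0)
    {ι : Type*} [Fintype ι] {c : ι → ℂ} {u : ι → A}
    (hu : ∀ i, u i ∈ unitary A) (h : ∑ i, c i • u i = 0) :
    ∑ i, c i * crossCharge μ v (w * u i) = 0 := by
  have hz : ∀ i, ∃ z : ℂ, ‖z‖ = 1 ∧ c i = ‖c i‖ * z := by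
    intro i
    rcases eq_or_ne (c i) 0 with h0 | h0
    · exact ⟨1, norm_one, by simp [h0]⟩
    · have h1 : (‖c i‖ : ℂ) ≠ 0 := by exact_mod_cast norm_ne_zero_iff.2 h0
      refine ⟨c i / ‖c i‖, ?_, by field_simp⟩
      rw [norm_div, Complex.norm_real, norm_norm, div_self (norm_ne_zero_iff.2 h0)]
  choose z hz hcz using hz
  have hu' : ∀ i, z i • u i ∈ unitary A := by
    intro i
    have : star (z i) * z i = 1 := by
      rw [Complex.star_def, ← Complex.normSq_eq_conj_mul_self, Complex.normSq_eq_norm_sq, hz]; simp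
    rw [Unitary.mem_iff, star_smul, smul_mul_smul_comm, smul_mul_smul_comm, mul_comm (z i), this,
      Unitary.star_mul_self_of_mem (hu i), Unitary.mul_star_self_of_mem (hu i), one_smul]
    exact ⟨rfl, rfl⟩
  have h1 := sum_mul_crossCharge_eq_zero_of_nonneg 𝒮 hμ hv hw ht hvw hvt hwt
    (r := fun i => ‖c i‖) (fun i => norm_nonneg _) hu' (by
      rw [← h]
      exact Finset.sum_congr rfl fun i _ => by rw [smul_smul, ← hcz])
  rw [← h1]
  refine Finset.sum_congr rfl fun i _ => ?_
  rw [mul_smul_comm, crossCharge_smul hμ hv (mul_mem_isometry hw (Unitary.star_mul_self_of_mem (hu i)))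
    ht (by rw [← mul_assoc, hvw, zero_mul]) hvt (by rw [star_mul, mul_assoc, hwt, mul_zero]) (hz i),
    ← mul_assoc, ← hcz]

theorem exists_linear_crossCharge (𝒮 : Amplification A) (hμ : IsProjCharge μ K)
    (hv : star v * v = 1) (hw : star w * w = 1)
    (ht : star t * t = 1) (hvw : star v * w = 0) (hvt : star v * t = 0) (hwt : star w * t = 0) :
    ∃ L : A →ₗ[ℂ] ℂ, ∀ u ∈ unitary A, L u = crossCharge μ v (w * u) := by
  let φ : (unitary A →₀ ℂ) →ₗ[ℂ] A := Finsupp.linearCombination ℂ Subtype.val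
  let ψ : (unitary A →₀ ℂ) →ₗ[ℂ] ℂ :=
    Finsupp.linearCombination ℂ fun u : unitary A => crossCharge μ v (w * u)
  have hφ : Function.Surjective φ := by
    rw [← LinearMap.range_eq_top, Finsupp.range_linearCombination, Subtype.range_coe,
      CStarAlgebra.span_unitary]
  have hk : LinearMap.ker φ ≤ LinearMap.ker ψ := by
    intro f hf
    rw [LinearMap.mem_ker] at hf ⊢
    simp only [φ, ψ, Finsupp.linearCombination_apply, Finsupp.sum, smul_eq_mul] at hf ⊢
    rw [← Finset.sum_coe_sort] at hf ⊢
    exact sum_mul_crossCharge_eq_zero 𝒮 hμ hv hw ht hvw hvt hwt (fun i => i.1.2) hf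
  refine ⟨(LinearMap.ker φ).liftQ ψ hk ∘ₗ
    (φ.quotKerEquivOfSurjective hφ).symm.toLinearMap, fun u hu => ?_⟩
  have h1 : φ (Finsupp.single ⟨u, hu⟩ 1) = u := by simp [φ]
  have h2 : (φ.quotKerEquivOfSurjective hφ).symm u =
      (LinearMap.ker φ).mkQ (Finsupp.single ⟨u, hu⟩ 1) := by
    rw [LinearEquiv.symm_apply_eq, Submodule.mkQ_apply,
      LinearMap.quotKerEquivOfSurjective_apply_mk, h1]
  rw [LinearMap.comp_apply, LinearEquiv.coe_coe, h2, Submodule.mkQ_apply, Submodule.liftQ_apply]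
  simp [ψ]

end

section

variable {A : Type*} [CStarAlgebra A] {μ : A → ℂ} {K : ℝ} {v w t : A}

theorem rangeCharge_combo (hμ : IsProjCharge μ K) (hv : star v * v = 1) (hw : star w * w = 1)
    (ht : star t * t = 1) (hvw : star v * w = 0) (hvt : star v * t = 0) (hwt : star w * t = 0) :
    rangeCharge μ (invSqrtTwo • (v + w)) =
      1 / 2 * (rangeCharge μ v + rangeCharge μ w + crossCharge μ v w + crossCharge μ w v) := by
  have hτ : ∀ i j, star (![v, w, t] i) * ![v, w, t] j = if i = j then 1 else 0 := by
    intro i j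
    fin_cases i <;> fin_cases j <;>
      simp [hv, hw, ht, hvw, hvt, hwt, star_mul_eq_zero_comm hvw, star_mul_eq_zero_comm hvt,
        star_mul_eq_zero_comm hwt]
  obtain ⟨T, hT, hTb, -⟩ := exists_isometricFamily (EuclideanSpace.basisFun (Fin 3) ℂ) hτ
  obtain ⟨S, hS, hF⟩ := hT.exists_sesq hμ (exists_orthogonal_unit (by simp))
  have h0 := hTb 0
  have h1 := hTb 1
  simp only [Matrix.cons_val_zero, Matrix.cons_val_one] at h0 h1
  have o := (EuclideanSpace.basisFun (Fin 3) ℂ).orthonormal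
  set e := EuclideanSpace.basisFun (Fin 3) ℂ with he
  rw [← h0, ← h1, ← map_add, ← map_smul, hS _ (norm_combo (o.1 0) (o.1 1) (o.2 (by decide))),
    hS _ (o.1 0), hS _ (o.1 1), hF _ _ (o.1 0) (o.1 1) (o.2 (by decide)),
    hF _ _ (o.1 1) (o.1 0) (o.2 (by decide))]
  simp only [map_add, map_smul, LinearMap.map_smulₛₗ, LinearMap.add_apply, LinearMap.smul_apply,
    smul_eq_mul]
  have e1 : (starRingEnd ℂ) invSqrtTwo = invSqrtTwo := star_invSqrtTwo
  rw [e1]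
  linear_combination (S (e 0) (e 0) + S (e 1) (e 0) + S (e 0) (e 1) + S (e 1) (e 1)) *
    invSqrtTwo_mul_self

theorem IsProjCharge.add_conj_compl (hμ : IsProjCharge μ K) {p : A} (hv : star v * v = 1)
    (hw : star w * w = 1) (hvw : star v * w = 0) (hp : IsStarProjection p) :
    μ (v * p * star v + w * (1 - p) * star w) =
      μ (v * p * star v) - μ (w * p * star w) + μ (w * star w) := by
  have h1 := hμ.add _ _ (hp.conj_isometry hv) (hp.one_sub.conj_isometry hw) (by
    calc v * p * star v * (w * (1 - p) * star w) = v * p * (star v * w) * ((1 - p) * star w) := by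
          noncomm_ring
      _ = 0 := by rw [hvw]; simp)
  have h2 := hμ.add _ _ (hp.conj_isometry hw) (hp.one_sub.conj_isometry hw) (by
    rw [mul_mul_of_isometry hw, hp.mul_one_sub_self]; simp)
  have e : w * p * star w + w * (1 - p) * star w = w * star w := by noncomm_ring
  rw [e] at h2
  rw [h1, h2]; ring

theorem exists_linear_conj_sub_conj (𝒮 : Amplification A) (hμ : IsProjCharge μ K)
    (hv : star v * v = 1) (hw : star w * w = 1)
    (ht : star t * t = 1) (hvw : star v * w = 0) (hvt : star v * t = 0) (hwt : star w * t = 0) :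
    ∃ G : A →ₗ[ℂ] ℂ, ∀ p, IsStarProjection p →
      μ (v * p * star v) - μ (w * p * star w) = G p := by
  have hwv := star_mul_eq_zero_comm hvw
  set a := invSqrtTwo • (v + w) with ha
  set b := invSqrtTwo • (v + -w) with hb
  have haa : star a * a = 1 := combo_isometry hv hw hvw
  have hbb : star b * b = 1 := combo_isometry hv (star_neg_mul_neg_self hw) (by
    rw [mul_neg, hvw, neg_zero])
  have hab : star a * b = 0 := by
    rw [ha, hb, star_mul_combo]
    simp [hv, hw, hvw, hwv]
  have hat : star a * t = 0 := by
    rw [ha, star_smul, star_add, smul_mul_assoc, add_mul, hvt, hwt, add_zero, smul_zero]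
  have hbt : star b * t = 0 := by
    rw [hb, star_smul, star_add, smul_mul_assoc, add_mul, hvt, star_neg, neg_mul, hwt, neg_zero,
      add_zero, smul_zero]
  obtain ⟨L₁, hL₁⟩ := exists_linear_crossCharge 𝒮 hμ haa hbb ht hab hat hbt
  obtain ⟨L₂, hL₂⟩ := exists_linear_crossCharge 𝒮 hμ hbb haa ht (star_mul_eq_zero_comm hab) hbt hat
  have key : ∀ p, IsStarProjection p → μ (v * p * star v) - μ (w * p * star w) + μ (w * star w) =
      1 / 2 * (rangeCharge μ a + rangeCharge μ b + (L₁ + L₂) (p + p - 1)) := by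
    intro p hp
    set u := p + p - 1 with hu
    have hpp : p * p = p := hp.isIdempotentElem
    have huu : u * u = 1 := by
      rw [hu]
      calc (p + p - 1) * (p + p - 1) = 4 * (p * p) - 4 * p + 1 := by noncomm_ring
        _ = 1 := by rw [hpp]; noncomm_ring
    have hus : star u = u := by
      rw [hu, star_sub, star_add, hp.isSelfAdjoint.star_eq, star_one]
    have huU : u ∈ unitary A := by
      rw [Unitary.mem_iff, hus]; exact ⟨huu, huu⟩
    have e : v * p * star v + w * (1 - p) * star w =
        (invSqrtTwo • (a + b * u)) * star (invSqrtTwo • (a + b * u)) := by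
      have h1 : invSqrtTwo • (a + b * u) = v * p + w * (1 - p) := by
        rw [ha, hb, smul_mul_assoc, ← smul_add, smul_smul, invSqrtTwo_mul_self]
        have : v + w + (v + -w) * u = (v * p + w * (1 - p)) + (v * p + w * (1 - p)) := by
          rw [hu]; noncomm_ring
        rw [this, half_add_half]
      rw [h1, star_add, star_mul, star_mul, hp.isSelfAdjoint.star_eq,
        hp.one_sub.isSelfAdjoint.star_eq]
      calc v * p * star v + w * (1 - p) * star w
          = v * (p * p) * star v + w * ((1 - p) * (1 - p)) * star w := by
            rw [hpp, hp.one_sub.isIdempotentElem.eq]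
        _ = v * (p * p) * star v + v * (p * (1 - p)) * star w + w * ((1 - p) * p) * star v +
            w * ((1 - p) * (1 - p)) * star w := by
            rw [hp.mul_one_sub_self, hp.one_sub_mul_self]; simp
        _ = _ := by simp only [add_mul, mul_add, mul_assoc]; abel
    rw [← hμ.add_conj_compl hv hw hvw hp, e]
    change rangeCharge μ (invSqrtTwo • (a + b * u)) = _
    rw [rangeCharge_combo hμ haa (mul_mem_isometry hbb (Unitary.star_mul_self_of_mem huU)) ht
      (by rw [← mul_assoc, hab, zero_mul]) hat (by rw [star_mul, mul_assoc, hbt, mul_zero]),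
      rangeCharge_mul_unitary μ huU, LinearMap.add_apply, hL₁ u huU, hL₂ u huU]
    have : crossCharge μ (b * u) a = crossCharge μ b (a * u) := by
      rw [← crossCharge_mul_unitary μ huU b (a * u), mul_assoc a, huu, mul_one]
    rw [this]; ring
  refine ⟨L₁ + L₂, fun p hp => ?_⟩
  have h1 := key p hp
  have h0 := key 0 (.zero A)
  simp only [mul_zero, zero_mul, add_zero, zero_sub, map_neg] at h0
  rw [map_sub, map_add] at h1
  linear_combination h1 - h0

end

section

variable {A : Type*} [CStarAlgebra A] {μ : A → ℂ} {K : ℝ} {s t : A}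

theorem IsStarProjection.star_mul_eq_zero {p : A} (hp : IsStarProjection p) (h : p * s = 0) :
    star s * p = 0 := by
  have := congrArg star h
  simpa [hp.isSelfAdjoint.star_eq] using this

theorem Amplification.star_S_mul_shift (𝒮 : Amplification A) : star (𝒮.S 0) * 𝒮.shift = 0 := by
  have h := 𝒮.σ_eq 1
  rw [map_one, mul_one, mul_one] at h
  have h1 : star (𝒮.S 0) * 𝒮.shift * star 𝒮.shift = 0 := by
    have := congrArg (fun z => star (𝒮.S 0) * z) h
    simp only [mul_add, mul_one, ← mul_assoc, 𝒮.star_mul_self, one_mul] at this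
    simpa using this
  calc star (𝒮.S 0) * 𝒮.shift = star (𝒮.S 0) * 𝒮.shift * star 𝒮.shift * 𝒮.shift := by
        rw [mul_assoc _ (star _), 𝒮.shift_star_mul_self, mul_one]
    _ = 0 := by rw [h1, zero_mul]

/-- A linear functional agrees with a charge on the projections annihilating `t`. -/
def AgreesOffRange (μ : A → ℂ) (Φ : A →ₗ[ℂ] ℂ) (t : A) : Prop :=
  ∀ q, IsStarProjection q → q * t = 0 → Φ q = μ q

theorem exists_agreesOffRange (𝒮 : Amplification A) (hμ : IsProjCharge μ K)
    (ht : star t * t = 1) : ∃ Φ : A →ₗ[ℂ] ℂ, AgreesOffRange μ Φ t := by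
  have het : (1 - t * star t) * t = 0 := by
    rw [sub_mul, one_mul, mul_assoc, ht, mul_one, sub_self]
  obtain ⟨c, w, hc, hw, hcw, hce, hct, hwt, ht3⟩ :=
    𝒮.exists_mover (isStarProjection_isometry ht).one_sub ht het
  have hcs : star (c * 𝒮.shift) * (c * 𝒮.shift) = 1 := mul_mem_isometry hc 𝒮.shift_star_mul_self
  obtain ⟨G₁, hG₁⟩ := exists_linear_conj_sub_conj 𝒮 hμ hc hw ht3 hcw hct hwt
  obtain ⟨G₂, hG₂⟩ := exists_linear_conj_sub_conj 𝒮 hμ hcs hw ht3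
    (by rw [star_mul, mul_assoc, hcw, mul_zero]) (by rw [star_mul, mul_assoc, hct, mul_zero]) hwt
  refine ⟨(G₁ - G₂) ∘ₗ (𝒮.σ : A →ₗ[ℂ] A), fun q hq hqt => ?_⟩
  have hσ : IsStarProjection (𝒮.σ q) :=
    ⟨by rw [IsIdempotentElem, ← map_mul, hq.isIdempotentElem.eq],
      by rw [IsSelfAdjoint, ← map_star, hq.isSelfAdjoint.star_eq]⟩
  have hq1 : (1 - t * star t) * q = q := by
    rw [sub_mul, one_mul, mul_assoc, hq.star_mul_eq_zero hqt, mul_zero, sub_zero]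
  have hq2 : c * 𝒮.S 0 * q = q := by
    rw [← hq1, ← mul_assoc, hce]
  have hq3 : q * star (c * 𝒮.S 0) = q := by
    have := congrArg star hq2
    simpa [hq.isSelfAdjoint.star_eq] using this
  have e : c * 𝒮.σ q * star c = q + c * 𝒮.shift * 𝒮.σ q * star (c * 𝒮.shift) := by
    have h1 : c * 𝒮.S 0 * q * star (c * 𝒮.S 0) = q := by rw [hq2, hq3]
    calc c * 𝒮.σ q * star c = c * 𝒮.S 0 * q * star (c * 𝒮.S 0) +
          c * 𝒮.shift * 𝒮.σ q * star (c * 𝒮.shift) := by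
          conv_lhs => rw [𝒮.σ_eq q]
          simp only [mul_add, add_mul, star_mul, mul_assoc]
      _ = _ := by rw [h1]
  have h1 := hμ.add _ _ hq (hσ.conj_isometry hcs) (by
    calc q * (c * 𝒮.shift * 𝒮.σ q * star (c * 𝒮.shift))
        = q * star (c * 𝒮.S 0) * (c * 𝒮.shift * 𝒮.σ q * star (c * 𝒮.shift)) := by rw [hq3]
      _ = q * (star (𝒮.S 0) * (star c * c) * 𝒮.shift) * (𝒮.σ q * star (c * 𝒮.shift)) := by
          rw [star_mul]; noncomm_ring
      _ = 0 := by rw [hc, mul_one, 𝒮.star_S_mul_shift]; simp)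
  have h2 := hG₁ _ hσ
  have h3 := hG₂ _ hσ
  rw [e, h1] at h2
  change G₁ (𝒮.σ q) - G₂ (𝒮.σ q) = μ q
  linear_combination h3 - h2

/-- A linear functional vanishing on the projections below `h` vanishes on the corner of `h`. -/
def HasCorner (A : Type*) [CStarAlgebra A] : Prop :=
  ∀ (h : A) (Ψ : A →ₗ[ℂ] ℂ), IsStarProjection h →
    (∀ p, IsStarProjection p → h * p * h = p → Ψ p = 0) → ∀ x, Ψ (h * x * h) = 0

theorem HasCorner.eq (hA : HasCorner A) {Φ Ψ : A →ₗ[ℂ] ℂ} (hΦ : AgreesOffRange μ Φ s)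
    (hΨ : AgreesOffRange μ Ψ t) {h : A} (hh : IsStarProjection h) (hs : h * s = 0)
    (ht : h * t = 0) {p q : A} (hp : h * p = p) (hq : q * h = q) (x : A) :
    Φ (p * x * q) = Ψ (p * x * q) := by
  have h0 := hA h (Φ - Ψ) hh (fun r hr hrh => by
    have hr0 : ∀ {s}, h * s = 0 → r * s = 0 := fun {s} hs => by
      rw [← hrh, mul_assoc, hs, mul_zero]
    rw [LinearMap.sub_apply, hΦ r hr (hr0 hs), hΨ r hr (hr0 ht), sub_self]) (p * x * q)
  have e : h * (p * x * q) * h = p * x * q := by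
    rw [← mul_assoc, ← mul_assoc, hp, mul_assoc, hq]
  rw [e, LinearMap.sub_apply] at h0
  exact sub_eq_zero.1 h0

theorem isStarProjection_compl_add (hs : star s * s = 1) (ht : star t * t = 1)
    (hst : star s * t = 0) : IsStarProjection (1 - (s * star s + t * star t)) :=
  ((isStarProjection_isometry hs).add (isStarProjection_isometry ht) (by
    calc s * star s * (t * star t) = s * (star s * t) * star t := by noncomm_ring
      _ = 0 := by rw [hst]; simp)).one_sub

theorem HasCorner.eq_of_orthogonal (hA : HasCorner A) {Φ Ψ : A →ₗ[ℂ] ℂ}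
    (hΦ : AgreesOffRange μ Φ s) (hΨ : AgreesOffRange μ Ψ t) (hs : star s * s = 1)
    (ht : star t * t = 1) (hst : star s * t = 0) {p q : A} (hp : IsStarProjection p)
    (hps : p * s = 0) (hpt : p * t = 0) (hqs : q * s = 0) (hqt : q * t = 0) (x : A) :
    Φ (p * x * q) = Ψ (p * x * q) := by
  refine hA.eq hΦ hΨ (isStarProjection_compl_add hs ht hst) ?_ ?_ ?_ ?_ x
  · calc (1 - (s * star s + t * star t)) * s = s - s * (star s * s) - t * (star t * s) := by
          noncomm_ring
      _ = 0 := by rw [hs, star_mul_eq_zero_comm hst]; simp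
  · calc (1 - (s * star s + t * star t)) * t = t - s * (star s * t) - t * (star t * t) := by
          noncomm_ring
      _ = 0 := by rw [ht, hst]; simp
  · calc (1 - (s * star s + t * star t)) * p = p - s * (star s * p) - t * (star t * p) := by
          noncomm_ring
      _ = p := by rw [hp.star_mul_eq_zero hps, hp.star_mul_eq_zero hpt]; simp
  · calc q * (1 - (s * star s + t * star t)) = q - q * s * star s - q * t * star t := by
          noncomm_ring
      _ = q := by rw [hqs, hqt]; simp

theorem Amplification.block_mul_S (𝒮 : Amplification A) (i : Fin 4) (m : Fin 3) :
    𝒮.block i * 𝒮.S m = 0 ∨ 𝒮.block i = 𝒮.S m * star (𝒮.S m) := by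
  by_cases h : (i : ℕ) = m
  · right
    fin_cases i <;> fin_cases m <;> first | rfl | simp at h
  · left
    fin_cases i
    · exact 𝒮.range_mul_S h
    · exact 𝒮.range_mul_S h
    · exact 𝒮.range_mul_S h
    · fin_cases m <;>
        simp [Amplification.block, sub_mul, add_mul, mul_assoc, 𝒮.star_mul_self, 𝒮.star_mul_of_ne]

theorem exists_agreesOffRange_S (𝒮 : Amplification A) (hA : HasCorner A) (hμ : IsProjCharge μ K) :
    ∃ Φ : A →ₗ[ℂ] ℂ, ∀ m : Fin 3, AgreesOffRange μ Φ (𝒮.S m) := by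
  choose Φ hΦ using fun m : Fin 3 => exists_agreesOffRange 𝒮 hμ (𝒮.star_mul_self m)
  choose k hk₁ hk₂ using 𝒮.exists_avoid
  refine ⟨∑ i, ∑ j, Φ (k i j) ∘ₗ LinearMap.mulRight ℂ (𝒮.block j) ∘ₗ
    LinearMap.mulLeft ℂ (𝒮.block i), fun m q hq hqm => ?_⟩
  rw [← hΦ m q hq hqm]
  conv_rhs => rw [sum_blocks 𝒮.block 𝒮.sum_block q]
  simp only [LinearMap.sum_apply, map_sum, LinearMap.comp_apply, LinearMap.mulRight_apply,
    LinearMap.mulLeft_apply]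
  refine Finset.sum_congr rfl fun i _ => Finset.sum_congr rfl fun j _ => ?_
  rcases 𝒮.block_mul_S i m with hi | hi
  swap
  · have : 𝒮.block i * q = 0 := by
      rw [hi, mul_assoc, hq.star_mul_eq_zero hqm, mul_zero]
    simp [this]
  rcases 𝒮.block_mul_S j m with hj | hj
  swap
  · have : q * 𝒮.block j = 0 := by rw [hj, ← mul_assoc, hqm, zero_mul]
    simp [mul_assoc, this]
  by_cases hm : k i j = m
  · rw [hm]
  · exact hA.eq_of_orthogonal (hΦ _) (hΦ _) (𝒮.star_mul_self _) (𝒮.star_mul_self _)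
      (𝒮.star_mul_of_ne _ _ fun h => hm (Fin.ext h)) (𝒮.isStarProjection_block i) (hk₁ i j) hi
      (hk₂ i j) hj q

theorem AgreesOffRange.of_range_le (𝒮 : Amplification A) (hA : HasCorner A)
    (hμ : IsProjCharge μ K) {Φ : A →ₗ[ℂ] ℂ} (hΦ : ∀ m : Fin 3, AgreesOffRange μ Φ (𝒮.S m))
    (ht : star t * t = 1) (hSt : 𝒮.S 0 * star (𝒮.S 0) * t = t) : AgreesOffRange μ Φ t := by
  obtain ⟨Ψ, hΨ⟩ := exists_agreesOffRange 𝒮 hμ ht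
  intro q hq hqt
  rw [← hΨ q hq hqt]
  have h0 : ∀ n, n ≠ 0 → star (𝒮.S n) * t = 0 := fun n hn => by
    rw [← hSt, ← mul_assoc, ← mul_assoc, 𝒮.star_mul_of_ne n 0 hn, zero_mul, zero_mul]
  have hy : ∀ n, IsStarProjection (𝒮.S n * star (𝒮.S n)) :=
    fun n => isStarProjection_isometry (𝒮.star_mul_self n)
  have hyt : ∀ n, n ≠ 0 → 𝒮.S n * star (𝒮.S n) * t = 0 := fun n hn => by
    rw [mul_assoc, h0 n hn, mul_zero]
  set y₁ := 𝒮.S 1 * star (𝒮.S 1) with hy₁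
  set y₂ := 𝒮.S 2 * star (𝒮.S 2) with hy₂
  set r := 1 - (t * star t + y₁ + y₂) with hr
  have hty : ∀ n, n ≠ 0 → t * star t * 𝒮.S n = 0 := fun n hn => by
    rw [mul_assoc, star_mul_eq_zero_comm (h0 n hn), mul_zero]
  have hrp : IsStarProjection r := by
    refine (((isStarProjection_isometry ht).add (hy 1) ?_).add (hy 2) ?_).one_sub
    · rw [← mul_assoc, hty 1 one_ne_zero, zero_mul]
    · rw [← mul_assoc, add_mul, hty 2 two_ne_zero, 𝒮.range_mul_S (by decide), add_zero, zero_mul]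
  have hr1 : r * 𝒮.S 1 = 0 := by
    rw [hr, sub_mul, add_mul, add_mul, hty 1 one_ne_zero, hy₁, hy₂, 𝒮.range_mul_S_self,
      𝒮.range_mul_S (by decide)]
    simp
  have hr2 : r * 𝒮.S 2 = 0 := by
    rw [hr, sub_mul, add_mul, add_mul, hty 2 two_ne_zero, hy₁, hy₂, 𝒮.range_mul_S_self,
      𝒮.range_mul_S (by decide)]
    simp
  have hrt : r * t = 0 := by
    rw [hr, sub_mul, add_mul, add_mul, mul_assoc, ht, hy₁, hy₂, hyt 1 one_ne_zero,
      hyt 2 two_ne_zero]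
    simp
  have hsum : y₁ + y₂ + r = 1 - t * star t := by rw [hr]; abel
  have hq1 : (1 - t * star t) * q * (1 - t * star t) = q := by
    rw [sub_mul, one_mul, mul_assoc, hq.star_mul_eq_zero hqt, mul_zero, sub_zero, mul_sub,
      mul_one, ← mul_assoc, hqt, zero_mul, sub_zero]
  have hdec : q = y₁ * q * y₁ + y₁ * q * y₂ + y₁ * q * r + (y₂ * q * y₁ + y₂ * q * y₂ + y₂ * q * r)
      + (r * q * y₁ + r * q * y₂ + r * q * r) := by
    conv_lhs => rw [← hq1, ← hsum]
    noncomm_ring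
  have h12 : y₁ * 𝒮.S 2 = 0 := 𝒮.range_mul_S (by decide)
  have h21 : y₂ * 𝒮.S 1 = 0 := 𝒮.range_mul_S (by decide)
  have h10 : y₁ * 𝒮.S 0 = 0 := 𝒮.range_mul_S (by decide)
  have h20 : y₂ * 𝒮.S 0 = 0 := 𝒮.range_mul_S (by decide)
  have c0 : ∀ {p p'}, IsStarProjection p → p * 𝒮.S 0 = 0 → p' * 𝒮.S 0 = 0 →
      Φ (p * q * p') = Ψ (p * q * p') := by
    intro p p' hp h h'
    refine hA.eq (hΦ 0) hΨ (𝒮.isStarProjection_compl 0) (𝒮.compl_mul_S 0) ?_ ?_ ?_ q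
    · rw [Amplification.compl, sub_mul, one_mul, hSt, sub_self]
    · rw [Amplification.compl, sub_mul, one_mul, mul_assoc, hp.star_mul_eq_zero h, mul_zero,
        sub_zero]
    · rw [Amplification.compl, mul_sub, mul_one, ← mul_assoc, h', zero_mul, sub_zero]
  have c1 := fun {p p' : A} => hA.eq_of_orthogonal (p := p) (q := p') (hΦ 1) hΨ (𝒮.star_mul_self 1)
    ht (h0 1 one_ne_zero)
  have c2 := fun {p p' : A} => hA.eq_of_orthogonal (p := p) (q := p') (hΦ 2) hΨ (𝒮.star_mul_self 2)
    ht (h0 2 two_ne_zero)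
  have t1 := hyt 1 one_ne_zero
  have t2 := hyt 2 two_ne_zero
  rw [hdec]
  simp only [map_add]
  rw [c0 (hy 1) h10 h10, c0 (hy 1) h10 h20, c0 (hy 2) h20 h10, c0 (hy 2) h20 h20,
    c2 (hy 1) h12 t1 hr2 hrt q, c2 hrp hr2 hrt h12 t1 q, c2 hrp hr2 hrt hr2 hrt q,
    c1 (hy 2) h21 t2 hr1 hrt q, c1 hrp hr1 hrt h21 t2 q]

/-- Every projection has two orthogonal commuting projections, each dominating an isometry
whose range lies in the range of a given isometry. -/
def HasCommutingRoom (A : Type*) [CStarAlgebra A] : Prop :=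
  ∀ p s : A, IsStarProjection p → star s * s = 1 → ∃ z t : Fin 2 → A,
    (∀ i, IsStarProjection (z i)) ∧ (∀ i, p * z i = z i * p) ∧ z 0 * z 1 = 0 ∧
    ∀ i, star (t i) * t i = 1 ∧ z i * t i = t i ∧ s * star s * t i = t i

theorem isStarProjection_mul_of_commute {p z : A} (hp : IsStarProjection p)
    (hz : IsStarProjection z) (h : p * z = z * p) : IsStarProjection (p * z) := by
  constructor
  · rw [IsIdempotentElem]
    calc p * z * (p * z) = p * (z * p) * z := by noncomm_ring
      _ = (p * p) * (z * z) := by rw [← h]; noncomm_ring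
      _ = p * z := by rw [hp.isIdempotentElem.eq, hz.isIdempotentElem.eq]
  · rw [IsSelfAdjoint, star_mul, hp.isSelfAdjoint.star_eq, hz.isSelfAdjoint.star_eq, h]

theorem Amplification.hasLinearExtension (𝒮 : Amplification A) (hA : HasCorner A)
    (hR : HasCommutingRoom A) : HasLinearExtension A := by
  intro μ K hμ
  obtain ⟨Φ, hΦ⟩ := exists_agreesOffRange_S 𝒮 hA hμ
  refine ⟨Φ, fun p hp => ?_⟩
  obtain ⟨z, t, hz, hpz, h01, ht⟩ := hR p (𝒮.S 0) hp (𝒮.star_mul_self 0)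
  have hg : ∀ i, AgreesOffRange μ Φ (t i) := fun i =>
    AgreesOffRange.of_range_le 𝒮 hA hμ hΦ (ht i).1 (ht i).2.2
  have h10 : z 1 * z 0 = 0 := by
    have := congrArg star h01
    simpa [(hz 0).isSelfAdjoint.star_eq, (hz 1).isSelfAdjoint.star_eq] using this
  have t01 : z 0 * t 1 = 0 := by rw [← (ht 1).2.1, ← mul_assoc, h01, zero_mul]
  have t10 : z 1 * t 0 = 0 := by rw [← (ht 0).2.1, ← mul_assoc, h10, zero_mul]
  have hzz : IsStarProjection (1 - (z 0 + z 1)) := ((hz 0).add (hz 1) h01).one_sub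
  have p0 := isStarProjection_mul_of_commute hp (hz 0) (hpz 0)
  have p1 := isStarProjection_mul_of_commute hp (hz 1) (hpz 1)
  have p2 := isStarProjection_mul_of_commute hp hzz (by
    rw [mul_sub, sub_mul, mul_add, add_mul, hpz, hpz, mul_one, one_mul])
  have o1 : p * z 0 * (p * z 1) = 0 := by
    calc p * z 0 * (p * z 1) = p * (z 0 * p) * z 1 := by noncomm_ring
      _ = p * p * (z 0 * z 1) := by rw [← hpz]; noncomm_ring
      _ = 0 := by rw [h01, mul_zero]
  have hs0 : (z 0 + z 1) * (1 - (z 0 + z 1)) = 0 := ((hz 0).add (hz 1) h01).mul_one_sub_self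
  have o2 : (p * z 0 + p * z 1) * (p * (1 - (z 0 + z 1))) = 0 := by
    calc (p * z 0 + p * z 1) * (p * (1 - (z 0 + z 1)))
        = p * (z 0 * p + z 1 * p) * (1 - (z 0 + z 1)) := by noncomm_ring
      _ = p * p * ((z 0 + z 1) * (1 - (z 0 + z 1))) := by rw [← hpz, ← hpz]; noncomm_ring
      _ = 0 := by rw [hs0, mul_zero]
  have e : p = p * z 0 + p * z 1 + p * (1 - (z 0 + z 1)) := by noncomm_ring
  have h1 := hμ.add _ _ (p0.add p1 o1) p2 o2
  rw [hμ.add _ _ p0 p1 o1] at h1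
  rw [e, h1, map_add, map_add, hg 1 _ p0 (by rw [mul_assoc, t01, mul_zero]),
    hg 0 _ p1 (by rw [mul_assoc, t10, mul_zero]), hg 0 _ p2 (by
      rw [mul_assoc, sub_mul, add_mul, (ht 0).2.1, t10]; simp)]

end

section

open scoped ENNReal

variable {E : Type*} [NormedAddCommGroup E]

/-- The Hilbert sum of countably many copies of `E`. -/
abbrev CountableSum (E : Type*) [NormedAddCommGroup E] : Type _ := lp (fun _ : ℕ => E) 2

namespace CountableSum

theorem norm_sq_eq (f : CountableSum E) : HasSum (fun n => ‖f n‖ ^ 2) (‖f‖ ^ 2) := by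
  have := lp.hasSum_norm (p := 2) (by norm_num) f
  simpa using this

theorem ext_iff' {f g : CountableSum E} (h : ∀ n, f n = g n) : f = g := lp.ext (funext h)

theorem hasSum_norm_sq_casesOn (f : CountableSum E) :
    HasSum (fun n => ‖(Nat.casesOn n 0 f : E)‖ ^ 2) (‖f‖ ^ 2) := by
  have h := (hasSum_nat_add_iff (f := fun n => ‖(Nat.casesOn n 0 f : E)‖ ^ 2) 1).1 (norm_sq_eq f)
  simpa using h

variable [InnerProductSpace ℂ E]

theorem memℓp_clm (a : E →L[ℂ] E) (f : CountableSum E) : Memℓp (fun n => a (f n)) 2 := by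
  refine Memℓp.mono ((lp.memℓp f).norm.const_smul (‖a‖)) fun n => ?_
  simpa using a.le_opNorm (f n)

/-- The diagonal amplification of an operator. -/
noncomputable def diag (a : E →L[ℂ] E) : CountableSum E →L[ℂ] CountableSum E :=
  LinearMap.mkContinuous
    { toFun := fun f => ⟨fun n => a (f n), memℓp_clm a f⟩
      map_add' := fun f g => ext_iff' fun n => map_add a _ _
      map_smul' := fun c f => ext_iff' fun n => map_smul a _ _ } ‖a‖ fun f => by
    refine le_of_sq_le_sq ?_ (by positivity)
    rw [mul_pow]
    refine hasSum_le (fun n => ?_) (norm_sq_eq _) ((norm_sq_eq f).mul_left _)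
    rw [← mul_pow]
    exact pow_le_pow_left₀ (norm_nonneg _) (a.le_opNorm _) 2

theorem diag_apply (a : E →L[ℂ] E) (f : CountableSum E) (n : ℕ) : diag a f n = a (f n) := rfl

/-- The right shift. -/
noncomputable def shift : CountableSum E →L[ℂ] CountableSum E :=
  LinearMap.mkContinuous
    { toFun := fun f => ⟨fun n => Nat.casesOn n 0 f, by
        refine memℓp_gen ?_
        rw [← summable_nat_add_iff 1]
        exact (lp.memℓp f).summable (by norm_num)⟩
      map_add' := fun f g => ext_iff' fun n => by
        cases n
        exacts [(add_zero (0 : E)).symm, rfl]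
      map_smul' := fun c f => ext_iff' fun n => by
        cases n
        exacts [(smul_zero c).symm, rfl] } 1 fun f => by
    refine le_of_sq_le_sq ?_ (by positivity)
    rw [one_mul]
    refine le_of_eq ((norm_sq_eq _).unique ?_)
    exact hasSum_norm_sq_casesOn f

theorem shift_zero (f : CountableSum E) : shift f 0 = 0 := rfl

theorem shift_succ (f : CountableSum E) (n : ℕ) : shift f (n + 1) = f n := rfl

/-- The inclusion of the `n`-th summand. -/
noncomputable def incl (n : ℕ) : E →L[ℂ] CountableSum E :=
  lp.singleContinuousLinearMap ℂ (fun _ : ℕ => E) 2 n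

theorem incl_apply_self (n : ℕ) (x : E) : incl n x n = x := lp.single_apply_self ..

theorem incl_apply_of_ne {n m : ℕ} (h : m ≠ n) (x : E) : incl n x m = 0 :=
  lp.single_apply_ne _ _ _ h

theorem inner_incl_left (n : ℕ) (x : E) (f : CountableSum E) :
    inner ℂ (incl n x) f = inner ℂ x (f n) := lp.inner_single_left ..

theorem inner_shift_shift (f g : CountableSum E) : inner ℂ (shift f) (shift g) = inner ℂ f g := by
  have h := (hasSum_nat_add_iff (f := fun n => inner ℂ (shift f n) (shift g n)) 1).1
    (lp.hasSum_inner f g)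
  rw [Finset.sum_range_one, shift_zero, inner_zero_left, add_zero] at h
  exact (lp.hasSum_inner _ _).unique h

variable [CompleteSpace E]

theorem diag_adjoint (a : E →L[ℂ] E) :
    diag (ContinuousLinearMap.adjoint a) = ContinuousLinearMap.adjoint (diag a) := by
  rw [ContinuousLinearMap.eq_adjoint_iff]
  intro f g
  rw [lp.inner_eq_tsum, lp.inner_eq_tsum]
  refine tsum_congr fun n => ?_
  rw [diag_apply, diag_apply, ContinuousLinearMap.adjoint_inner_left]

theorem adjoint_shift_shift (f : CountableSum E) :
    ContinuousLinearMap.adjoint shift (shift f) = f :=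
  ext_inner_left ℂ fun x => by rw [ContinuousLinearMap.adjoint_inner_right, inner_shift_shift]

theorem adjoint_shift_apply (f : CountableSum E) (n : ℕ) :
    ContinuousLinearMap.adjoint shift f n = f (n + 1) := by
  have h' : ∀ x : E, shift (incl n x) = incl (n + 1) x := by
    intro x
    refine ext_iff' fun m => ?_
    cases m with
    | zero => rw [shift_zero, incl_apply_of_ne (by omega)]
    | succ m =>
      rw [shift_succ]
      by_cases hm : m = n
      · subst hm; rw [incl_apply_self, incl_apply_self]
      · rw [incl_apply_of_ne hm, incl_apply_of_ne (by omega)]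
  refine ext_inner_left ℂ fun x => ?_
  rw [← inner_incl_left, ContinuousLinearMap.adjoint_inner_right, h', inner_incl_left]

theorem exists_linearIsometryEquiv (h : ¬ FiniteDimensional ℂ E) :
    Nonempty (E ≃ₗᵢ[ℂ] CountableSum E) := by
  obtain ⟨I, b, hb⟩ := exists_hilbertBasis ℂ E
  have hI : Infinite I := by
    by_contra hI
    rw [not_infinite_iff_finite] at hI
    have := Fintype.ofFinite I
    exact h b.toOrthonormalBasis.toBasis.finiteDimensional_of_finite
  have hc : Cardinal.mk I = Cardinal.mk (ℕ × I) := by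
    rw [Cardinal.mk_prod, Cardinal.lift_id'.{0}]
    simp [Cardinal.aleph0_mul_eq (Cardinal.aleph0_le_mk I)]
  obtain ⟨e⟩ := Cardinal.eq.1 hc
  let v : I → CountableSum E := fun i => incl (e i).1 (b (e i).2)
  have hv : Orthonormal ℂ v := by
    classical
    rw [orthonormal_iff_ite]
    intro i j
    rw [inner_incl_left]
    by_cases h1 : (e i).1 = (e j).1
    · rw [h1, incl_apply_self, orthonormal_iff_ite.1 b.orthonormal]
      by_cases h2 : (e i).2 = (e j).2
      · rw [if_pos h2, if_pos (e.injective (Prod.ext h1 h2))]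
      · rw [if_neg h2, if_neg fun hij => h2 (by rw [hij])]
    · rw [incl_apply_of_ne h1, inner_zero_right, if_neg fun hij => h1 (by rw [hij])]
  have hspan : (Submodule.span ℂ (Set.range v))ᗮ = ⊥ := by
    rw [Submodule.eq_bot_iff]
    intro f hf
    have h0 : ∀ n i, inner ℂ (b i) (f n) = 0 := by
      intro n i
      have := (Submodule.mem_orthogonal _ _).1 hf (v (e.symm (n, i)))
        (Submodule.subset_span ⟨_, rfl⟩)
      simpa [v, inner_incl_left] using this
    refine ext_iff' fun n => ?_
    apply b.repr.injective
    refine lp.ext (funext fun i => ?_)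
    rw [b.repr_apply_apply, h0]
    simp
  exact ⟨b.repr.trans (HilbertBasis.mkOfOrthogonalEqBot hv hspan).repr.symm⟩

end CountableSum

open CountableSum in
theorem nonempty_amplification {H : Type*} [NormedAddCommGroup H] [InnerProductSpace ℂ H]
    [CompleteSpace H] (h : ¬ FiniteDimensional ℂ H) : Nonempty (Amplification (H →L[ℂ] H)) := by
  obtain ⟨U⟩ := exists_linearIsometryEquiv h
  let S : ℕ → H →L[ℂ] H := fun n => (U.symm.toContinuousLinearEquiv : _ →L[ℂ] H) ∘L incl n
  have hS : ∀ n x, S n x = U.symm (incl n x) := fun n x => rfl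
  let C : (CountableSum H →L[ℂ] CountableSum H) → H →L[ℂ] H := fun a =>
    (U.symm.toContinuousLinearEquiv : _ →L[ℂ] H) ∘L a ∘L (U.toContinuousLinearEquiv : H →L[ℂ] _)
  have hC : ∀ (a : CountableSum H →L[ℂ] CountableSum H) x, C a x = U.symm (a (U x)) :=
    fun a x => rfl
  have hSstar : ∀ n x, star (S n) x = U x n := fun n x => by
    refine ext_inner_left ℂ fun y => ?_
    rw [ContinuousLinearMap.star_eq_adjoint, ContinuousLinearMap.adjoint_inner_right, hS,
      ← U.inner_map_map, U.apply_symm_apply, inner_incl_left]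
  have hCstar : ∀ a, star (C a) = C (ContinuousLinearMap.adjoint a) := fun a => by
    rw [ContinuousLinearMap.star_eq_adjoint]
    refine ((ContinuousLinearMap.eq_adjoint_iff _ _).2 fun x y => ?_).symm
    rw [hC, hC, ← U.inner_map_map, U.apply_symm_apply, ContinuousLinearMap.adjoint_inner_left,
      ← U.inner_map_map x, U.apply_symm_apply]
  let σ : (H →L[ℂ] H) →⋆ₐ[ℂ] (H →L[ℂ] H) :=
    { toFun := fun a => C (diag a)
      map_one' := by ext x; exact U.symm_apply_apply x
      map_mul' := fun a b => by
        ext x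
        rw [mul_apply_eq_comp, hC, hC, hC, U.apply_symm_apply]; rfl
      map_zero' := by ext x; exact map_zero U.symm
      map_add' := fun a b => by ext x; exact map_add U.symm (diag a (U x)) (diag b (U x))
      commutes' := fun c => by
        ext x
        change U.symm (c • U x) = c • x
        rw [map_smul, U.symm_apply_apply]
      map_star' := fun a => by
        rw [hCstar, ContinuousLinearMap.star_eq_adjoint, diag_adjoint] }
  refine ⟨{ S := S, shift := C shift, σ := σ, star_mul_self := ?_,
            star_mul_of_ne := ?_, shift_star_mul_self := ?_, σ_eq := ?_ }⟩
  · intro n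
    ext x
    rw [mul_apply_eq_comp, hSstar, hS, U.apply_symm_apply, incl_apply_self]; rfl
  · intro n m hnm
    ext x
    rw [mul_apply_eq_comp, hSstar, hS, U.apply_symm_apply, incl_apply_of_ne hnm]; rfl
  · ext x
    rw [mul_apply_eq_comp, hCstar, hC, hC shift, U.apply_symm_apply, adjoint_shift_shift,
      U.symm_apply_apply]; rfl
  · intro a
    ext x
    apply U.injective
    refine ext_iff' fun n => ?_
    change U (U.symm (diag a (U x))) n = U (S 0 (a (star (S 0) x)) +
      C shift (C (diag a) (star (C shift) x))) n
    rw [hSstar, hCstar, hS, hC, hC, hC]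
    simp only [map_add, U.apply_symm_apply]
    rw [lp.coeFn_add, Pi.add_apply]
    cases n with
    | zero => rw [incl_apply_self, shift_zero, add_zero, diag_apply]
    | succ n =>
      rw [incl_apply_of_ne (by omega), shift_succ, zero_add, diag_apply, diag_apply,
        adjoint_shift_apply]

end

theorem hasProjBound_continuousLinearMap (H : Type*) [NormedAddCommGroup H] [InnerProductSpace ℂ H]
    [CompleteSpace H] : HasProjBound (H →L[ℂ] H) := by
  by_cases h : FiniteDimensional ℂ H
  · exact hasProjBound_of_finiteDimensional
  · exact (nonempty_amplification h).some.hasProjBound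

theorem HasProjBound.eq_zero {A : Type*} [CStarAlgebra A] (h : HasProjBound A) (Φ : A →ₗ[ℂ] ℂ)
    (h0 : ∀ p, IsStarProjection p → Φ p = 0) : Φ = 0 := by
  obtain ⟨C, _, hC⟩ := h
  ext x
  simpa using hC Φ 0 (fun p hp => by rw [h0 p hp, norm_zero]) x

theorem hasCorner_continuousLinearMap {H : Type*} [NormedAddCommGroup H] [InnerProductSpace ℂ H]
    [CompleteSpace H] : HasCorner (H →L[ℂ] H) := by
  intro h Ψ hh hΨ x
  obtain ⟨K, _, rfl⟩ := isStarProjection_iff_eq_starProjection.1 hh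
  have : CompleteSpace K := by
    rw [← K.orthogonal_orthogonal]
    exact (Submodule.isClosed_orthogonal _).completeSpace_coe
  let P : H →L[ℂ] K := K.orthogonalProjectionOnto
  have hP : ∀ y : K, P (y : H) = y := fun y => K.orthogonalProjectionOnto_mem_subspace_eq_self y
  have hadj : ContinuousLinearMap.adjoint K.subtypeL = P := K.adjoint_subtypeL
  have hadj' : ContinuousLinearMap.adjoint P = K.subtypeL := by
    rw [← hadj, ContinuousLinearMap.adjoint_adjoint]
  let L : (K →L[ℂ] K) →ₗ[ℂ] (H →L[ℂ] H) :=
    { toFun := fun y => K.subtypeL ∘L y ∘L P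
      map_add' := fun a b => by ext; simp
      map_smul' := fun a b => by ext; simp }
  have hL : ∀ y z, L y z = y (P z) := fun _ _ => rfl
  have hK : ∀ z, K.starProjection z = P z := fun _ => rfl
  have hz : Ψ ∘ₗ L = 0 := by
    refine (hasProjBound_continuousLinearMap K).eq_zero _ fun p hp => ?_
    refine hΨ _ ⟨?_, ?_⟩ ?_
    · ext z
      have := DFunLike.congr_fun hp.isIdempotentElem.eq (P z)
      change L p (L p z) = L p z
      rw [hL, hL, hP]
      exact congrArg _ this
    · have := hp.isSelfAdjoint.star_eq
      rw [ContinuousLinearMap.star_eq_adjoint] at this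
      change star (K.subtypeL ∘L p ∘L P) = K.subtypeL ∘L p ∘L P
      rw [ContinuousLinearMap.star_eq_adjoint, ContinuousLinearMap.adjoint_comp,
        ContinuousLinearMap.adjoint_comp, hadj, hadj', this]
      rfl
    · ext z
      change K.starProjection (L p (K.starProjection z)) = L p z
      rw [hL, hL, hK, hK, hP, hP]
  have h2 : K.starProjection * x * K.starProjection = L (P ∘L x ∘L K.subtypeL) := by
    ext z
    rfl
  rw [h2]
  exact DFunLike.congr_fun hz _

section

variable {E : Type*} [NormedAddCommGroup E] [InnerProductSpace ℂ E]

/-- Orthonormal sets which are also orthogonal for the form of `q`. -/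
def IsJointlyOrthonormal (q : E →L[ℂ] E) (s : Set E) : Prop :=
  (∀ x ∈ s, ‖x‖ = 1) ∧ ∀ x ∈ s, ∀ y ∈ s, x ≠ y → inner ℂ x y = 0 ∧ inner ℂ x (q y) = 0

theorem exists_maximal_isJointlyOrthonormal (q : E →L[ℂ] E) :
    ∃ s, Maximal (IsJointlyOrthonormal q) s := by
  refine zorn_subset {s | IsJointlyOrthonormal q s} fun c hc hchain =>
    ⟨⋃₀ c, ⟨?_, ?_⟩, fun s hs => Set.subset_sUnion_of_mem hs⟩
  · rintro x ⟨s, hs, hx⟩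
    exact (hc hs).1 x hx
  · rintro x ⟨s, hs, hx⟩ y ⟨t, ht, hy⟩ hxy
    rcases hchain.total hs ht with h | h
    · exact (hc ht).2 x (h hx) y hy hxy
    · exact (hc hs).2 x hx y (h hy) hxy

theorem orthogonal_span_eq_bot_of_maximal {q : E →L[ℂ] E}
    (hq : ∀ x y, inner ℂ (q x) y = inner ℂ x (q y)) {s : Set E}
    (hs : Maximal (IsJointlyOrthonormal q) s) : (Submodule.span ℂ (s ∪ q '' s))ᗮ = ⊥ := by
  rw [Submodule.eq_bot_iff]
  intro w hw
  by_contra hw0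
  have hw' : ∀ m ∈ s ∪ q '' s, inner ℂ m w = 0 := fun m hm =>
    (Submodule.mem_orthogonal _ _).1 hw m (Submodule.subset_span hm)
  set v : E := ((‖w‖⁻¹ : ℝ) : ℂ) • w with hv
  have hn : ‖w‖ ≠ 0 := norm_ne_zero_iff.2 hw0
  have hv1 : ‖v‖ = 1 := by
    rw [hv, norm_smul]
    simp [hn]
  have hv2 : ∀ m ∈ s ∪ q '' s, inner ℂ m v = 0 := fun m hm => by
    rw [hv, inner_smul_right, hw' m hm, mul_zero]
  have hv2' : ∀ m ∈ s ∪ q '' s, inner ℂ v m = 0 := fun m hm => inner_eq_zero_symm.1 (hv2 m hm)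
  have hins : IsJointlyOrthonormal q (insert v s) := by
    refine ⟨?_, ?_⟩
    · rintro x (rfl | hx)
      exacts [hv1, hs.1.1 x hx]
    · rintro x (rfl | hx) y (rfl | hy) hxy
      · exact absurd rfl hxy
      · exact ⟨hv2' y (.inl hy), hv2' _ (.inr ⟨y, hy, rfl⟩)⟩
      · exact ⟨hv2 x (.inl hx), by rw [← hq]; exact hv2 _ (.inr ⟨x, hx, rfl⟩)⟩
      · exact hs.1.2 x hx y hy hxy
  have hmem : v ∈ s := hs.2 hins (Set.subset_insert _ _) (Set.mem_insert _ _)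
  have := hv2 v (.inl hmem)
  rw [inner_self_eq_zero] at this
  rw [this, norm_zero] at hv1
  exact zero_ne_one hv1

theorem infinite_of_orthogonal_span_eq_bot (hE : ¬ FiniteDimensional ℂ E) {s : Set E}
    (hs : (Submodule.span ℂ s)ᗮ = ⊥) : s.Infinite := by
  intro hfin
  have := FiniteDimensional.span_of_finite ℂ hfin
  have htop : Submodule.span ℂ s = ⊤ := by
    rw [← Submodule.orthogonal_eq_bot_iff, hs]
  rw [htop] at this
  exact hE (Module.Finite.of_surjective (⊤ : Submodule ℂ E).subtype fun x => ⟨⟨x, trivial⟩, rfl⟩)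

theorem HilbertBasis.mk_le_of_orthogonal_span_eq_bot {I s : Set E} (b : HilbertBasis I ℂ E)
    (hs : (Submodule.span ℂ s)ᗮ = ⊥) (hinf : s.Infinite) : Cardinal.mk I ≤ Cardinal.mk s := by
  have := hinf.to_subtype
  have hcount : ∀ m : s, (Function.support fun i => b.repr (m : E) i).Countable := fun m => by
    have h := (lp.memℓp (b.repr (m : E))).summable (by norm_num)
    refine h.countable_support.mono fun i hi => ?_
    simpa using hi
  have hU : (⋃ m : s, Function.support fun i => b.repr (m : E) i) = Set.univ := by
    rw [Set.eq_univ_iff_forall]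
    intro i
    by_contra hi
    have hi' : ∀ m ∈ s, inner ℂ m (b i) = 0 := fun m hm => by
      refine inner_eq_zero_symm.1 ?_
      rw [← b.repr_apply_apply]
      by_contra h
      exact hi (Set.mem_iUnion.2 ⟨⟨m, hm⟩, h⟩)
    have : b i ∈ (Submodule.span ℂ s)ᗮ := by
      rw [Submodule.mem_orthogonal]
      intro u hu
      induction hu using Submodule.span_induction with
      | mem x hx => exact hi' x hx
      | zero => exact inner_zero_left _
      | add x y _ _ hx hy => rw [inner_add_left, hx, hy, add_zero]
      | smul c x _ hx => rw [inner_smul_left, hx, mul_zero]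
    rw [hs, Submodule.mem_bot] at this
    exact b.orthonormal.ne_zero i this
  calc Cardinal.mk I = Cardinal.mk (⋃ m : s, Function.support fun i => b.repr (m : E) i) := by
        rw [hU, Cardinal.mk_univ]
    _ ≤ Cardinal.mk s * ⨆ m : s, Cardinal.mk (Function.support fun i => b.repr (m : E) i) :=
        Cardinal.mk_iUnion_le _
    _ ≤ Cardinal.mk s * Cardinal.aleph0 := by
        gcongr
        exact ciSup_le' fun m => (hcount m).le_aleph0
    _ = Cardinal.mk s := Cardinal.mul_aleph0_eq (Cardinal.aleph0_le_mk s)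

theorem exists_jointlyOrthonormal_family (hE : ¬ FiniteDimensional ℂ E) {q : E →L[ℂ] E}
    (hq : ∀ x y, inner ℂ (q x) y = inner ℂ x (q y)) {I : Set E} (b : HilbertBasis I ℂ E) :
    ∃ v : Fin 2 × I → E, (∀ k, ‖v k‖ = 1) ∧
      ∀ k l, k ≠ l → inner ℂ (v k) (v l) = 0 ∧ inner ℂ (v k) (q (v l)) = 0 := by
  obtain ⟨s, hs⟩ := exists_maximal_isJointlyOrthonormal q
  have hbot := orthogonal_span_eq_bot_of_maximal hq hs
  have hinf := infinite_of_orthogonal_span_eq_bot hE hbot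
  have hsinf : s.Infinite := by
    intro hfin
    exact hinf (hfin.union (hfin.image q))
  have := hsinf.to_subtype
  have h2 : Cardinal.mk (Fin 2 × I) ≤ Cardinal.mk s := by
    have h1 : Cardinal.mk I ≤ Cardinal.mk s := by
      refine (b.mk_le_of_orthogonal_span_eq_bot hbot hinf).trans
        ((Cardinal.mk_union_le _ _).trans ?_)
      refine (add_le_add_right Cardinal.mk_image_le _).trans ?_
      rw [Cardinal.add_mk_eq_self]
    rw [Cardinal.mk_prod, Cardinal.lift_uzero, Cardinal.mk_fin, Cardinal.lift_natCast]
    refine (mul_le_mul_right h1 _).trans ?_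
    exact (Cardinal.mul_eq_right (Cardinal.aleph0_le_mk s)
      ((Cardinal.natCast_lt_aleph0).le.trans (Cardinal.aleph0_le_mk s)) (by norm_num)).le
  obtain ⟨e⟩ := Cardinal.le_def _ _ |>.1 h2
  refine ⟨fun k => e k, fun k => hs.1.1 _ (e k).2, fun k l hkl => hs.1.2 _ (e k).2 _ (e l).2 ?_⟩
  exact fun h => hkl (e.injective (Subtype.ext h))

end

section

variable {E : Type*} [NormedAddCommGroup E] [InnerProductSpace ℂ E]

theorem HilbertBasis.exists_isometry [CompleteSpace E] {I : Type*} (b : HilbertBasis I ℂ E)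
    {v : I → E} (hv : Orthonormal ℂ v) :
    ∃ r : E →ₗᵢ[ℂ] E, ∀ x, HasSum (fun i => b.repr x i • v i) (r x) :=
  ⟨hv.orthogonalFamily.linearIsometry.comp b.repr.toLinearIsometry, fun x =>
    hv.orthogonalFamily.hasSum_linearIsometry (b.repr x)⟩

theorem exists_isometries_of_not_finiteDimensional [CompleteSpace E]
    (hE : ¬ FiniteDimensional ℂ E) {q : E →L[ℂ] E}
    (hq : ∀ x y, inner ℂ (q x) y = inner ℂ x (q y)) :
    ∃ r : Fin 2 → E →ₗᵢ[ℂ] E,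
      ∀ x y, inner ℂ (r 0 x) (r 1 y) = 0 ∧ inner ℂ (r 0 x) (q (r 1 y)) = 0 := by
  obtain ⟨I, b, -⟩ := exists_hilbertBasis ℂ E
  obtain ⟨v, hv1, hv⟩ := exists_jointlyOrthonormal_family hE hq b
  have hv' : ∀ i, Orthonormal ℂ fun k => v (i, k) := fun i =>
    ⟨fun k => hv1 _, fun k l hkl => (hv _ _ fun h => hkl (Prod.ext_iff.1 h).2).1⟩
  choose r hr using fun i => b.exists_isometry (hv' i)
  have key : ∀ (a : E →L[ℂ] E), (∀ k l, inner ℂ (v (0, k)) (a (v (1, l))) = 0) →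
      ∀ x y, inner ℂ (r 0 x) (a (r 1 y)) = 0 := by
    intro a ha x y
    have h1 : ∀ k, inner ℂ (v (0, k)) (a (r 1 y)) = 0 := fun k => by
      have := ((hr 1 y).mapL a).mapL (innerSL ℂ (v (0, k)))
      refine this.unique ?_
      simp [ha, hasSum_zero]
    rw [inner_eq_zero_symm]
    have := (hr 0 x).mapL (innerSL ℂ (a (r 1 y)))
    refine this.unique ?_
    have h2 : ∀ k, inner ℂ (a (r 1 y)) (v (0, k)) = 0 := fun k => inner_eq_zero_symm.1 (h1 k)
    simp [h2, hasSum_zero]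
  have hne : ∀ k l : I, ((0 : Fin 2), k) ≠ (1, l) := fun k l h => by
    simpa using congrArg Prod.fst h
  exact ⟨r, fun x y => ⟨key (.id ℂ E) (fun k l => (hv _ _ (hne k l)).1) x y,
    key q (fun k l => (hv _ _ (hne k l)).2) x y⟩⟩

theorem hasCommutingRoom_continuousLinearMap [CompleteSpace E] (hE : ¬ FiniteDimensional ℂ E) :
    HasCommutingRoom (E →L[ℂ] E) := by
  intro p s hp hs
  have hp1 : ∀ x y, inner ℂ (p x) y = inner ℂ x (p y) := fun x y => by
    rw [← ContinuousLinearMap.adjoint_inner_right, ← ContinuousLinearMap.star_eq_adjoint,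
      hp.isSelfAdjoint.star_eq]
  have hp2 : ∀ x, p (p x) = p x := fun x => DFunLike.congr_fun hp.isIdempotentElem.eq x
  have hs1 : ∀ x, star s (s x) = x := fun x => DFunLike.congr_fun hs x
  have hs2 : ∀ x y, inner ℂ (s x) y = inner ℂ x (star s y) := fun x y => by
    rw [ContinuousLinearMap.star_eq_adjoint, ContinuousLinearMap.adjoint_inner_right]
  have hs3 : ∀ x y, inner ℂ x (s y) = inner ℂ (star s x) y := fun x y => by
    rw [ContinuousLinearMap.star_eq_adjoint, ContinuousLinearMap.adjoint_inner_left]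
  obtain ⟨r, hr⟩ := exists_isometries_of_not_finiteDimensional hE (q := star s * p * s)
    fun x y => by
      change inner ℂ (star s (p (s x))) y = inner ℂ x (star s (p (s y)))
      rw [← hs3, ← hs2, hp1]
  let t : Fin 2 → E →L[ℂ] E := fun i => s ∘L (r i).toContinuousLinearMap
  have ht : ∀ i x, t i x = s (r i x) := fun _ _ => rfl
  let M : Fin 2 → Submodule ℂ E := fun i =>
    ((t i).range ⊔ (p ∘L t i).range).topologicalClosure
  have hMp : ∀ i x, x ∈ M i → p x ∈ M i := by
    intro i x hx
    refine Set.MapsTo.closure (f := p) (t := ((t i).range ⊔ (p ∘L t i).range : Submodule ℂ E))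
      (fun y hy => ?_) p.continuous hx
    obtain ⟨_, ⟨a, rfl⟩, _, ⟨c, rfl⟩, rfl⟩ := Submodule.mem_sup.1 hy
    change p (t i a + p (t i c)) ∈ _
    rw [map_add, hp2, ← map_add, ← map_add]
    exact Submodule.mem_sup_right ⟨a + c, rfl⟩
  have hMt : ∀ i x, t i x ∈ M i := fun i x =>
    subset_closure (Submodule.mem_sup_left ⟨x, rfl⟩)
  have hMc : ∀ i, CompleteSpace (M i) := fun i =>
    (Submodule.isClosed_topologicalClosure _).completeSpace_coe
  have hMo : M 0 ⟂ M 1 := by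
    have h1 : ∀ x y, inner ℂ (t 0 x) (t 1 y) = 0 := fun x y => by
      rw [ht, ht, hs2, hs1]
      exact (hr x y).1
    have h2 : ∀ x y, inner ℂ (t 0 x) (p (t 1 y)) = 0 := fun x y => by
      rw [ht, ht, hs2]
      exact (hr x y).2
    have h3 : ((t 0).range ⊔ (p ∘L t 0).range) ⟂ ((t 1).range ⊔ (p ∘L t 1).range) := by
      rw [Submodule.isOrtho_iff_inner_eq]
      intro u hu w hw
      obtain ⟨_, ⟨a, rfl⟩, _, ⟨c, rfl⟩, rfl⟩ := Submodule.mem_sup.1 hu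
      obtain ⟨_, ⟨a', rfl⟩, _, ⟨c', rfl⟩, rfl⟩ := Submodule.mem_sup.1 hw
      change inner ℂ (t 0 a + p (t 0 c)) (t 1 a' + p (t 1 c')) = 0
      rw [inner_add_left, inner_add_right, inner_add_right, hp1, hp1, hp2, h1, h2, h2, h2]
      simp
    rw [Submodule.isOrtho_iff_le, Submodule.orthogonal_closure]
    exact Submodule.topologicalClosure_minimal _ h3 (Submodule.isClosed_orthogonal _)
  refine ⟨fun i => (M i).starProjection, t, fun i => isStarProjection_starProjection, fun i => ?_,
    hMo.starProjection_comp_starProjection, fun i => ⟨?_, ?_, ?_⟩⟩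
  · have h1 : ∀ x, (M i).starProjection (p ((M i).starProjection x)) =
        p ((M i).starProjection x) := fun x =>
      Submodule.starProjection_eq_self_iff.2 (hMp i _ (Submodule.starProjection_apply_mem _ _))
    have h2 : (M i).starProjection * p * (M i).starProjection = p * (M i).starProjection :=
      ContinuousLinearMap.ext h1
    have h3 := congrArg star h2
    simp only [star_mul, hp.isSelfAdjoint.star_eq,
      (isStarProjection_starProjection (U := M i)).isSelfAdjoint.star_eq] at h3
    rw [← h3, ← mul_assoc, h2]
  · ext x
    refine ext_inner_left ℂ fun y => ?_
    change inner ℂ y (star (t i) (t i x)) = inner ℂ y x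
    rw [ContinuousLinearMap.star_eq_adjoint, ContinuousLinearMap.adjoint_inner_right, ht, ht, hs2,
      hs1, LinearIsometry.inner_map_map]
  · ext x
    exact Submodule.starProjection_eq_self_iff.2 (hMt i x)
  · ext x
    change s (star s (s (r i x))) = s (r i x)
    rw [hs1]

end

theorem hasLinearExtension_continuousLinearMap {H : Type*} [NormedAddCommGroup H]
    [InnerProductSpace ℂ H] [CompleteSpace H]
    (hdim : ¬ FiniteDimensional ℂ H ∨ 2 < Module.finrank ℂ H) : HasLinearExtension (H →L[ℂ] H) := by
  by_cases h : FiniteDimensional ℂ H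
  · exact hasLinearExtension_of_finrank (hdim.resolve_left (not_not.2 h))
  · exact (nonempty_amplification h).some.hasLinearExtension hasCorner_continuousLinearMap
      (hasCommutingRoom_continuousLinearMap h)

section

variable {A : Type*} [CStarAlgebra A]

theorem HasProjBound.ext (h : HasProjBound A) {Φ Ψ : A →ₗ[ℂ] ℂ}
    (h0 : ∀ p, IsStarProjection p → Φ p = Ψ p) : Φ = Ψ :=
  sub_eq_zero.1 (h.eq_zero (Φ - Ψ) fun p hp => by rw [LinearMap.sub_apply, h0 p hp, sub_self])

theorem HasProjBound.exists_bilinear (hB : HasProjBound A) (hL : HasLinearExtension A)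
    {d : A → A → ℂ} {K : ℝ} (h1 : ∀ q, IsStarProjection q → IsProjCharge (fun p => d p q) K)
    (h2 : ∀ p, IsStarProjection p → IsProjCharge (d p) K) :
    ∃ D : A →ₗ[ℂ] A →ₗ[ℂ] ℂ, (∃ C : ℝ, ∀ x y, ‖D x y‖ ≤ C * ‖x‖ * ‖y‖) ∧
      ∀ p q, IsStarProjection p → IsStarProjection q → D p q = d p q := by
  obtain ⟨C, hC0, hC⟩ := id hB
  have hΦ : ∀ q : A, ∃ Φ : A →ₗ[ℂ] ℂ, IsStarProjection q →
      ∀ p, IsStarProjection p → Φ p = d p q := fun q => by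
    by_cases hq : IsStarProjection q
    · obtain ⟨Φ, hΦ⟩ := hL _ K (h1 q hq)
      exact ⟨Φ, fun _ => hΦ⟩
    · exact ⟨0, fun h => absurd h hq⟩
  choose Φ hΦ using hΦ
  have hcharge : ∀ x, IsProjCharge (fun q => Φ q x) (C * K * ‖x‖) := fun x => by
    refine ⟨fun p q hp hq hpq => ?_, fun q hq => hC _ K (fun p hp => ?_) x⟩
    · have : Φ (p + q) = Φ p + Φ q := hB.ext fun e he => by
        rw [hΦ _ (hp.add hq hpq) e he, LinearMap.add_apply, hΦ p hp e he, hΦ q hq e he]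
        exact (h2 e he).add p q hp hq hpq
      exact DFunLike.congr_fun this x
    · rw [hΦ q hq p hp]
      exact (h1 q hq).bound p hp
  choose Ψ hΨ using fun x => hL _ _ (hcharge x)
  refine ⟨{ toFun := Ψ, map_add' := fun x y => hB.ext fun q hq => ?_,
            map_smul' := fun c x => hB.ext fun q hq => ?_ }, ⟨C * (C * K), fun x y => ?_⟩,
    fun p q hp hq => ?_⟩
  · rw [LinearMap.add_apply, hΨ _ q hq, hΨ _ q hq, hΨ _ q hq, map_add]
  · rw [LinearMap.smul_apply, hΨ _ q hq, hΨ _ q hq, map_smul, RingHom.id_apply]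
  · refine (hC (Ψ x) (C * K * ‖x‖) (fun q hq => ?_) y).trans_eq (by ring)
    rw [hΨ x q hq]
    exact (hcharge x).bound q hq
  · change Ψ p q = d p q
    rw [hΨ p q hq, hΦ q hq p hp]

end

/-- Wright's extension theorem.  A decoherence functional `d` on a
complex Hilbert space `H` (infinite dimensional or of finite dimension `> 2`)
extends to a bounded bilinear form on `B(H) × B(H)` iff `d` is bounded, and in
the bounded case the extension is unique. -/
theorem wright_extension
    (hdim : ¬ FiniteDimensional ℂ H ∨ 2 < Module.finrank ℂ H)
    (d : (H →L[ℂ] H) → (H →L[ℂ] H) → ℂ)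
    (hpos : ∀ p : H →L[ℂ] H, IsSelfAdjoint p → p * p = p →
      (d p p).im = 0 ∧ 0 ≤ (d p p).re)
    (hherm : ∀ p q : H →L[ℂ] H, IsSelfAdjoint p → p * p = p →
      IsSelfAdjoint q → q * q = q → d p q = (starRingEnd ℂ) (d q p))
    (hnorm : d 1 1 = 1)
    (hzero : ∀ p : H →L[ℂ] H, IsSelfAdjoint p → p * p = p → d 0 p = 0)
    (hadd : ∀ p₁ p₂ q : H →L[ℂ] H, IsSelfAdjoint p₁ → p₁ * p₁ = p₁ →
      IsSelfAdjoint p₂ → p₂ * p₂ = p₂ → IsSelfAdjoint q → q * q = q → p₁ * p₂ = 0 →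
      d (p₁ + p₂) q = d p₁ q + d p₂ q) :
    ((∃ D : (H →L[ℂ] H) → (H →L[ℂ] H) → ℂ, IsBoundedBilinearExtension d D) ↔
      (∃ C : ℝ, ∀ p q : H →L[ℂ] H, IsSelfAdjoint p → p * p = p →
        IsSelfAdjoint q → q * q = q → ‖d p q‖ ≤ C)) ∧
    ((∃ C : ℝ, ∀ p q : H →L[ℂ] H, IsSelfAdjoint p → p * p = p →
        IsSelfAdjoint q → q * q = q → ‖d p q‖ ≤ C) →
      ∀ D D' : (H →L[ℂ] H) → (H →L[ℂ] H) → ℂ,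
        IsBoundedBilinearExtension d D → IsBoundedBilinearExtension d D' → D = D') := by
  have hsp : ∀ {p : H →L[ℂ] H}, IsStarProjection p → IsSelfAdjoint p ∧ p * p = p :=
    fun hp => ⟨hp.isSelfAdjoint, hp.isIdempotentElem⟩
  have hB := hasProjBound_continuousLinearMap H
  refine ⟨⟨?_, ?_⟩, ?_⟩
  · rintro ⟨D, -, -, -, -, ⟨C, hC⟩, hD⟩
    refine ⟨max C 0, fun p q hp hp' hq hq' => ?_⟩
    have h1 : ‖p‖ ≤ 1 := IsStarProjection.norm_le p ⟨hp', hp⟩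
    have h2 : ‖q‖ ≤ 1 := IsStarProjection.norm_le q ⟨hq', hq⟩
    rw [← hD p q hp hp' hq hq']
    calc ‖D p q‖ ≤ C * ‖p‖ * ‖q‖ := hC p q
      _ ≤ max C 0 * 1 * 1 := by gcongr; exact le_max_left _ _
      _ = max C 0 := by ring
  · rintro ⟨K, hK⟩
    have h1 : ∀ q, IsStarProjection q → IsProjCharge (fun p => d p q) K := fun q hq =>
      ⟨fun p p' hp hp' hpp' => hadd p p' q (hsp hp).1 (hsp hp).2 (hsp hp').1 (hsp hp').2
        (hsp hq).1 (hsp hq).2 hpp',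
       fun p hp => hK p q (hsp hp).1 (hsp hp).2 (hsp hq).1 (hsp hq).2⟩
    have hherm' : ∀ p q : H →L[ℂ] H, IsStarProjection p → IsStarProjection q →
        d p q = (starRingEnd ℂ) (d q p) := fun p q hp hq =>
      hherm p q (hsp hp).1 (hsp hp).2 (hsp hq).1 (hsp hq).2
    have h2 : ∀ p, IsStarProjection p → IsProjCharge (d p) K := fun p hp =>
      ⟨fun q q' hq hq' hqq' => by
        rw [hherm' _ _ hp (hq.add hq' hqq'), hherm' _ _ hp hq, hherm' _ _ hp hq', ← map_add,
          (h1 p hp).add q q' hq hq' hqq'],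
       fun q hq => (h1 q hq).bound p hp⟩
    obtain ⟨D, hDC, hD⟩ := hB.exists_bilinear (hasLinearExtension_continuousLinearMap hdim) h1 h2
    exact ⟨fun x y => D x y, fun x x' y => by simp, fun c x y => by simp,
      fun x y y' => by simp, fun c x y => by simp, hDC,
      fun p q hp hp' hq hq' => hD p q ⟨hp', hp⟩ ⟨hq', hq⟩⟩
  · rintro - D D' ⟨hl, hls, hr, hrs, -, hD⟩ ⟨hl', hls', hr', hrs', -, hD'⟩
    let F : (H →L[ℂ] H) → (H →L[ℂ] H) →ₗ[ℂ] ℂ := fun x =>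
      { toFun := D x, map_add' := hr x, map_smul' := fun c => hrs c x }
    let F' : (H →L[ℂ] H) → (H →L[ℂ] H) →ₗ[ℂ] ℂ := fun x =>
      { toFun := D' x, map_add' := hr' x, map_smul' := fun c => hrs' c x }
    have key : ∀ x, F x = F' x := fun x => hB.ext fun q hq => by
      let G : (H →L[ℂ] H) →ₗ[ℂ] ℂ :=
        { toFun := fun x => D x q, map_add' := fun x x' => hl x x' q
          map_smul' := fun c x => hls c x q }
      let G' : (H →L[ℂ] H) →ₗ[ℂ] ℂ :=
        { toFun := fun x => D' x q, map_add' := fun x x' => hl' x x' q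
          map_smul' := fun c x => hls' c x q }
      have hG : G = G' := hB.ext fun p hp => by
        change D p q = D' p q
        rw [hD p q (hsp hp).1 (hsp hp).2 (hsp hq).1 (hsp hq).2,
          hD' p q (hsp hp).1 (hsp hp).2 (hsp hq).1 (hsp hq).2]
      exact DFunLike.congr_fun hG x
    funext x y
    exact DFunLike.congr_fun (key x) y
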